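/- Let k be an algebraically closed field with (d−1)! invertible in k, and let A = k[x_0, x_1, …, x_d]/(x_0² + x_1² + f(x_2,…,x_d)) for some polynomial f ∈ k[x_2,…,x_d]. Then the free A-module of rank d − 1 is cancellative; that is, every stably free A-module of rank d − 1 is free. -/

import Mathlib

/-- A module `P` over `A` is *cancellative* if `P ⊕ Aᵐ ≅ Q ⊕ Aᵐ` implies `P ≅ Q`
for every finitely generated projective `A`-module `Q` and every `m ≥ 0`. -/
def IsCancellative (A : Type) [CommRing A] (P : Type) [AddCommGroup P] [Module A P] : Prop :=
  ∀ (Q : Type) [AddCommGroup Q] [Module A Q], Module.Finite A Q → Module.Projective A Q →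
    ∀ m : ℕ, Nonempty ((P × (Fin m → A)) ≃ₗ[A] (Q × (Fin m → A))) → Nonempty (P ≃ₗ[A] Q)

set_option linter.unusedSectionVars false

section Rows

open scoped Matrix

variable {ι κ : Type*} [Fintype ι] [DecidableEq ι] [Fintype κ] [DecidableEq κ]
variable {R S : Type*} [CommRing R] [CommRing S]

/-- A vector is unimodular if its entries generate the unit ideal. -/
def Unimodular (a : ι → R) : Prop := ∃ b : ι → R, b ⬝ᵥ a = 1

/-- Two vectors are equivalent if an invertible matrix carries one to the other. -/
def RowEquiv (a b : ι → R) : Prop := ∃ M : Matrix ι ι R, IsUnit M ∧ M *ᵥ a = b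

/-- A vector is completable if it is a column of an invertible matrix. -/
def Completable (a : ι → R) : Prop := ∃ i, RowEquiv (Pi.single i 1) a

namespace RowEquiv

variable {a b c : ι → R}

theorem refl (a : ι → R) : RowEquiv a a := ⟨1, isUnit_one, Matrix.one_mulVec a⟩

theorem of_eq (h : a = b) : RowEquiv a b := h ▸ refl a

theorem symm (h : RowEquiv a b) : RowEquiv b a := by
  obtain ⟨M, ⟨u, rfl⟩, rfl⟩ := h
  refine ⟨↑u⁻¹, u⁻¹.isUnit, ?_⟩
  rw [Matrix.mulVec_mulVec, u.inv_mul, Matrix.one_mulVec]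

theorem trans (h : RowEquiv a b) (h' : RowEquiv b c) : RowEquiv a c := by
  obtain ⟨M, hM, rfl⟩ := h
  obtain ⟨N, hN, rfl⟩ := h'
  exact ⟨N * M, hN.mul hM, by rw [Matrix.mulVec_mulVec]⟩

theorem of_linearEquiv (e : (ι → R) ≃ₗ[R] (ι → R)) (h : e a = b) : RowEquiv a b := by
  refine ⟨LinearMap.toMatrix' (e : (ι → R) →ₗ[R] (ι → R)), ?_, ?_⟩
  · refine IsUnit.of_mul_eq_one (LinearMap.toMatrix' (e.symm : (ι → R) →ₗ[R] (ι → R))) ?_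
    rw [← LinearMap.toMatrix'_comp]
    simp
  · rw [← Matrix.toLin'_apply, Matrix.toLin'_toMatrix']
    exact h

theorem map (φ : R →+* S) (h : RowEquiv a b) : RowEquiv (φ ∘ a) (φ ∘ b) := by
  obtain ⟨M, hM, rfl⟩ := h
  refine ⟨φ.mapMatrix M, hM.map _, ?_⟩
  ext i
  simp [Matrix.mulVec, dotProduct]

theorem reindex (e : κ ≃ ι) (h : RowEquiv a b) : RowEquiv (a ∘ e) (b ∘ e) := by
  obtain ⟨M, hM, rfl⟩ := h
  refine ⟨M.submatrix e e, ?_, ?_⟩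
  · rw [Matrix.isUnit_iff_isUnit_det] at hM ⊢
    rwa [Matrix.det_submatrix_equiv_self]
  · rw [Matrix.submatrix_mulVec_equiv]
    simp [Function.comp_assoc]

theorem perm (σ : Equiv.Perm ι) (a : ι → R) : RowEquiv a (a ∘ σ) :=
  of_linearEquiv (LinearEquiv.funCongrLeft R R σ) rfl

theorem sumElim (h : RowEquiv a b) (c : κ → R) :
    RowEquiv (Sum.elim a c) (Sum.elim b c) := by
  obtain ⟨M, hM, rfl⟩ := h
  refine ⟨Matrix.fromBlocks M 0 0 1, ?_, ?_⟩
  · rw [Matrix.isUnit_iff_isUnit_det] at hM ⊢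
    simpa using hM
  · simp [Matrix.fromBlocks_mulVec]

theorem add_mul (a : ι → R) {i j : ι} (hij : i ≠ j) (c : R) :
    RowEquiv a (Function.update a i (a i + c * a j)) := by
  refine ⟨Matrix.transvection i j c, ?_, ?_⟩
  · rw [Matrix.isUnit_iff_isUnit_det, Matrix.det_transvection_of_ne i j hij]
    exact isUnit_one
  · ext l
    rcases eq_or_ne l i with rfl | hl
    · simp [Matrix.transvection, Matrix.add_mulVec, Matrix.single_mulVec]
    · simp [Matrix.transvection, Matrix.add_mulVec, Matrix.single_mulVec, hl]

theorem add_mem (a : ι → R) (i : ι) {x : R} (hx : x ∈ Ideal.span (a '' {j | j ≠ i})) :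
    RowEquiv a (Function.update a i (a i + x)) := by
  suffices H : ∀ t : R, RowEquiv (Function.update a i t) (Function.update a i (t + x)) by
    simpa using H (a i)
  induction hx using Submodule.span_induction with
  | mem x h =>
    obtain ⟨j, hj, rfl⟩ := h
    intro t
    have := add_mul (Function.update a i t) (Ne.symm hj : i ≠ j) 1
    simpa [Function.update_of_ne hj] using this
  | zero => intro t; simpa using refl _
  | add x y _ _ hx hy =>
    intro t
    rw [← add_assoc]
    exact (hx t).trans (hy _)
  | smul c x hx' ih =>
    intro t
    clear ih
    induction hx' using Submodule.span_induction generalizing t c with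
    | mem x h =>
      obtain ⟨j, hj, rfl⟩ := h
      have := add_mul (Function.update a i t) (Ne.symm hj : i ≠ j) c
      simpa [Function.update_of_ne hj] using this
    | zero => simpa using refl _
    | add x y _ _ hx hy =>
      rw [smul_add, ← add_assoc]
      exact (hx c t).trans (hy c _)
    | smul d x _ ih =>
      rw [smul_smul]
      exact ih _ _

theorem block (a : ι → R) {i j : ι} (hij : i ≠ j) {p q r s : R} (h : p * s - q * r = 1) :
    RowEquiv a (Function.update (Function.update a i (p * a i + q * a j)) j
      (r * a i + s * a j)) := by
  refine of_linearEquiv (LinearEquiv.ofLinearMap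
    (LinearMap.pi fun l => if l = j then r • LinearMap.proj i + s • LinearMap.proj j else
      if l = i then p • LinearMap.proj i + q • LinearMap.proj j else LinearMap.proj l)
    (LinearMap.pi fun l => if l = j then (-r) • LinearMap.proj i + p • LinearMap.proj j else
      if l = i then s • LinearMap.proj i + (-q) • LinearMap.proj j else LinearMap.proj l)
    ?_ ?_) ?_
  · refine LinearMap.ext fun x => funext fun l => ?_
    by_cases hj : l = j
    · subst hj; simp [hij]; linear_combination (x l) * h
    by_cases hi : l = i
    · subst hi; simp [hij]; linear_combination (x l) * h
    simp [hj, hi]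
  · refine LinearMap.ext fun x => funext fun l => ?_
    by_cases hj : l = j
    · subst hj; simp [hij]; linear_combination (x l) * h
    by_cases hi : l = i
    · subst hi; simp [hij]; linear_combination (x l) * h
    simp [hj, hi]
  · ext l
    by_cases hj : l = j
    · subst hj; simp
    by_cases hi : l = i
    · subst hi; simp [hij]
    simp [hj, hi]

theorem unit_mul (a : ι → R) (i : ι) {u : R} (hu : IsUnit u) :
    RowEquiv a (Function.update a i (u * a i)) := by
  refine ⟨Matrix.diagonal (Function.update 1 i u), ?_, ?_⟩
  · rw [Matrix.isUnit_iff_isUnit_det, Matrix.det_diagonal]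
    rw [Finset.prod_update_of_mem (Finset.mem_univ i)]
    simpa using hu
  · ext l
    rw [Matrix.mulVec_diagonal]
    rcases eq_or_ne l i with rfl | hl
    · simp
    · simp [hl]

theorem unimodular (h : RowEquiv a b) (ha : Unimodular a) : Unimodular b := by
  obtain ⟨M, ⟨u, rfl⟩, rfl⟩ := h
  obtain ⟨c, hc⟩ := ha
  refine ⟨Matrix.vecMul c (↑u⁻¹ : Matrix ι ι R), ?_⟩
  rw [Matrix.dotProduct_mulVec, Matrix.vecMul_vecMul, u.inv_mul, Matrix.vecMul_one, hc]

theorem completable (h : RowEquiv a b) (ha : Completable a) : Completable b :=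
  ⟨ha.choose, ha.choose_spec.trans h⟩

theorem span_eq (h : RowEquiv a b) : Ideal.span (Set.range a) = Ideal.span (Set.range b) := by
  have key : ∀ {a b : ι → R}, RowEquiv a b →
      Ideal.span (Set.range b) ≤ Ideal.span (Set.range a) := by
    rintro a _ ⟨M, -, rfl⟩
    rw [Ideal.span_le]
    rintro _ ⟨i, rfl⟩
    exact Ideal.sum_mem _ fun j _ => Ideal.mul_mem_left _ _ (Ideal.subset_span ⟨j, rfl⟩)
  exact le_antisymm (key h.symm) (key h)

end RowEquiv

theorem unimodular_iff {a : ι → R} : Unimodular a ↔ Ideal.span (Set.range a) = ⊤ := by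
  rw [Ideal.eq_top_iff_one]
  exact (Ideal.mem_span_range_iff_exists_fun (x := (1 : R)) (v := a)).symm

theorem Unimodular.map {a : ι → R} (φ : R →+* S) (h : Unimodular a) : Unimodular (φ ∘ a) := by
  obtain ⟨b, hb⟩ := h
  refine ⟨φ ∘ b, ?_⟩
  rw [← map_one φ, ← hb]
  simp [dotProduct]

theorem Unimodular.reindex {a : ι → R} (e : κ ≃ ι) (h : Unimodular a) :
    Unimodular (a ∘ e) := by
  obtain ⟨b, hb⟩ := h
  refine ⟨b ∘ e, ?_⟩
  rw [← hb]
  simp [dotProduct, e.sum_comp (fun i => b i * a i)]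

theorem Completable.map {a : ι → R} (φ : R →+* S) (h : Completable a) :
    Completable (φ ∘ a) := by
  obtain ⟨i, h⟩ := h
  refine ⟨i, (RowEquiv.of_eq ?_).trans (h.map φ)⟩
  ext j
  simp [Pi.single_apply, apply_ite φ]

theorem Completable.reindex {a : ι → R} (e : κ ≃ ι) (h : Completable a) :
    Completable (a ∘ e) := by
  obtain ⟨i, h⟩ := h
  refine ⟨e.symm i, (RowEquiv.of_eq ?_).trans (h.reindex e)⟩
  ext j
  simp [Pi.single_apply, Equiv.eq_symm_apply]

theorem rowEquiv_single (i j : ι) : RowEquiv (Pi.single i 1 : ι → R) (Pi.single j 1) := by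
  refine (RowEquiv.perm (Equiv.swap i j) _).trans (RowEquiv.of_eq ?_)
  ext l
  simp only [Function.comp, Pi.single_apply, Equiv.swap_apply_eq_iff, Equiv.swap_apply_left]

theorem Completable.rowEquiv {a : ι → R} (h : Completable a) (i : ι) :
    RowEquiv (Pi.single i 1) a := (rowEquiv_single i _).trans h.choose_spec

theorem completable_of_isUnit {a : ι → R} (i : ι) (h : IsUnit (a i)) : Completable a := by
  refine ⟨i, (1 : Matrix ι ι R).updateCol i a, ?_, ?_⟩
  · rw [Matrix.isUnit_iff_isUnit_det, ← Matrix.cramer_apply, Matrix.cramer_one]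
    exact h
  · ext j
    simp

end Rows

section SuslinPowers

open scoped Matrix

variable {ι ρ : Type*} [Fintype ι] [DecidableEq ι] [Fintype ρ] [DecidableEq ρ]
variable {R : Type*} [CommRing R]

theorem exists_isUnit_block {i j : ι} (hij : i ≠ j) {p q r s : R} (h : p * s - q * r = 1) :
    ∃ M : Matrix ι ι R, IsUnit M ∧ ∀ l m, M l m =
      if l = j then (if m = i then r else if m = j then s else 0) else
      if l = i then (if m = i then p else if m = j then q else 0) else
      if l = m then 1 else 0 := by
  let N (p q r s : R) : Matrix ι ι R := fun l m =>
      if l = j then (if m = i then r else if m = j then s else 0) else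
      if l = i then (if m = i then p else if m = j then q else 0) else
      if l = m then 1 else 0
  refine ⟨N p q r s, IsUnit.of_mul_eq_one (N s (-q) (-r) p) ?_, fun _ _ => rfl⟩
  have key : ∀ (p q r s : R) (v : ι → R) (l : ι), (N p q r s *ᵥ v) l =
      if l = j then r * v i + s * v j else if l = i then p * v i + q * v j else v l := by
    intro p q r s v l
    have aux : ∀ x y : R, ∑ m, (if m = i then x else if m = j then y else 0) * v m =
        x * v i + y * v j := by
      intro x y
      have : ∀ m, (if m = i then x else if m = j then y else 0) * v m =
          (if m = i then x * v m else 0) + (if m = j then y * v m else 0) := by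
        intro m
        by_cases h1 : m = i
        · simp [h1, hij]
        · by_cases h2 : m = j <;> simp [h1, h2, hij.symm]
      simp [this, Finset.sum_add_distrib]
    simp only [Matrix.mulVec, dotProduct, N]
    split_ifs
    · exact aux r s
    · exact aux p q
    · simp
  refine Matrix.toLin'.injective (LinearMap.ext fun v => funext fun l => ?_)
  simp only [Matrix.toLin'_mul, LinearMap.comp_apply, Matrix.toLin'_apply, Matrix.one_mulVec]
  rw [key]
  by_cases hj : l = j
  · subst hj; simp [hij, key]; linear_combination (v l) * h
  by_cases hi : l = i
  · subst hi; simp [hij, key]; linear_combination (v l) * h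
  simp [hj, hi, key]

/-- A diagonal matrix with determinant one modulo an ideal, with entries a power of `b` and
inverses of `b`, lifts to an invertible matrix. -/
theorem exists_isUnit_lift_diagonal (I : Ideal R) {b s : R}
    (hbs : Ideal.Quotient.mk I (b * s) = 1) (i : ι) (T : Finset ι) (hT : i ∉ T) :
    ∃ M : Matrix ι ι R, IsUnit M ∧ (Ideal.Quotient.mk I).mapMatrix M =
      Matrix.diagonal (fun j => Ideal.Quotient.mk I
        (if j = i then b ^ T.card else if j ∈ T then s else 1)) := by
  induction T using Finset.induction_on with
  | empty => exact ⟨1, isUnit_one, by ext j l; simp [Matrix.diagonal_apply, Matrix.one_apply]⟩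
  | insert j T hj ih =>
    obtain ⟨hij, hiT⟩ : i ≠ j ∧ i ∉ T := by simpa using hT
    obtain ⟨M, hM, hM'⟩ := ih hiT
    obtain ⟨N, hN, hN'⟩ := exists_isUnit_block hij (p := 2 * b - b ^ 2 * s) (q := b * s - 1)
      (r := 1 - b * s) (s := s) (by ring)
    refine ⟨N * M, hN.mul hM, ?_⟩
    have e : (Ideal.Quotient.mk I).mapMatrix N = Matrix.diagonal (fun l => Ideal.Quotient.mk I
        (if l = i then b else if l = j then s else 1)) := by
      have hb : Ideal.Quotient.mk I b * Ideal.Quotient.mk I s = 1 := by rw [← map_mul, hbs]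
      ext l m
      simp only [RingHom.mapMatrix_apply, Matrix.map_apply, hN', Matrix.diagonal_apply]
      by_cases hlj : l = j
      · subst hlj
        by_cases hm : m = l
        · subst hm; simp [hij.symm]
        · by_cases hmi : m = i
          · subst hmi; simp [hij.symm, hb]
          · simp [hm, hmi, Ne.symm hm]
      by_cases hli : l = i
      · subst hli
        by_cases hm : m = l
        · subst hm; simp [hij, two_mul]; linear_combination (-Ideal.Quotient.mk I b) * hb
        · by_cases hmi : m = j
          · subst hmi; simp [hij, hij.symm, hb]
          · simp [hm, hmi, Ne.symm hm, hij]
      · rw [if_neg hlj, if_neg hli, if_neg hli, if_neg hlj]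
        by_cases hlm : l = m <;> simp [hlm]
    rw [map_mul, e, hM', Matrix.diagonal_mul_diagonal]
    congr 1
    ext l
    rw [← map_mul]
    congr 1
    by_cases hli : l = i
    · subst hli; simp [hj, pow_succ']
    · by_cases hlj : l = j
      · subst hlj; simp [hij.symm, hj]
      · simp [hli, hlj]

theorem completable_sumElim_aux (α : Matrix (Unit ⊕ ρ) (Unit ⊕ ρ) R) (b : R)
    (h : IsUnit (Ideal.Quotient.mk (Ideal.span {b}) α.det)) :
    Completable (Sum.elim (α.col (Sum.inl ()))
      (fun _ : Unit => b ^ (Fintype.card ρ + 1))) := by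
  obtain ⟨c, hc⟩ := h.exists_right_inv
  obtain ⟨e, rfl⟩ := Ideal.Quotient.mk_surjective c
  rw [← map_mul, ← map_one (Ideal.Quotient.mk _), Ideal.Quotient.eq,
    Ideal.mem_span_singleton'] at hc
  obtain ⟨t, ht⟩ := hc
  set δ := α.det
  have hbs : Ideal.Quotient.mk (Ideal.span {δ}) (b * -t) = 1 := by
    rw [← map_one (Ideal.Quotient.mk _), Ideal.Quotient.eq, Ideal.mem_span_singleton']
    exact ⟨-e, by linear_combination ht⟩
  obtain ⟨ε, hε, hε'⟩ := exists_isUnit_lift_diagonal (Ideal.span {δ}) hbs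
    (Sum.inl () : Unit ⊕ ρ) (Finset.univ.erase (Sum.inl ())) (by simp)
  let D : Matrix (Unit ⊕ ρ) (Unit ⊕ ρ) R :=
    Matrix.diagonal fun j => if j = Sum.inl () then b ^ (Fintype.card ρ + 1) else 1
  have hZ : ∀ l m, ∃ z, z * δ = b * ε l m - D l m := by
    intro l m
    rw [← Ideal.mem_span_singleton', ← Ideal.Quotient.eq, map_mul]
    have := congrFun (congrFun hε' l) m
    simp only [RingHom.mapMatrix_apply, Matrix.map_apply] at this
    rw [this]
    by_cases hlm : l = m
    · subst hlm
      by_cases hl : l = Sum.inl ()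
      · simp [D, hl, pow_succ']
      · simp only [Matrix.diagonal_apply_eq, hl, D, ← map_mul]
        simpa [hl] using hbs
    · simp [D, hlm]
  choose Z hZ using hZ
  have hZ' : b • ε - δ • Matrix.of Z = D := by
    ext l m
    simp only [Matrix.sub_apply, Matrix.smul_apply, Matrix.of_apply, smul_eq_mul]
    linear_combination (-1 : R) * hZ l m
  have hadj : (e • α.adjugate) * α = (1 + b * t) • (1 : Matrix (Unit ⊕ ρ) (Unit ⊕ ρ) R) := by
    rw [Matrix.smul_mul, Matrix.adjugate_mul, smul_smul]
    congr 1
    linear_combination (-1 : R) * ht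
  have hadj' : α * (e • α.adjugate) = (1 + b * t) • (1 : Matrix (Unit ⊕ ρ) (Unit ⊕ ρ) R) := by
    rw [Matrix.mul_smul, Matrix.mul_adjugate, smul_smul]
    congr 1
    linear_combination (-1 : R) * ht
  let G := Matrix.fromBlocks α (t • 1) (b • 1) (e • α.adjugate)
  have hG : IsUnit G := by
    refine IsUnit.of_mul_eq_one
      (Matrix.fromBlocks (e • α.adjugate) (-t • 1) (-b • 1) α) ?_
    rw [Matrix.fromBlocks_multiply, hadj, hadj']
    refine Eq.trans ?_ Matrix.fromBlocks_one
    refine Matrix.fromBlocks_inj.2 ⟨?_, ?_, ?_, ?_⟩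
    · simp [smul_smul, add_smul]
    · simp
    · simp [smul_smul, mul_comm]
    · simp [smul_smul, add_smul, mul_comm]
  let H : Matrix ((Unit ⊕ ρ) ⊕ (Unit ⊕ ρ)) ((Unit ⊕ ρ) ⊕ (Unit ⊕ ρ)) R :=
    Matrix.fromBlocks 1 0 (-(Matrix.of Z * α.adjugate)) ε
  have hH : IsUnit H := by
    rw [Matrix.isUnit_iff_isUnit_det] at hε ⊢
    simpa [H] using hε
  have hHG : ∃ X Y, H * G = Matrix.fromBlocks α X D Y := by
    refine ⟨t • 1, -(Matrix.of Z * α.adjugate) * (t • 1) + ε * (e • α.adjugate), ?_⟩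
    rw [Matrix.fromBlocks_multiply]
    congr 1
    · simp
    · simp
    · rw [← hZ', Matrix.neg_mul, Matrix.mul_assoc, Matrix.adjugate_mul]
      simp [δ, sub_eq_neg_add]
  obtain ⟨X, Y, hXY⟩ := hHG
  have hu := hH.mul hG
  rw [hXY, ← Matrix.isUnit_submatrix_equiv (Equiv.sumAssoc (Unit ⊕ ρ) Unit ρ)
    ((Equiv.sumAssoc (Unit ⊕ ρ) Unit ρ).trans (Equiv.sumComm _ _)),
    ← Matrix.fromBlocks_toBlocks (Matrix.submatrix _ _ _)] at hu
  set B := (Matrix.fromBlocks α X D Y).submatrix (Equiv.sumAssoc (Unit ⊕ ρ) Unit ρ)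
    ((Equiv.sumAssoc (Unit ⊕ ρ) Unit ρ).trans (Equiv.sumComm _ _)) with hB
  have h22 : B.toBlocks₂₂ = 1 := by
    ext l m
    simp [hB, Matrix.toBlocks₂₂, D, Matrix.diagonal_apply, Matrix.one_apply]
  rw [h22, Matrix.isUnit_iff_isUnit_det, Matrix.det_fromBlocks_one₂₂,
    ← Matrix.isUnit_iff_isUnit_det] at hu
  refine ⟨Sum.inr (), _, hu, ?_⟩
  rw [Matrix.mulVec_single_one]
  ext (l | l)
  · simp [Matrix.col, Matrix.mul_apply, hB, Matrix.toBlocks₁₁, Matrix.toBlocks₂₁, D]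
  · simp [Matrix.col, Matrix.mul_apply, hB, Matrix.toBlocks₁₁, Matrix.toBlocks₂₁, D]

theorem completable_snoc_pow {r : ℕ} (α : Matrix (Fin (r + 1)) (Fin (r + 1)) R) (b : R)
    (h : IsUnit (Ideal.Quotient.mk (Ideal.span {b}) α.det)) :
    Completable (Fin.snoc (α.col 0) (b ^ (r + 1)) : Fin (r + 2) → R) := by
  let e : Unit ⊕ Fin r ≃ Fin (r + 1) := (Equiv.sumComm _ _).trans
    ((Equiv.optionEquivSumPUnit (Fin r)).symm.trans (finSuccEquiv r).symm)
  have he : e (Sum.inl ()) = 0 := by simp [e]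
  have h1 := completable_sumElim_aux (α.submatrix e e) b
    (by rwa [Matrix.det_submatrix_equiv_self])
  rw [Fintype.card_fin] at h1
  have h2 := h1.reindex ((finSuccEquivLast (n := r + 1)).trans
    ((Equiv.optionEquivSumPUnit (Fin (r + 1))).trans (Equiv.sumCongr e.symm (Equiv.refl Unit))))
  convert h2 using 1
  ext j
  induction j using Fin.lastCases with
  | last => simp
  | cast j => simp [he, Matrix.col]

/-- Suslin's theorem on powers of unimodular rows. -/
theorem completable_factorial_powers (r : ℕ) : ∀ {R : Type*} [CommRing R] (a : Fin (r + 1) → R),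
    Unimodular a → Completable (fun i => a i ^ max 1 (i : ℕ)) := by
  induction r with
  | zero =>
    intro R _ a ⟨b, hb⟩
    refine completable_of_isUnit 0 ?_
    have h0 : b 0 * a 0 = 1 := by simpa [dotProduct] using hb
    simpa using IsUnit.of_mul_eq_one_right _ h0
  | succ r ih =>
    intro R _ a ha
    set q := Ideal.Quotient.mk (Ideal.span {a (Fin.last (r + 1))})
    have h1 : Unimodular (fun i : Fin (r + 1) => q (a i.castSucc)) := by
      obtain ⟨b, hb⟩ := ha
      refine ⟨fun i => q (b i.castSucc), ?_⟩
      rw [← map_one q, ← hb, dotProduct, dotProduct, Fin.sum_univ_castSucc (n := r + 1), map_add]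
      have : q (a (Fin.last (r + 1))) = 0 :=
        Ideal.Quotient.eq_zero_iff_mem.2 (Ideal.mem_span_singleton_self _)
      simp [this]
    obtain ⟨M, hM, hM'⟩ := (ih _ h1).rowEquiv 0
    rw [Matrix.mulVec_single_one] at hM'
    choose L hL using fun i j => Ideal.Quotient.mk_surjective (M i j)
    let α : Matrix (Fin (r + 1)) (Fin (r + 1)) R :=
      (Matrix.of L).updateCol 0 (fun i => a i.castSucc ^ max 1 (i : ℕ))
    have hα : q.mapMatrix α = M := by
      ext i j
      rcases eq_or_ne j 0 with rfl | hj
      · simpa [α] using (congrFun hM' i).symm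
      · simpa [α, hj] using hL i j
    have h3 := completable_snoc_pow α (a (Fin.last (r + 1))) (by
      rw [Matrix.isUnit_iff_isUnit_det, ← hα, ← RingHom.map_det] at hM
      exact hM)
    convert h3 using 1
    ext j
    induction j using Fin.lastCases with
    | last => simp
    | cast j => simp [α, Matrix.col]

end SuslinPowers

section Nagata

open MvPolynomial NoetherNormalization

variable {k : Type*} [Field k] {n : ℕ} (f : MvPolynomial (Fin (n + 1)) k)
variable (v w : Fin (n + 1) →₀ ℕ)

theorem T1_comp_T1_neg (c : k) : (T1 f c).comp (T1 f (-c)) = AlgHom.id _ _ := by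
  rw [comp_aeval, ← MvPolynomial.aeval_X_left]
  ext i v
  cases i using Fin.cases <;> simp

/-- The automorphism of a polynomial ring used in Nagata's proof of Noether normalization. -/
noncomputable def nagataEquiv :
    MvPolynomial (Fin (n + 1)) k ≃ₐ[k] MvPolynomial (Fin (n + 1)) k :=
  AlgEquiv.ofAlgHom (T1 f 1) (T1 f (-1))
    (T1_comp_T1_neg f 1) (by simpa using T1_comp_T1_neg f (-1))

theorem sum_pow_mul_ne {N : ℕ} (hN : 1 < N) (vlt : ∀ i, v i < N) (wlt : ∀ i, w i < N)
    (ne : v ≠ w) :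
    ∑ x : Fin (n + 1), N ^ x.1 * v x ≠ ∑ x : Fin (n + 1), N ^ x.1 * w x := by
  intro h
  refine ne <| Finsupp.ext <| congrFun <| List.ofFn_inj.mp ?_
  refine Nat.ofDigits_inj_of_len_eq hN (by simp) ?_ ?_ ?_
  · intro l hl
    obtain ⟨i, rfl⟩ := List.mem_ofFn.1 hl
    exact vlt i
  · intro l hl
    obtain ⟨i, rfl⟩ := List.mem_ofFn.1 hl
    exact wlt i
  · simpa only [Nat.ofDigits_eq_sum_mapIdx, List.mapIdx_eq_ofFn, List.get_ofFn, List.length_ofFn,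
      Fin.val_cast, mul_comm, List.sum_ofFn] using! h

theorem degreeOf_zero_nagataEquiv {a : k} (ha : a ≠ 0) :
    (nagataEquiv f (monomial v a)).degreeOf 0 =
      ∑ i : Fin (n + 1), ((2 + f.totalDegree) ^ i.1) * v i := by
  rw [← natDegree_finSuccEquiv, monomial_eq, Finsupp.prod_pow v fun a ↦ X a]
  simp only [nagataEquiv, Fin.prod_univ_succ, Fin.sum_univ_succ, map_mul, map_prod, map_pow,
    AlgEquiv.ofAlgHom_apply, MvPolynomial.aeval_C, MvPolynomial.aeval_X, if_pos, Fin.succ_ne_zero,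
    ite_false, one_smul, map_add, finSuccEquiv_X_zero, finSuccEquiv_X_succ, algebraMap_eq]
  have h (i : Fin n) :
      (Polynomial.C (X (R := k) i) + Polynomial.X ^ ((2 + f.totalDegree) ^ i.succ.1)) ^ v i.succ
        ≠ 0 :=
    pow_ne_zero (v i.succ) (Polynomial.leadingCoeff_ne_zero.mp <| by
      simp [add_comm, Polynomial.leadingCoeff_X_pow_add_C])
  rw [Polynomial.natDegree_mul (by simp [ha]) (mul_ne_zero (by simp)
    (Finset.prod_ne_zero_iff.mpr (fun i _ ↦ h i))), Polynomial.natDegree_mul (by simp)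
    (Finset.prod_ne_zero_iff.mpr (fun i _ ↦ h i)),
    Polynomial.natDegree_prod _ _ (fun i _ ↦ h i), natDegree_finSuccEquiv, degreeOf_C]
  simpa only [Polynomial.natDegree_pow, zero_add, Polynomial.natDegree_X, mul_one, Fin.val_zero,
    pow_zero, one_mul, add_right_inj] using Finset.sum_congr rfl (fun i _ ↦ by
    rw [add_comm (Polynomial.C _), Polynomial.natDegree_X_pow_add_C, mul_comm])

theorem degreeOf_nagataEquiv_ne (hv : v ∈ f.support) (hw : w ∈ f.support) (ne : v ≠ w) :
    (nagataEquiv f <| monomial v <| coeff v f).degreeOf 0 ≠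
    (nagataEquiv f <| monomial w <| coeff w f).degreeOf 0 := by
  rw [degreeOf_zero_nagataEquiv _ _ <| mem_support_iff.mp hv,
    degreeOf_zero_nagataEquiv _ _ <| mem_support_iff.mp hw]
  refine sum_pow_mul_ne v w (by lia) (fun i ↦ ?_) (fun i ↦ ?_) ne <;>
  exact lt_of_le_of_lt ((monomial_le_degreeOf i ‹_›).trans (degreeOf_le_totalDegree f i))
    (by lia)

theorem leadingCoeff_finSuccEquiv_nagataEquiv_monomial :
    (finSuccEquiv k n ((nagataEquiv f) ((monomial v) (coeff v f)))).leadingCoeff =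
    algebraMap k _ (coeff v f) := by
  rw [monomial_eq, Finsupp.prod_fintype]
  · simp only [nagataEquiv, map_mul, map_prod, Polynomial.leadingCoeff_mul,
      Polynomial.leadingCoeff_prod]
    rw [AlgEquiv.ofAlgHom_apply, algHom_C, algebraMap_eq, finSuccEquiv_apply,
      eval₂Hom_C, RingHom.coe_comp]
    simp only [AlgEquiv.ofAlgHom_apply, Function.comp_apply, Polynomial.leadingCoeff_C, map_pow,
      Polynomial.leadingCoeff_pow, algebraMap_eq]
    have : ∀ j, ((finSuccEquiv k n) ((T1 f) 1 (X j))).leadingCoeff = 1 := fun j ↦ by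
      by_cases h : j = 0
      · simp [h, finSuccEquiv_apply]
      · simp only [aeval_eq_bind₁, bind₁_X_right, if_neg h, one_smul, map_add, map_pow]
        obtain ⟨i, rfl⟩ := Fin.exists_succ_eq.mpr h
        simp [finSuccEquiv_X_succ, finSuccEquiv_X_zero, add_comm]
    simp only [this, one_pow, Finset.prod_const_one, mul_one]
  exact fun i ↦ pow_zero _

theorem isUnit_leadingCoeff_nagataEquiv (fne : f ≠ 0) :
    IsUnit (finSuccEquiv k n (nagataEquiv f f)).leadingCoeff := by
  obtain ⟨v, vin, vs⟩ := Finset.exists_max_image f.support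
    (fun v ↦ (nagataEquiv f ((monomial v) (coeff v f))).degreeOf 0) (support_nonempty.mpr fne)
  set h := fun w ↦ (MvPolynomial.monomial w) (coeff w f)
  simp only [← natDegree_finSuccEquiv] at vs
  replace vs : ∀ x ∈ f.support \ {v}, (finSuccEquiv k n ((nagataEquiv f) (h x))).degree <
      (finSuccEquiv k n ((nagataEquiv f) (h v))).degree := by
    intro x hx
    obtain ⟨h1, h2⟩ := Finset.mem_sdiff.mp hx
    apply Polynomial.degree_lt_degree <| lt_of_le_of_ne (vs x h1) ?_
    simpa only [natDegree_finSuccEquiv]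
      using degreeOf_nagataEquiv_ne f _ _ h1 vin <| by simpa using h2
  have coeff : (finSuccEquiv k n ((nagataEquiv f)
      (h v + ∑ x ∈ f.support \ {v}, h x))).leadingCoeff =
      (finSuccEquiv k n ((nagataEquiv f) (h v))).leadingCoeff := by
    simp only [map_add, map_sum]
    rw [add_comm]
    apply Polynomial.leadingCoeff_add_of_degree_lt <|
      (lt_of_le_of_lt <| Polynomial.degree_sum_le _ _) ?_
    have h2 : h v ≠ 0 := by simpa [h] using mem_support_iff.mp vin
    replace h2 : (finSuccEquiv k n ((nagataEquiv f) (h v))) ≠ 0 := fun eq ↦ h2 <|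
      by simpa only [map_eq_zero_iff _ (AlgEquiv.injective _)] using eq
    exact (Finset.sup_lt_iff <| Ne.bot_lt (fun x ↦ h2 <| Polynomial.degree_eq_bot.mp x)).mpr vs
  nth_rw 2 [← f.support_sum_monomial_coeff]
  rw [Finset.sum_eq_add_sum_sdiff_singleton_of_mem vin h]
  rw [leadingCoeff_finSuccEquiv_nagataEquiv_monomial] at coeff
  simpa only [coeff, algebraMap_eq] using (mem_support_iff.mp vin).isUnit.map MvPolynomial.C

end Nagata

section MonicRows

variable {ι : Type*} [Fintype ι] [DecidableEq ι]

theorem RowEquiv.of_sub_mem {R : Type*} [CommRing R] {a b : ι → R} (S : Set ι)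
    (h : ∀ i ∈ S, a i = b i) (h' : ∀ i ∉ S, b i - a i ∈ Ideal.span (a '' S)) :
    RowEquiv a b := by
  classical
  suffices H : ∀ T : Finset ι, (∀ i ∈ T, i ∉ S) →
      RowEquiv a (fun i => if i ∈ T then b i else a i) by
    refine (H (Finset.univ.filter (· ∉ S)) (by simp)).trans (RowEquiv.of_eq ?_)
    ext i
    by_cases hi : i ∈ S <;> simp [hi, h]
  intro T
  induction T using Finset.induction_on with
  | empty => intro _; simpa using RowEquiv.refl a
  | insert j T hj ih =>
    intro hT
    refine (ih fun i hi => hT i (Finset.mem_insert_of_mem hi)).trans ?_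
    have hjS := hT j (Finset.mem_insert_self _ _)
    have hmem : b j - a j ∈ Ideal.span
        ((fun i => if i ∈ T then b i else a i) '' {i | i ≠ j}) := by
      refine Ideal.span_mono ?_ (h' j hjS)
      rintro _ ⟨i, hi, rfl⟩
      refine ⟨i, fun hij => hjS (hij ▸ hi), ?_⟩
      by_cases hiT : i ∈ T <;> simp [hiT, h i hi]
    refine (RowEquiv.add_mem _ j hmem).trans (RowEquiv.of_eq ?_)
    ext i
    rcases eq_or_ne i j with rfl | hij
    · simp [hj]
    · simp [hij]

theorem exists_isCoprime_add_mul {R : Type*} [CommRing R] [IsDomain R]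
    [IsPrincipalIdealRing R] {a : R} (ha : a ≠ 0) {b c : R}
    (h : Ideal.span {a, b, c} = ⊤) : ∃ t, IsCoprime a (b + t * c) := by
  induction a using UniqueFactorizationMonoid.induction_on_prime with
  | h₁ => exact absurd rfl ha
  | h₂ x hx =>
    obtain ⟨y, hy⟩ := hx.exists_left_inv
    exact ⟨0, y, 0, by simp [hy]⟩
  | h₃ a p ha' hp ih =>
    obtain ⟨t, ht⟩ := ih ha' (by
      rw [eq_top_iff, ← h, Ideal.span_le]
      rintro x (rfl | hx)
      · exact Ideal.mul_mem_left _ _ (Ideal.subset_span (by simp))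
      · exact Ideal.subset_span (Set.mem_insert_of_mem _ hx))
    by_cases hpd : p ∣ b + t * c
    · have hpa : ¬ p ∣ a := fun hpa => hp.not_isUnit (ht.isUnit_of_dvd' hpa hpd)
      have hpc : ¬ p ∣ c := by
        intro hpc
        have hpb : p ∣ b := (dvd_add_left (hpc.mul_left t)).1 hpd
        refine hp.not_isUnit (isUnit_of_dvd_one ?_)
        rw [← Ideal.mem_span_singleton]
        have : Ideal.span {p * a, b, c} ≤ Ideal.span {p} := by
          rw [Ideal.span_le]
          rintro x (rfl | rfl | rfl)
          · exact Ideal.mem_span_singleton.2 (dvd_mul_right _ _)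
          · exact Ideal.mem_span_singleton.2 hpb
          · exact Ideal.mem_span_singleton.2 hpc
        exact this (h ▸ Submodule.mem_top)
      refine ⟨t + a, IsCoprime.mul_left ?_ ?_⟩
      · refine (hp.irreducible.coprime_iff_not_dvd).2 fun hd => ?_
        have : p ∣ a * c := by
          have := dvd_sub hd hpd
          rwa [show b + (t + a) * c - (b + t * c) = a * c by ring] at this
        exact (hp.dvd_or_dvd this).elim hpa hpc
      · have := ht.add_mul_left_right c
        rwa [show b + t * c + a * c = b + (t + a) * c by ring] at this
    · exact ⟨t, IsCoprime.mul_left ((hp.irreducible.coprime_iff_not_dvd).2 hpd) ht⟩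

open Polynomial in
theorem rowEquiv_comp_of_dvd_sub {B : Type*} [CommRing B] [IsDomain B] (f : ι → B[X]) {i₀ i₁ : ι}
    (hi : i₀ ≠ i₁) {r : B} (hr : r ≠ 0) {p q : B[X]} (hpq : p * f i₀ + q * f i₁ = C r)
    {b b' : B[X]} (hb : C r ∣ b' - b) :
    RowEquiv (fun i => (f i).comp b) (fun i => (f i).comp b') := by
  have hdvd : ∀ g : B[X], ∃ d, g.comp b' = g.comp b + C r * d := by
    intro g
    obtain ⟨d, hd⟩ := hb.trans (sub_dvd_eval_sub b' b (g.map C))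
    rw [← eval₂_eq_eval_map, ← eval₂_eq_eval_map] at hd
    exact ⟨d, by rw [← hd]; simp [comp]⟩
  have hC : (C r : B[X]) ≠ 0 := C_ne_zero.2 hr
  have hcomp : ∀ x : B[X], p.comp x * (f i₀).comp x + q.comp x * (f i₁).comp x = C r := by
    intro x
    rw [← mul_comp, ← mul_comp, ← add_comp, hpq, C_comp]
  obtain ⟨dα, hα⟩ := hdvd (f i₀)
  obtain ⟨dβ, hβ⟩ := hdvd (f i₁)
  obtain ⟨dP, hP⟩ := hdvd p
  obtain ⟨dQ, hQ⟩ := hdvd q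
  have h1 := hcomp b
  have h2 := hcomp b'
  rw [hα, hβ, hP, hQ] at h2
  have hdet : (1 + dα * p.comp b + dQ * (f i₁).comp b) *
      (1 + dβ * q.comp b + dP * (f i₀).comp b) -
      (dα * q.comp b - dQ * (f i₀).comp b) * (dβ * p.comp b - dP * (f i₁).comp b) = 1 := by
    refine mul_left_cancel₀ hC ?_
    generalize p.comp b = P at *
    generalize q.comp b = Q at *
    generalize (f i₀).comp b = α at *
    generalize (f i₁).comp b = β at *
    generalize (C r : B[X]) = c at *
    linear_combination h2 - h1 + c * (dα * dP + dβ * dQ) * (h1)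
  refine (RowEquiv.block _ hi hdet).trans (RowEquiv.of_sub_mem {i₀, i₁} ?_ ?_)
  · rintro i (rfl | rfl)
    · simp only [Function.update_of_ne hi, Function.update_self]
      rw [hα]; linear_combination dα * h1
    · simp only [Function.update_self]
      rw [hβ]; linear_combination dβ * h1
  · intro i hi'
    simp only [Set.mem_insert_iff, Set.mem_singleton_iff, not_or] at hi'
    rw [Function.update_of_ne hi'.2, Function.update_of_ne hi'.1]
    obtain ⟨d, hd⟩ := hdvd (f i)
    rw [hd, add_sub_cancel_left]
    refine Ideal.mul_mem_right _ _ ?_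
    rw [← hcomp b']
    refine Ideal.add_mem _ (Ideal.mul_mem_left _ _ (Ideal.subset_span ⟨i₀, by simp, ?_⟩))
      (Ideal.mul_mem_left _ _ (Ideal.subset_span ⟨i₁, by simp, ?_⟩))
    · simp only [Function.update_of_ne hi, Function.update_self]
      rw [hα]; linear_combination dα * h1
    · simp only [Function.update_self]
      rw [hβ]; linear_combination dβ * h1

open Polynomial in
/-- A monic polynomial and a polynomial coprime to it modulo `I` generate an ideal containing a
constant congruent to `1` modulo `I`. -/
theorem exists_sub_one_mem_of_monic {B : Type*} [CommRing B] (I : Ideal B) {f g : B[X]}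
    (hf : f.Monic)
    (h : IsCoprime (f.map (Ideal.Quotient.mk I)) (g.map (Ideal.Quotient.mk I))) :
    ∃ r : B, r - 1 ∈ I ∧ ∃ p q : B[X], p * f + q * g = C r := by
  have : Module.Finite B (B[X] ⧸ Ideal.span {f}) := hf.finite_quotient
  let J : Ideal B[X] := Ideal.span {f, g}
  have hle : Ideal.span {f} ≤ J := Ideal.span_mono (by simp)
  have : Module.Finite B (B[X] ⧸ J) :=
    Module.Finite.of_surjective (Ideal.Quotient.factorₐ B hle).toLinearMap
      (Ideal.Quotient.factor_surjective hle)
  obtain ⟨u, v, huv⟩ := h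
  obtain ⟨u, rfl⟩ := map_surjective _ Ideal.Quotient.mk_surjective u
  obtain ⟨v, rfl⟩ := map_surjective _ Ideal.Quotient.mk_surjective v
  have hmem : 1 - (u * f + v * g) ∈ I.map (C : B →+* B[X]) := by
    rw [Ideal.mem_map_C_iff]
    intro n
    rw [← Ideal.Quotient.eq_zero_iff_mem, ← coeff_map]
    simp [huv]
  have htop : (⊤ : Submodule B (B[X] ⧸ J)) ≤ I • ⊤ := by
    rintro x -
    obtain ⟨x, rfl⟩ := Ideal.Quotient.mk_surjective x
    have hx : Ideal.Quotient.mk J x = Ideal.Quotient.mk J ((1 - (u * f + v * g)) * x) := by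
      rw [Ideal.Quotient.eq]
      refine Ideal.mem_span_pair.2 ⟨u * x, v * x, by ring⟩
    rw [hx]
    generalize 1 - (u * f + v * g) = y at hmem
    induction hmem using Submodule.span_induction with
    | mem y hy =>
      obtain ⟨c, hc, rfl⟩ := hy
      rw [← smul_eq_C_mul]
      exact Submodule.smul_mem_smul (N := (⊤ : Submodule B (B[X] ⧸ J))) hc
        (Submodule.mem_top (x := Ideal.Quotient.mk J x))
    | zero => simp
    | add y z _ _ hy hz => rw [add_mul, map_add]; exact add_mem hy hz
    | smul c y _ hy =>
      rw [smul_eq_mul, mul_assoc, map_mul]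
      clear hx
      revert hy
      generalize (Ideal.Quotient.mk J) (y * x) = z
      intro hz
      induction hz using Submodule.smul_induction_on' with
      | smul a ha n _ =>
        rw [mul_smul_comm]
        exact Submodule.smul_mem_smul ha Submodule.mem_top
      | add a _ b _ ha hb => rw [mul_add]; exact add_mem ha hb
  obtain ⟨r, hr, hr'⟩ := Submodule.exists_sub_one_mem_and_smul_eq_zero_of_fg_of_le_smul I ⊤
    Module.Finite.fg_top htop
  refine ⟨r, hr, ?_⟩
  have := hr' (Ideal.Quotient.mk J 1) Submodule.mem_top
  have h2 : Ideal.Quotient.mk J (C r) = 0 := by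
    rw [← this, ← mul_one (C r), ← smul_eq_C_mul]; rfl
  exact Ideal.mem_span_pair.1 (Ideal.Quotient.eq_zero_iff_mem.1 h2)

open Polynomial in
/-- A unimodular row over `B[X]` with a monic entry is equivalent to its value at `0`. -/
theorem rowEquiv_comp_of_monic {B : Type*} [CommRing B] [IsDomain B] (f : ι → B[X])
    (hf : Unimodular f) {i₀ : ι} (h₀ : (f i₀).Monic) (b b' : B[X]) :
    RowEquiv (fun i => (f i).comp b) (fun i => (f i).comp b') := by
  by_cases hι : ∃ i₁, i₀ ≠ i₁
  swap
  · push Not at hι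
    have : Unique ι := ⟨⟨i₀⟩, fun i => (hι i).symm⟩
    obtain ⟨c, hc⟩ := hf
    have hu : IsUnit (f i₀) := by
      refine IsUnit.of_mul_eq_one_right (c i₀) ?_
      rw [← hc, dotProduct, Fintype.sum_eq_single i₀ fun i hi => absurd (hι i).symm hi]
    have h1 := h₀.eq_one_of_isUnit hu
    refine RowEquiv.of_eq (funext fun i => ?_)
    rw [← hι i, h1, one_comp, one_comp]
  obtain ⟨i₁, hi⟩ := hι
  let I : Ideal B :=
    { carrier := {c | ∀ b b' : B[X], C c ∣ b' - b →
        RowEquiv (fun i => (f i).comp b) (fun i => (f i).comp b')}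
      add_mem' := by
        rintro c c' hc hc' b b' ⟨d, hd⟩
        refine (hc b (b + C c * d) ⟨d, by ring⟩).trans (hc' _ _ ⟨d, ?_⟩)
        rw [C_add] at hd
        linear_combination hd
      zero_mem' := by
        intro b b' h
        rw [C_0, zero_dvd_iff, sub_eq_zero] at h
        exact h ▸ RowEquiv.refl _
      smul_mem' := by
        intro c c' hc b b' h
        refine hc b b' (dvd_trans ?_ h)
        rw [smul_eq_mul, C_mul]
        exact dvd_mul_left _ _ }
  suffices hI : (1 : B) ∈ I from hI b b' (by simp)
  rw [← Ideal.eq_top_iff_one]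
  by_contra hne
  obtain ⟨m, hm, hIm⟩ := Ideal.exists_le_maximal I hne
  let : Field (B ⧸ m) := Ideal.Quotient.field m
  let π := mapRingHom (Ideal.Quotient.mk m)
  let S : Set ι := {i | i ≠ i₀ ∧ i ≠ i₁}
  obtain ⟨c, hc⟩ := (inferInstance : (Ideal.span ((π ∘ f) '' S)).IsPrincipal)
  rw [Ideal.submodule_span_eq] at hc
  have hspan : Ideal.span {π (f i₀), π (f i₁), c} = ⊤ := by
    rw [eq_top_iff, ← unimodular_iff.1 (hf.map π), Ideal.span_le]
    rintro _ ⟨i, rfl⟩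
    by_cases h0 : i = i₀
    · exact Ideal.subset_span (by simp [h0])
    by_cases h1 : i = i₁
    · exact Ideal.subset_span (by simp [h1])
    have : (π ∘ f) i ∈ Ideal.span {c} := hc ▸ Ideal.subset_span ⟨i, ⟨h0, h1⟩, rfl⟩
    exact Ideal.span_mono (by simp) this
  have hmon : (π (f i₀)).Monic := h₀.map _
  obtain ⟨t, ht⟩ := exists_isCoprime_add_mul hmon.ne_zero hspan
  have htc : t * c ∈ Ideal.map π (Ideal.span (f '' S)) := by
    rw [Ideal.map_span, ← Set.image_comp, hc]
    exact Ideal.mul_mem_left _ _ (Ideal.mem_span_singleton_self c)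
  obtain ⟨x, hx, hxt⟩ := (Ideal.mem_map_iff_of_surjective π
    (map_surjective _ Ideal.Quotient.mk_surjective)).1 htc
  obtain ⟨r, hr, p, q, hpq⟩ := exists_sub_one_mem_of_monic m (g := f i₁ + x) h₀ (by
    change IsCoprime (π (f i₀)) (π (f i₁ + x))
    rwa [map_add, hxt])
  have hrm : r ∉ m := fun h => hm.ne_top ((Ideal.eq_top_iff_one m).2 (by
    simpa using m.sub_mem h hr))
  refine hrm (hIm fun b b' hb => ?_)
  have hr0 : r ≠ 0 := fun h => hrm (h ▸ m.zero_mem)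
  have e := RowEquiv.add_mem f i₁ (x := x) (Ideal.span_mono
    (Set.image_mono fun i hi => hi.2) hx)
  have key := rowEquiv_comp_of_dvd_sub (Function.update f i₁ (f i₁ + x)) hi hr0 (p := p) (q := q)
    (by simpa [hi] using hpq) hb
  exact (e.map (compRingHom b)).trans (key.trans (e.map (compRingHom b')).symm)

open Polynomial in
theorem Unimodular.eval_zero {B : Type*} [CommRing B] {f : ι → B[X]} (hf : Unimodular f) :
    Unimodular (fun i => (f i).eval 0) := by
  simpa only [Function.comp_def, coe_evalRingHom] using hf.map (evalRingHom 0)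

open Polynomial in
theorem completable_of_monic {B : Type*} [CommRing B] [IsDomain B] (f : ι → B[X])
    (hf : Unimodular f) {i₀ : ι} (h₀ : (f i₀).Monic)
    (h : Completable (fun i => (f i).eval 0)) : Completable f := by
  have := rowEquiv_comp_of_monic f hf h₀ 0 X
  simp only [comp_X, comp_zero] at this
  exact this.completable (h.map C)

/-- Unimodular rows over polynomial rings over a field are completable. -/
theorem completable_mvPolynomial (n : ℕ) {k : Type*} [Field k]
    (a : ι → MvPolynomial (Fin n) k) (ha : Unimodular a) : Completable a := by
  induction n with
  | zero =>
    have e := MvPolynomial.isEmptyAlgEquiv k (Fin 0)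
    by_cases h : ∃ i, e (a i) ≠ 0
    · obtain ⟨i, hi⟩ := h
      refine completable_of_isUnit i ?_
      simpa using (hi.isUnit.map e.symm)
    · push Not at h
      obtain ⟨b, hb⟩ := ha.map (e : MvPolynomial (Fin 0) k →+* k)
      simp [dotProduct, h] at hb
  | succ n ih =>
    by_cases h : ∃ i, a i ≠ 0
    swap
    · push Not at h
      obtain ⟨b, hb⟩ := ha
      simp [dotProduct, h] at hb
    obtain ⟨i, hi⟩ := h
    let e := (nagataEquiv (a i)).trans (MvPolynomial.finSuccEquiv k n)
    have hu : IsUnit (e (a i)).leadingCoeff := isUnit_leadingCoeff_nagataEquiv (a i) hi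
    obtain ⟨u, hu'⟩ := hu.exists_left_inv
    let φ : MvPolynomial (Fin (n + 1)) k →+* Polynomial (MvPolynomial (Fin n) k) := e
    let ψ : Polynomial (MvPolynomial (Fin n) k) →+* MvPolynomial (Fin (n + 1)) k := e.symm
    have hψ : ∀ x, ψ (φ x) = x := e.symm_apply_apply
    have h1 : RowEquiv (φ ∘ a) (Function.update (φ ∘ a) i (Polynomial.C u * φ (a i))) :=
      RowEquiv.unit_mul _ i ((IsUnit.of_mul_eq_one _ hu').map Polynomial.C)
    have h2 : Unimodular (φ ∘ a) := ha.map φ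
    have h3 := completable_of_monic _ (h1.unimodular h2) (i₀ := i) (by
      rw [Function.update_self, Polynomial.Monic, Polynomial.leadingCoeff_mul,
        Polynomial.leadingCoeff_C]
      exact hu') (ih _ (h1.unimodular h2).eval_zero)
    have h4 := (h1.symm.completable h3).map ψ
    convert h4 using 1
    ext1 j
    exact (hψ _).symm

end MonicRows

section Cancellation

open scoped Matrix

/-- Schanuel's lemma. -/
theorem nonempty_linearEquiv_of_exact {R : Type*} [Ring R] {K P K' Q C : Type*}
    [AddCommGroup K] [AddCommGroup P] [AddCommGroup K'] [AddCommGroup Q] [AddCommGroup C]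
    [Module R K] [Module R P] [Module R K'] [Module R Q] [Module R C]
    [Module.Projective R P] [Module.Projective R Q]
    {i : K →ₗ[R] P} {f : P →ₗ[R] C} {i' : K' →ₗ[R] Q} {g : Q →ₗ[R] C}
    (hi : Function.Injective i) (hf : Function.Surjective f) (hif : Function.Exact i f)
    (hi' : Function.Injective i') (hg : Function.Surjective g) (hig : Function.Exact i' g) :
    Nonempty ((P × K') ≃ₗ[R] (Q × K)) := by
  obtain ⟨h, hh⟩ := Module.projective_lifting_property g f hg
  obtain ⟨l, hl⟩ := Module.projective_lifting_property f g hf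
  have hh' : ∀ x, g (h x) = f x := fun x => LinearMap.congr_fun hh x
  have hl' : ∀ x, f (l x) = g x := fun x => LinearMap.congr_fun hl x
  have hfi : ∀ x, f (i x) = 0 := fun x => (hif _).2 ⟨x, rfl⟩
  have hgi : ∀ x, g (i' x) = 0 := fun x => (hig _).2 ⟨x, rfl⟩
  let X : Submodule R (P × Q) :=
    LinearMap.eqLocus (f ∘ₗ LinearMap.fst R P Q) (g ∘ₗ LinearMap.snd R P Q)
  let a : (P × K') →ₗ[R] X := LinearMap.codRestrict X
    (LinearMap.prod (LinearMap.fst R P K') (h ∘ₗ LinearMap.fst R P K' + i' ∘ₗ LinearMap.snd R P K'))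
    (fun x => by simp [X, hh', hgi])
  let b : (Q × K) →ₗ[R] X := LinearMap.codRestrict X
    (LinearMap.prod (l ∘ₗ LinearMap.fst R Q K + i ∘ₗ LinearMap.snd R Q K) (LinearMap.fst R Q K))
    (fun x => by simp [X, hl', hfi])
  have ha : Function.Bijective a := by
    constructor
    · rintro ⟨p, k⟩ ⟨p', k'⟩ e
      have e1 := congrArg (fun z : X => z.1.1) e
      have e2 := congrArg (fun z : X => z.1.2) e
      simp only [a, LinearMap.codRestrict_apply, LinearMap.prod_apply, Function.prod_apply,
        LinearMap.fst_apply, LinearMap.add_apply, LinearMap.comp_apply, LinearMap.snd_apply] at e1 e2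
      subst e1
      rw [hi' (add_left_cancel e2)]
    · rintro ⟨⟨p, q⟩, hpq⟩
      replace hpq : f p = g q := hpq
      obtain ⟨k, hk⟩ := (hig (q - h p)).1 (by rw [map_sub, hh', hpq, sub_self])
      refine ⟨(p, k), Subtype.ext (Prod.ext rfl ?_)⟩
      change h p + i' k = q
      rw [hk]; abel
  have hb : Function.Bijective b := by
    constructor
    · rintro ⟨p, k⟩ ⟨p', k'⟩ e
      have e1 := congrArg (fun z : X => z.1.2) e
      have e2 := congrArg (fun z : X => z.1.1) e
      simp only [b, LinearMap.codRestrict_apply, LinearMap.prod_apply, Function.prod_apply,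
        LinearMap.fst_apply, LinearMap.add_apply, LinearMap.comp_apply, LinearMap.snd_apply] at e1 e2
      subst e1
      rw [hi (add_left_cancel e2)]
    · rintro ⟨⟨p, q⟩, hpq⟩
      replace hpq : f p = g q := hpq
      obtain ⟨k, hk⟩ := (hif (p - l q)).1 (by rw [map_sub, hl', hpq, sub_self])
      refine ⟨(q, k), Subtype.ext (Prod.ext ?_ rfl)⟩
      change l q + i k = p
      rw [hk]; abel
  exact ⟨(LinearEquiv.ofBijective a ha).trans (LinearEquiv.ofBijective b hb).symm⟩

theorem nonempty_linearEquiv_of_prod_self {R : Type*} [CommRing R] {P : Type*} [AddCommGroup P]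
    [Module R P] {r : ℕ} (H : ∀ a : Fin (r + 1) → R, Unimodular a → Completable a)
    (e : (P × R) ≃ₗ[R] (Fin (r + 1) → R)) : Nonempty (P ≃ₗ[R] (Fin r → R)) := by
  let φ : (Fin (r + 1) → R) →ₗ[R] R := LinearMap.snd R P R ∘ₗ e.symm
  let a : Fin (r + 1) → R := fun i => φ (Pi.single i 1)
  have hφ : ∀ x, φ x = a ⬝ᵥ x := by
    intro x
    rw [LinearMap.pi_apply_eq_sum_univ φ x]
    simp only [dotProduct, a, smul_eq_mul]
    refine Finset.sum_congr rfl fun i _ => ?_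
    rw [mul_comm]
    congr 2
    ext j
    simp [Pi.single_apply, eq_comm]
  have ha : Unimodular a := by
    refine ⟨e (0, 1), ?_⟩
    rw [dotProduct_comm, ← hφ]
    simp [φ]
  obtain ⟨M, ⟨u, rfl⟩, hM⟩ := (H a ha).rowEquiv 0
  let U : Matrix (Fin (r + 1)) (Fin (r + 1)) R := u
  let V : Matrix (Fin (r + 1)) (Fin (r + 1)) R := ↑u⁻¹
  have hUV : U * V = 1 := u.mul_inv
  have hVU : V * U = 1 := u.inv_mul
  have hVa : V *ᵥ a = Pi.single 0 1 := by
    rw [← hM, Matrix.mulVec_mulVec, hVU, Matrix.one_mulVec]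
  have h0 : ∀ x, φ (Vᵀ *ᵥ x) = x 0 := by
    intro x
    rw [hφ, Matrix.dotProduct_mulVec, Matrix.vecMul_transpose, hVa]
    simp
  have hVt : Vᵀ * Uᵀ = 1 := by rw [← Matrix.transpose_mul, hUV, Matrix.transpose_one]
  have hUt : Uᵀ * Vᵀ = 1 := by rw [← Matrix.transpose_mul, hVU, Matrix.transpose_one]
  refine ⟨LinearEquiv.ofLinearMap
    (LinearMap.funLeft R R Fin.succ ∘ₗ Matrix.toLin' Uᵀ ∘ₗ (e : _ →ₗ[R] _) ∘ₗ
      LinearMap.inl R P R)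
    (LinearMap.fst R P R ∘ₗ (e.symm : _ →ₗ[R] _) ∘ₗ Matrix.toLin' Vᵀ ∘ₗ
      LinearMap.pi (fun j => Fin.cases 0 (fun j => LinearMap.proj j) j)) ?_ ?_⟩
  · refine LinearMap.ext fun x => ?_
    have h1 : (e.symm (Vᵀ *ᵥ (Fin.cons 0 x : Fin (r + 1) → R))).2 = 0 := h0 (Fin.cons 0 x)
    have h2 : (LinearMap.pi (fun j => Fin.cases 0 (fun j => LinearMap.proj j) j) :
      (Fin r → R) →ₗ[R] (Fin (r + 1) → R)) x = Fin.cons 0 x := by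
      ext j; cases j using Fin.cases <;> simp
    simp only [LinearMap.comp_apply, h2, Matrix.toLin'_apply, LinearMap.inl_apply,
      LinearMap.fst_apply, LinearEquiv.coe_coe, LinearMap.id_apply]
    have h3 : ((e.symm (Vᵀ *ᵥ (Fin.cons 0 x : Fin (r + 1) → R))).1, (0 : R)) =
        e.symm (Vᵀ *ᵥ (Fin.cons 0 x : Fin (r + 1) → R)) := Prod.ext rfl h1.symm
    rw [h3, LinearEquiv.apply_symm_apply, Matrix.mulVec_mulVec, hUt, Matrix.one_mulVec]
    ext j
    simp [LinearMap.funLeft_apply]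
  · refine LinearMap.ext fun x => ?_
    have h1 : (Uᵀ *ᵥ e (x, 0)) 0 = 0 := by
      rw [← h0 (Uᵀ *ᵥ e (x, 0)), Matrix.mulVec_mulVec, hVt, Matrix.one_mulVec]
      simp [φ]
    have h2 : (LinearMap.pi (fun j => Fin.cases 0 (fun j => LinearMap.proj j) j) :
      (Fin r → R) →ₗ[R] (Fin (r + 1) → R)) (LinearMap.funLeft R R Fin.succ (Uᵀ *ᵥ e (x, 0)))
        = Uᵀ *ᵥ e (x, 0) := by
      ext j; cases j using Fin.cases <;> simp [LinearMap.funLeft_apply, h1]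
    simp only [LinearMap.comp_apply, Matrix.toLin'_apply, LinearMap.inl_apply,
      LinearMap.fst_apply, LinearEquiv.coe_coe, LinearMap.id_apply]
    rw [h2, Matrix.mulVec_mulVec, hVt, Matrix.one_mulVec, LinearEquiv.symm_apply_apply]

theorem nonempty_linearEquiv_of_prod_fin {R : Type*} [CommRing R] {P : Type*} [AddCommGroup P]
    [Module R P] {m : ℕ} (H : ∀ r, m ≤ r → ∀ a : Fin (r + 1) → R, Unimodular a → Completable a)
    (N : ℕ) (e : (P × (Fin N → R)) ≃ₗ[R] (Fin (m + N) → R)) :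
    Nonempty (P ≃ₗ[R] (Fin m → R)) := by
  induction N with
  | zero => exact ⟨(LinearEquiv.prodUnique (R := R) (M := P) (M₂ := Fin 0 → R)).symm.trans e⟩
  | succ N ih =>
    have c : (R × (Fin N → R)) ≃ₗ[R] (Fin (N + 1) → R) := Fin.consLinearEquiv R (fun _ => R)
    have e' : ((P × (Fin N → R)) × R) ≃ₗ[R] (Fin (m + N + 1) → R) :=
      (LinearEquiv.prodAssoc R P (Fin N → R) R).trans
        (((LinearEquiv.refl R P).prodCongr ((LinearEquiv.prodComm R _ _).trans c)).trans e)
    obtain ⟨e2⟩ := nonempty_linearEquiv_of_prod_self (H (m + N) (by lia)) e'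
    exact ih e2

end Cancellation

section Polynomial

open Polynomial TensorProduct

variable {R : Type*} [CommRing R]

section Characteristic

variable (T : Type*) [AddCommGroup T] [Module R T] [Module R[X] T] [IsScalarTower R R[X] T]

/-- Multiplication by `X` on a module over `R[X]`, as an `R`-linear map. -/
noncomputable def mulXLinear : T →ₗ[R] T := (LinearMap.lsmul R[X] T X).restrictScalars R

theorem mulXLinear_apply (t : T) : mulXLinear (R := R) T t = (X : R[X]) • t := rfl

/-- The characteristic endomorphism `X ⊗ 1 - 1 ⊗ X` of `R[X] ⊗ T`. -/
noncomputable def charMap : R[X] ⊗[R] T →ₗ[R[X]] R[X] ⊗[R] T :=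
  LinearMap.liftBaseChange R[X]
    (TensorProduct.mk R R[X] T X - TensorProduct.mk R R[X] T 1 ∘ₗ mulXLinear T)

/-- The `R[X]`-linear evaluation map `R[X] ⊗ T → T`. -/
noncomputable def evalMap : R[X] ⊗[R] T →ₗ[R[X]] T := LinearMap.liftBaseChange R[X] LinearMap.id

/-- The divided differences that define the contracting homotopy of `charMap`. -/
noncomputable def dividedDifference : ℕ → T →ₗ[R] R[X] ⊗[R] T
  | 0 => 0
  | i + 1 => TensorProduct.mk R R[X] T (X ^ i) + dividedDifference i ∘ₗ mulXLinear T

/-- The contracting homotopy of `charMap`. -/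
noncomputable def charHomotopy : R[X] ⊗[R] T →ₗ[R] R[X] ⊗[R] T :=
  TensorProduct.lift ((basisMonomials R).constr R (dividedDifference T))

variable {T}

theorem charMap_tmul (p : R[X]) (t : T) :
    charMap T (p ⊗ₜ[R] t) = (p * X) ⊗ₜ[R] t - p ⊗ₜ[R] ((X : R[X]) • t) := by
  simp [charMap, smul_sub, TensorProduct.smul_tmul', mulXLinear_apply]

theorem evalMap_tmul (p : R[X]) (t : T) : evalMap T (p ⊗ₜ[R] t) = p • t := by
  simp [evalMap]

theorem charHomotopy_tmul (i : ℕ) (t : T) :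
    charHomotopy T ((X ^ i : R[X]) ⊗ₜ[R] t) = dividedDifference T i t := by
  have h := (basisMonomials R).constr_basis R (dividedDifference (R := R) T) i
  rw [coe_basisMonomials] at h
  rw [charHomotopy, TensorProduct.lift.tmul, ← monomial_one_right_eq_X_pow, h]

theorem tensor_hom_ext {N : Type*} [AddCommGroup N] [Module R N] {f g : R[X] ⊗[R] T →ₗ[R] N}
    (h : ∀ (i : ℕ) (t : T), f ((X ^ i : R[X]) ⊗ₜ[R] t) = g ((X ^ i : R[X]) ⊗ₜ[R] t)) : f = g := by
  refine TensorProduct.ext (lhom_ext' fun i => LinearMap.ext_ring (LinearMap.ext fun t => ?_))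
  simpa [monomial_one_right_eq_X_pow] using h i t

theorem charHomotopy_charMap (x : R[X] ⊗[R] T) : charHomotopy T (charMap T x) = x := by
  have : charHomotopy T ∘ₗ (charMap T).restrictScalars R = LinearMap.id := by
    refine tensor_hom_ext fun i t => ?_
    rw [LinearMap.comp_apply, LinearMap.restrictScalars_apply, charMap_tmul, map_sub, ← pow_succ,
      charHomotopy_tmul, charHomotopy_tmul, dividedDifference]
    simp [mulXLinear_apply]
  exact LinearMap.congr_fun this x

theorem charMap_charHomotopy (x : R[X] ⊗[R] T) :
    charMap T (charHomotopy T x) + 1 ⊗ₜ[R] evalMap T x = x := by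
  have : (charMap T).restrictScalars R ∘ₗ charHomotopy T +
      TensorProduct.mk R R[X] T 1 ∘ₗ (evalMap T).restrictScalars R = LinearMap.id := by
    refine tensor_hom_ext fun i => ?_
    induction i with
    | zero =>
      intro t
      simp only [LinearMap.add_apply, LinearMap.comp_apply, LinearMap.restrictScalars_apply,
        charHomotopy_tmul, evalMap_tmul, dividedDifference]
      simp
    | succ i ih =>
      intro t
      have h := ih ((X : R[X]) • t)
      simp only [LinearMap.add_apply, LinearMap.comp_apply, LinearMap.restrictScalars_apply,
        charHomotopy_tmul, evalMap_tmul, dividedDifference, TensorProduct.mk_apply,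
        LinearMap.id_apply, map_add, charMap_tmul, mulXLinear_apply, smul_smul] at h ⊢
      rw [← pow_succ] at h ⊢
      rw [add_assoc, h, sub_add_cancel]
  exact LinearMap.congr_fun this x

theorem charMap_injective : Function.Injective (charMap (R := R) T) :=
  Function.LeftInverse.injective charHomotopy_charMap

theorem evalMap_surjective : Function.Surjective (evalMap (R := R) T) :=
  fun t => ⟨1 ⊗ₜ t, by rw [evalMap_tmul, one_smul]⟩

theorem exact_charMap_evalMap : Function.Exact (charMap (R := R) T) (evalMap T) := by
  intro x
  constructor
  · intro h
    refine ⟨charHomotopy T x, ?_⟩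
    have := charMap_charHomotopy x
    rwa [h, TensorProduct.tmul_zero, add_zero] at this
  · rintro ⟨y, rfl⟩
    have : evalMap T ∘ₗ charMap (R := R) T = 0 := by
      refine LinearMap.restrictScalars_injective R (tensor_hom_ext fun i t => ?_)
      simp [charMap_tmul, evalMap_tmul, smul_smul]
    exact LinearMap.congr_fun this y

end Characteristic

theorem projective_restrictScalars {S P : Type*} [CommRing S] [Algebra R S] [Module.Free R S]
    [AddCommGroup P] [Module R P] [Module S P] [IsScalarTower R S P] [Module.Finite S P]
    [Module.Projective S P] : Module.Projective R P := by
  obtain ⟨n, f, g, -, -, h⟩ := Module.Finite.exists_comp_eq_id_of_projective S P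
  exact Module.Projective.of_split (g.restrictScalars R) (f.restrictScalars R)
    (LinearMap.ext fun x => LinearMap.congr_fun h x)

/-- The coordinatewise remainder modulo `X ^ c`. -/
noncomputable def piModXPow (R ι : Type*) [CommRing R] (c : ℕ) : (ι → R[X]) →ₗ[R] (ι → R[X]) :=
  LinearMap.pi fun i => modByMonicHom (X ^ c) ∘ₗ LinearMap.proj i

theorem exists_piModXPow_add {ι : Type*} (c : ℕ) (x : ι → R[X]) :
    ∃ y : ι → R[X], x = piModXPow R ι c x + (X ^ c : R[X]) • y := by
  refine ⟨fun i => x i /ₘ X ^ c, funext fun i => ?_⟩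
  have := modByMonic_add_div (x i) (X ^ c : R[X])
  exact this.symm

theorem piModXPow_smul {ι : Type*} (c : ℕ) (x : ι → R[X]) :
    piModXPow R ι c ((X ^ c : R[X]) • x) = 0 := by
  refine funext fun i => ?_
  have : (X ^ c * x i) %ₘ X ^ c = 0 :=
    (modByMonic_eq_zero_iff_dvd (monic_X_pow c)).2 (dvd_mul_right _ _)
  exact this

variable {P : Type*} [AddCommGroup P] [Module R P] [Module R[X] P] [IsScalarTower R R[X] P]

theorem finite_of_pow_smul_eq_zero [Module.Finite R[X] P] {c : ℕ}
    (h : ∀ x : P, (X ^ c : R[X]) • x = 0) : Module.Finite R P := by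
  obtain ⟨n, f, hf⟩ := Module.Finite.exists_fin' R[X] P
  let g : (Fin n → degreeLT R c) →ₗ[R] P :=
    f.restrictScalars R ∘ₗ LinearMap.pi fun i => (degreeLT R c).subtype ∘ₗ LinearMap.proj i
  refine Module.Finite.of_surjective g fun t => ?_
  obtain ⟨x, rfl⟩ := hf t
  cases subsingleton_or_nontrivial R
  · have := Module.subsingleton R P
    exact ⟨0, Subsingleton.elim _ _⟩
  refine ⟨fun i => ⟨x i %ₘ X ^ c, ?_⟩, ?_⟩
  · rw [mem_degreeLT]
    exact (degree_modByMonic_lt _ (monic_X_pow c)).trans_eq (degree_X_pow c)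
  · obtain ⟨y, hy⟩ := exists_piModXPow_add c x
    conv_rhs => rw [hy, map_add, map_smul, h, add_zero]
    rfl

theorem projective_quotient_of_pow_smul_mem [Module.Finite R[X] P] [Module.Projective R[X] P]
    {m c : ℕ} (hinj : ∀ x : P, (X ^ c : R[X]) • x = 0 → x = 0) (L : Submodule R[X] P)
    (e : L ≃ₗ[R[X]] (Fin m → R[X])) (hL : ∀ x : P, (X ^ c : R[X]) • x ∈ L) :
    Module.Projective R (P ⧸ L) := by
  have hP : Module.Projective R P := projective_restrictScalars (S := R[X])
  have hLp : Module.Projective R L :=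
    Module.Projective.of_equiv (e.symm.restrictScalars R)
  let v : P →ₗ[R[X]] L := LinearMap.codRestrict L (LinearMap.lsmul R[X] P (X ^ c)) hL
  have hv : ∀ x, (v x : P) = (X ^ c : R[X]) • x := fun x => rfl
  let N : Submodule R[X] L := L.map v
  have hN : ∀ x : L, (X ^ c : R[X]) • x ∈ N := fun x => ⟨x, x.2, Subtype.ext rfl⟩
  have hQ : Module.Projective R (L ⧸ N) := by
    let s : L →ₗ[R] L := (e.symm.restrictScalars R).toLinearMap ∘ₗ piModXPow R (Fin m) c ∘ₗ
      (e.restrictScalars R).toLinearMap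
    have hs : ∀ x, s x = e.symm (piModXPow R (Fin m) c (e x)) := fun x => rfl
    have hs0 : ∀ x ∈ N, s x = 0 := by
      rintro _ ⟨x, hx, rfl⟩
      have : v x = (X ^ c : R[X]) • (⟨x, hx⟩ : L) := Subtype.ext rfl
      rw [hs, this, map_smul, piModXPow_smul, map_zero]
    refine Module.Projective.of_split
      (Submodule.liftQ (N.restrictScalars R) s hs0 : (L ⧸ N) →ₗ[R] L)
      (N.mkQ.restrictScalars R) (LinearMap.ext fun t => ?_)
    obtain ⟨x, rfl⟩ := N.mkQ_surjective t
    obtain ⟨y, hy⟩ := exists_piModXPow_add c (e x)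
    change N.mkQ (s x) = N.mkQ x
    have : x = s x + (X ^ c : R[X]) • e.symm y := by
      apply e.injective
      rw [map_add, map_smul, hs, LinearEquiv.apply_symm_apply, LinearEquiv.apply_symm_apply, ← hy]
    conv_rhs => rw [this, map_add]
    rw [left_eq_add]
    exact (Submodule.Quotient.mk_eq_zero N).2 (hN _)
  let W : Submodule R[X] L := LinearMap.range v
  have hNW : N ≤ W := by rintro _ ⟨x, -, rfl⟩; exact ⟨x, rfl⟩
  let i' : (P ⧸ L) →ₗ[R[X]] (L ⧸ N) := L.mapQ N v (fun x hx => ⟨x, hx, rfl⟩)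
  let g : (L ⧸ N) →ₗ[R[X]] (L ⧸ W) := N.mapQ W LinearMap.id hNW
  have hvi : Function.Injective v := by
    refine (injective_iff_map_eq_zero v).2 fun x hx => hinj x ?_
    rw [← hv, hx]; rfl
  have hi' : Function.Injective i' := by
    refine (injective_iff_map_eq_zero i').2 fun t ht => ?_
    obtain ⟨x, rfl⟩ := L.mkQ_surjective t
    obtain ⟨y, hy, hyx⟩ := (Submodule.Quotient.mk_eq_zero N).1 ht
    rw [← hvi hyx]
    exact (Submodule.Quotient.mk_eq_zero L).2 hy
  have hg : Function.Surjective g := by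
    intro t
    obtain ⟨x, rfl⟩ := W.mkQ_surjective t
    exact ⟨N.mkQ x, rfl⟩
  have hig : Function.Exact i' g := by
    intro t
    obtain ⟨x, rfl⟩ := N.mkQ_surjective t
    constructor
    · intro h
      obtain ⟨y, rfl⟩ := (Submodule.Quotient.mk_eq_zero W).1 h
      exact ⟨L.mkQ y, rfl⟩
    · rintro ⟨y, hy⟩
      obtain ⟨y, rfl⟩ := L.mkQ_surjective y
      rw [← hy]
      exact (Submodule.Quotient.mk_eq_zero W).2 ⟨y, rfl⟩
  obtain ⟨E⟩ := nonempty_linearEquiv_of_exact (R := R) (i := v.restrictScalars R)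
    (f := W.mkQ.restrictScalars R) (i' := i'.restrictScalars R) (g := g.restrictScalars R)
    hvi W.mkQ_surjective (LinearMap.exact_map_mkQ_range v) hi' hg hig
  have hp : Module.Projective R (L × (P ⧸ L)) := Module.Projective.of_equiv E.symm
  exact Module.Projective.of_split (LinearMap.inr R L (P ⧸ L)) (LinearMap.snd R L (P ⧸ L))
    (LinearMap.snd_comp_inr R L _)

theorem nonempty_linearEquiv_of_pow_smul_mem [Module.Finite R[X] P] [Module.Projective R[X] P]
    {m c : ℕ} (H : ∀ r, m ≤ r → ∀ a : Fin (r + 1) → R[X], Unimodular a → Completable a)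
    (hinj : ∀ x : P, (X ^ c : R[X]) • x = 0 → x = 0) (L : Submodule R[X] P)
    (e : L ≃ₗ[R[X]] (Fin m → R[X])) (hL : ∀ x : P, (X ^ c : R[X]) • x ∈ L) :
    Nonempty (P ≃ₗ[R[X]] (Fin m → R[X])) := by
  have hT := projective_quotient_of_pow_smul_mem hinj L e hL
  have hTf : Module.Finite R (P ⧸ L) := by
    refine finite_of_pow_smul_eq_zero (c := c) fun t => ?_
    obtain ⟨x, rfl⟩ := L.mkQ_surjective t
    rw [← map_smul]
    exact (Submodule.Quotient.mk_eq_zero L).2 (hL x)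
  let F := R[X] ⊗[R] (P ⧸ L)
  obtain ⟨E⟩ := nonempty_linearEquiv_of_exact (R := R[X]) (f := L.mkQ) L.injective_subtype
    L.mkQ_surjective (LinearMap.exact_subtype_mkQ L) (charMap_injective (R := R) (T := P ⧸ L))
    evalMap_surjective exact_charMap_evalMap
  obtain ⟨N, f, g, hf, -, hfg⟩ := Module.Finite.exists_comp_eq_id_of_projective R[X] F
  obtain ⟨G⟩ := nonempty_linearEquiv_of_exact (R := R[X]) (i := (LinearMap.ker f).subtype) (f := f)
    (i' := (0 : (Fin 0 → R[X]) →ₗ[R[X]] F)) (g := LinearMap.id)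
    (LinearMap.ker f).injective_subtype hf (LinearMap.exact_subtype_ker_map f)
    (Function.injective_of_subsingleton _) Function.surjective_id
    (by intro y; simp [eq_comm])
  let F' := LinearMap.ker f
  let G' : (F × F') ≃ₗ[R[X]] (Fin N → R[X]) := G.symm.trans
    (LinearEquiv.prodUnique (R := R[X]) (M := Fin N → R[X]) (M₂ := Fin 0 → R[X]))
  refine nonempty_linearEquiv_of_prod_fin H N ?_
  let E' : (P × F) ≃ₗ[R[X]] ((Fin m → R[X]) × F) :=
    E.trans ((LinearEquiv.prodComm R[X] F L).trans (e.prodCongr (LinearEquiv.refl R[X] F)))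
  let e₁ : (P × (Fin N → R[X])) ≃ₗ[R[X]] (P × F × F') :=
    (LinearEquiv.refl R[X] P).prodCongr G'.symm
  let e₂ : ((P × F) × F') ≃ₗ[R[X]] (((Fin m → R[X]) × F) × F') :=
    E'.prodCongr (LinearEquiv.refl R[X] F')
  let e₃ : ((Fin m → R[X]) × F × F') ≃ₗ[R[X]] ((Fin m → R[X]) × (Fin N → R[X])) :=
    (LinearEquiv.refl R[X] (Fin m → R[X])).prodCongr G'
  let e₄ : ((Fin m → R[X]) × (Fin N → R[X])) ≃ₗ[R[X]] (Fin (m + N) → R[X]) :=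
    (LinearEquiv.sumArrowLequivProdArrow (Fin m) (Fin N) R[X] R[X]).symm.trans
      (LinearEquiv.funCongrLeft R[X] R[X] finSumFinEquiv.symm)
  exact (((e₁.trans (LinearEquiv.prodAssoc R[X] P F F').symm).trans e₂).trans
    ((LinearEquiv.prodAssoc R[X] (Fin m → R[X]) F F').trans e₃)).trans e₄

end Polynomial

section Patching

open Polynomial
open scoped Matrix

section AwaySubring

variable {K : Type*} [Field K]

/-- The elements of `K` that a power of `v` multiplies into the subring `A`. -/
def awaySubring (A : Subring K) (v : A) : Subring K where
  carrier := {x | ∃ c : ℕ, (v : K) ^ c * x ∈ A}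
  mul_mem' := by
    rintro x y ⟨c, hc⟩ ⟨e, he⟩
    refine ⟨c + e, ?_⟩
    rw [show (v : K) ^ (c + e) * (x * y) = (v ^ c * x) * (v ^ e * y) by ring]
    exact A.mul_mem hc he
  one_mem' := ⟨0, by simp⟩
  add_mem' := by
    rintro x y ⟨c, hc⟩ ⟨e, he⟩
    refine ⟨c + e, ?_⟩
    rw [show (v : K) ^ (c + e) * (x + y) = v ^ e * (v ^ c * x) + v ^ c * (v ^ e * y) by ring]
    exact A.add_mem (A.mul_mem (A.pow_mem v.2 e) hc) (A.mul_mem (A.pow_mem v.2 c) he)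
  zero_mem' := ⟨0, by simp⟩
  neg_mem' := by
    rintro x ⟨c, hc⟩
    exact ⟨c, by rw [mul_neg]; exact A.neg_mem hc⟩

variable {A : Subring K} {v h : A} {x : K}

theorem mem_awaySubring_of_pow_mul_mem (c : ℕ) (hx : (v : K) ^ c * x ∈ A) : x ∈ awaySubring A v :=
  ⟨c, hx⟩

theorem mem_awaySubring_of_mul_mem (hx : (v : K) * x ∈ A) : x ∈ awaySubring A v :=
  ⟨1, by rwa [pow_one]⟩

theorem le_awaySubring : A ≤ awaySubring A v := fun _ hx => ⟨0, by simpa using hx⟩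

theorem mem_of_mem_awaySubring (hc : IsCoprime v h) (hx : x ∈ awaySubring A v)
    (hx' : x ∈ awaySubring A h) : x ∈ A := by
  obtain ⟨c, hc'⟩ := hx
  obtain ⟨e, he⟩ := hx'
  obtain ⟨α, β, hαβ⟩ := hc.pow (m := c) (n := e)
  have : x = α * (v ^ c * x) + β * (h ^ e * x) := by
    have := congrArg (fun z : A => (z : K) * x) hαβ
    simp only [Subring.coe_add, Subring.coe_mul, Subring.coe_pow, Subring.coe_one] at this
    linear_combination -this
  rw [this]
  exact A.add_mem (A.mul_mem α.2 hc') (A.mul_mem β.2 he)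

theorem exists_pow_mul_mem_of_finite {ι : Type*} [Finite ι] {f : ι → K}
    (hf : ∀ i, f i ∈ awaySubring A v) : ∃ c : ℕ, ∀ i, (v : K) ^ c * f i ∈ A := by
  have := Fintype.ofFinite ι
  choose c hc using hf
  refine ⟨∑ i, c i, fun i => ?_⟩
  obtain ⟨e, he⟩ := Nat.exists_eq_add_of_le
    (Finset.single_le_sum (f := c) (fun _ _ => Nat.zero_le _) (Finset.mem_univ i))
  rw [he, pow_add, mul_right_comm, mul_comm]
  exact A.mul_mem (A.pow_mem v.2 e) (hc i)

theorem matrix_mul_mem {ι : Type*} [Fintype ι] {S : Subring K} {M N : Matrix ι ι K}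
    (hM : ∀ i j, M i j ∈ S) (hN : ∀ i j, N i j ∈ S) (i j : ι) : (M * N) i j ∈ S := by
  rw [Matrix.mul_apply]
  exact S.sum_mem fun k _ => S.mul_mem (hM i k) (hN k j)

end AwaySubring

variable {R K : Type*} [CommRing R] [Field K] [Algebra R K] [Algebra R[X] K]
  [IsScalarTower R R[X] K] [FaithfulSMul R[X] K]

section Lattice

variable {m : ℕ} (v h : (algebraMap R[X] K).range) (M' : Matrix (Fin m) (Fin m) K)

/-- The vectors with entries in `B[1/v]` that `M'` carries to vectors with entries in `B[1/h]`,
where `B = R[X]`. -/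
def patchedLattice : Submodule R[X] (Fin m → K) where
  carrier := {x | (∀ i, x i ∈ awaySubring _ v) ∧ ∀ i, (M' *ᵥ x) i ∈ awaySubring _ h}
  add_mem' := by
    rintro x y ⟨hx, hx'⟩ ⟨hy, hy'⟩
    refine ⟨fun i => Subring.add_mem _ (hx i) (hy i), fun i => ?_⟩
    rw [Matrix.mulVec_add]
    exact Subring.add_mem _ (hx' i) (hy' i)
  zero_mem' := ⟨fun _ => Subring.zero_mem _, fun i => by
    rw [Matrix.mulVec_zero]; exact Subring.zero_mem _⟩
  smul_mem' := by
    rintro b x ⟨hx, hx'⟩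
    refine ⟨fun i => ?_, fun i => ?_⟩
    · rw [Pi.smul_apply, Algebra.smul_def]
      exact Subring.mul_mem _ (le_awaySubring ⟨b, rfl⟩) (hx i)
    · rw [Matrix.mulVec_smul, Pi.smul_apply, Algebra.smul_def]
      exact Subring.mul_mem _ (le_awaySubring ⟨b, rfl⟩) (hx' i)

end Lattice

/-- Coordinatewise inclusion of `R[X]` in `K`, followed by a matrix. -/
noncomputable def matrixRange {m : ℕ} (M : Matrix (Fin m) (Fin m) K) :
    (Fin m → R[X]) →ₗ[R[X]] (Fin m → K) :=
  (Matrix.toLin' M).restrictScalars R[X] ∘ₗ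
    LinearMap.pi fun i => Algebra.linearMap R[X] K ∘ₗ LinearMap.proj i

theorem matrixRange_apply {m : ℕ} (M : Matrix (Fin m) (Fin m) K) (y : Fin m → R[X]) :
    matrixRange M y = M *ᵥ fun i => algebraMap R[X] K (y i) := rfl

variable (K) in
theorem exists_linearMap_of_forall_mem {P : Type*} [AddCommGroup P] [Module R[X] P] {m : ℕ}
    (l : P →ₗ[R[X]] (Fin m → K)) (hl : ∀ x i, l x i ∈ (algebraMap R[X] K).range) :
    ∃ l' : P →ₗ[R[X]] (Fin m → R[X]), ∀ x i, algebraMap R[X] K (l' x i) = l x i := by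
  have hinj : Function.Injective (algebraMap R[X] K) := FaithfulSMul.algebraMap_injective _ _
  choose g hg using hl
  exact ⟨{  toFun := g
            map_add' := fun x y => funext fun i => hinj (by simp [hg])
            map_smul' := fun b x => funext fun i => hinj (by simp [hg, Algebra.smul_def]) }, hg⟩

theorem exists_patchedLattice_equiv {m c : ℕ} [Nontrivial R]
    (H : ∀ r, ∀ a : Fin r → R[X], Unimodular a → Completable a)
    {v h : (algebraMap R[X] K).range} (hv : (v : K) = algebraMap R[X] K X) (hvh : IsCoprime v h)
    {M M' : Matrix (Fin m) (Fin m) K} (hMM : M * M' = 1)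
    (hM : ∀ i j, (v : K) ^ c * (h * M i j) ∈ (algebraMap R[X] K).range)
    (hM' : ∀ i j, (v : K) ^ c * (h * M' i j) ∈ (algebraMap R[X] K).range) :
    Nonempty (patchedLattice v h M' ≃ₗ[R[X]] (Fin m → R[X])) := by
  have hinj : Function.Injective (algebraMap R[X] K) := FaithfulSMul.algebraMap_injective _ _
  have hMM' : M' * M = 1 := mul_eq_one_comm.1 hMM
  have hv0 : (v : K) ≠ 0 := by
    rw [hv, Ne, map_eq_zero_iff _ hinj]; exact X_ne_zero
  let 𝔹 : Subring K := (algebraMap R[X] K).range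
  have hj : ∀ y : R[X], algebraMap R[X] K y ∈ 𝔹 := fun y => ⟨y, rfl⟩
  let P := patchedLattice v h M'
  let Ψ₁ : (Fin m → R[X]) →ₗ[R[X]] P := LinearMap.codRestrict P
    (matrixRange ((v : K) ^ c • (1 : Matrix (Fin m) (Fin m) K))) (fun y => by
      rw [matrixRange_apply, Matrix.smul_mulVec, Matrix.one_mulVec]
      refine ⟨fun i => le_awaySubring (𝔹.mul_mem (𝔹.pow_mem v.2 c) (hj _)), fun i =>
        mem_awaySubring_of_mul_mem ?_⟩
      rw [Matrix.mulVec_smul, Pi.smul_apply, smul_eq_mul, Matrix.mulVec, dotProduct,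
        Finset.mul_sum, Finset.mul_sum]
      refine 𝔹.sum_mem fun k _ => ?_
      rw [show (h : K) * (v ^ c * (M' i k * algebraMap R[X] K (y k))) =
        (v ^ c * (h * M' i k)) * algebraMap R[X] K (y k) by ring]
      exact 𝔹.mul_mem (hM' i k) (hj _))
  let Ψ₂ : (Fin m → R[X]) →ₗ[R[X]] P := LinearMap.codRestrict P
    (matrixRange ((h : K) • M)) (fun y => by
      rw [matrixRange_apply]
      refine ⟨fun i => mem_awaySubring_of_pow_mul_mem c ?_, fun i => ?_⟩
      · rw [Matrix.mulVec, dotProduct, Finset.mul_sum]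
        refine 𝔹.sum_mem fun k _ => ?_
        rw [← mul_assoc]
        exact 𝔹.mul_mem (hM i k) (hj _)
      · rw [Matrix.mulVec_mulVec, Matrix.mul_smul, hMM', Matrix.smul_mulVec, Matrix.one_mulVec]
        exact le_awaySubring (𝔹.mul_mem h.2 (hj _)))
  have hΨ₁ : ∀ y i, (Ψ₁ y : Fin m → K) i = v ^ c * algebraMap R[X] K (y i) := by
    intro y i
    change matrixRange _ y i = _
    rw [matrixRange_apply, Matrix.smul_mulVec, Matrix.one_mulVec]; rfl
  have hΨ₂ : ∀ y, (Ψ₂ y : Fin m → K) = (h : K) • M *ᵥ fun i => algebraMap R[X] K (y i) := by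
    intro y
    change matrixRange _ y = _
    rw [matrixRange_apply, Matrix.smul_mulVec]
  have hmem₁ : ∀ (x : P) i, (v : K) ^ c * (x : Fin m → K) i ∈ 𝔹 := by
    intro x i
    refine mem_of_mem_awaySubring hvh
      (Subring.mul_mem _ (Subring.pow_mem _ (le_awaySubring v.2) c) (x.2.1 i)) ?_
    have : (x : Fin m → K) = M *ᵥ (M' *ᵥ x) := by
      rw [Matrix.mulVec_mulVec, hMM, Matrix.one_mulVec]
    rw [this, Matrix.mulVec, dotProduct, Finset.mul_sum]
    refine Subring.sum_mem _ fun k _ => ?_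
    rw [← mul_assoc]
    refine Subring.mul_mem _ (mem_awaySubring_of_mul_mem ?_) (x.2.2 k)
    rw [mul_left_comm]; exact hM i k
  have hmem₂ : ∀ (x : P) i, (h : K) * (M' *ᵥ (x : Fin m → K)) i ∈ 𝔹 := by
    intro x i
    refine mem_of_mem_awaySubring hvh ?_
      (Subring.mul_mem _ (le_awaySubring h.2) (x.2.2 i))
    rw [Matrix.mulVec, dotProduct, Finset.mul_sum]
    refine Subring.sum_mem _ fun k _ => ?_
    rw [← mul_assoc]
    exact Subring.mul_mem _ (mem_awaySubring_of_pow_mul_mem c (hM' i k)) (x.2.1 k)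
  obtain ⟨Φ₁, hΦ₁⟩ := exists_linearMap_of_forall_mem K
    ((Matrix.toLin' ((v : K) ^ c • (1 : Matrix (Fin m) (Fin m) K))).restrictScalars R[X] ∘ₗ
      P.subtype) (fun x i => by simpa [Matrix.smul_mulVec] using RingHom.mem_range.1 (hmem₁ x i))
  obtain ⟨Φ₂, hΦ₂⟩ := exists_linearMap_of_forall_mem K
    ((Matrix.toLin' ((h : K) • M')).restrictScalars R[X] ∘ₗ P.subtype)
    (fun x i => by simpa [Matrix.smul_mulVec] using RingHom.mem_range.1 (hmem₂ x i))
  replace hΦ₁ : ∀ (x : P) i, algebraMap R[X] K (Φ₁ x i) = v ^ c * (x : Fin m → K) i :=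
    fun x i => by simpa [Matrix.smul_mulVec] using hΦ₁ x i
  replace hΦ₂ : ∀ (x : P) i, algebraMap R[X] K (Φ₂ x i) = h * (M' *ᵥ (x : Fin m → K)) i :=
    fun x i => by simpa [Matrix.smul_mulVec] using hΦ₂ x i
  have hΨΦ₁ : ∀ x, Ψ₁ (Φ₁ x) = (X ^ (c + c) : R[X]) • x := by
    intro x
    refine Subtype.ext (funext fun i => ?_)
    rw [hΨ₁, hΦ₁, Submodule.coe_smul, Pi.smul_apply, Algebra.smul_def, map_pow, ← hv]
    ring
  obtain ⟨⟨α', α, hα⟩, ⟨β', β, hβ⟩, hαβ⟩ := (hvh.pow (m := c + c) (n := 2))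
  replace hαβ : algebraMap R[X] K α * (v : K) ^ (c + c) + algebraMap R[X] K β * (h : K) ^ 2 = 1 := by
    rw [hα, hβ]; exact congrArg Subtype.val hαβ
  let Ψ : (Fin m → R[X]) × (Fin m → R[X]) →ₗ[R[X]] P := (α • Ψ₁).coprod (β • Ψ₂)
  have hsplit : Ψ ∘ₗ (Φ₁.prod Φ₂) = LinearMap.id := by
    refine LinearMap.ext fun x => Subtype.ext (funext fun i => ?_)
    change (α • Ψ₁ (Φ₁ x) + β • Ψ₂ (Φ₂ x) : P).1 i = x.1 i
    have e₂ : (Ψ₂ (Φ₂ x) : Fin m → K) = (h : K) ^ 2 • (x : Fin m → K) := by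
      rw [hΨ₂]
      have : (fun i => algebraMap R[X] K (Φ₂ x i)) = (h : K) • M' *ᵥ (x : Fin m → K) :=
        funext fun i => hΦ₂ x i
      rw [this, Matrix.mulVec_smul, Matrix.mulVec_mulVec, hMM, Matrix.one_mulVec, smul_smul, sq]
    have e₁ : (Ψ₁ (Φ₁ x) : Fin m → K) i = v ^ (c + c) * (x : Fin m → K) i := by
      rw [hΨ₁, hΦ₁, pow_add, mul_assoc]
    rw [Submodule.coe_add, Submodule.coe_smul, Submodule.coe_smul, Pi.add_apply, Pi.smul_apply,
      Pi.smul_apply, e₁, e₂, Pi.smul_apply, Algebra.smul_def, Algebra.smul_def, smul_eq_mul]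
    linear_combination (x : Fin m → K) i * hαβ
  have hproj : Module.Projective R[X] P := Module.Projective.of_split _ _ hsplit
  have hfin : Module.Finite R[X] P :=
    Module.Finite.of_surjective Ψ fun x => ⟨_, LinearMap.congr_fun hsplit x⟩
  have hΨi : Function.Injective Ψ₁ := by
    intro y z hyz
    refine funext fun i => hinj (mul_left_cancel₀ (pow_ne_zero c hv0) ?_)
    rw [← hΨ₁, ← hΨ₁, hyz]
  refine nonempty_linearEquiv_of_pow_smul_mem (R := R) (c := c + c) (fun r _ a => H _ a) ?_
    (LinearMap.range Ψ₁) (LinearEquiv.ofInjective Ψ₁ hΨi).symm fun x => ⟨Φ₁ x, hΨΦ₁ x⟩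
  intro x hx
  refine Subtype.ext (funext fun i => ?_)
  have := congrFun (congrArg Subtype.val hx) i
  rw [Submodule.coe_smul, Pi.smul_apply, Algebra.smul_def, map_pow, ← hv] at this
  exact (mul_eq_zero.1 this).resolve_left (pow_ne_zero _ hv0)

theorem exists_pow_mem_span {m : ℕ} {v : (algebraMap R[X] K).range} {p : R[X]}
    (hp : (v : K) = algebraMap R[X] K p) {t : Fin m → K} (ht : ∀ i, t i ∈ awaySubring _ v)
    {w : Fin m → R[X]} (hw : t ⬝ᵥ (fun i => algebraMap R[X] K (w i)) = 1) :
    ∃ c : ℕ, p ^ c ∈ Ideal.span (Set.range w) := by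
  have hinj : Function.Injective (algebraMap R[X] K) := FaithfulSMul.algebraMap_injective _ _
  obtain ⟨c, hc⟩ := exists_pow_mul_mem_of_finite ht
  choose s hs using hc
  refine ⟨c, ?_⟩
  have : p ^ c = ∑ i, s i * w i := by
    apply hinj
    rw [map_sum, map_pow, ← hp, ← mul_one ((v : K) ^ c), ← hw, dotProduct, Finset.mul_sum]
    exact Finset.sum_congr rfl fun i _ => by rw [map_mul, hs, mul_assoc]
  rw [this]
  exact Ideal.sum_mem _ fun i _ => Ideal.mul_mem_left _ _ (Ideal.subset_span ⟨i, rfl⟩)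

/-- A unimodular vector over a ring `A` between `R[X]` and `R[X][1/X]` is completable if it is so
after inverting an element that is coprime to `X`. -/
theorem completable_of_patching {m : ℕ} [Nontrivial R]
    (H : ∀ r, ∀ a : Fin r → R[X], Unimodular a → Completable a)
    (A : Subring K) (hBA : (algebraMap R[X] K).range ≤ A)
    (hA : ∀ x ∈ A, ∃ c : ℕ, algebraMap R[X] K X ^ c * x ∈ (algebraMap R[X] K).range)
    (g : R[X]) (hg : IsCoprime X g) (a : Fin m → A) (ha : Unimodular a)
    {M M' : Matrix (Fin m) (Fin m) K} (hMM : M * M' = 1)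
    (hM : ∀ i j, algebraMap R[X] K g * M i j ∈ A)
    (hM' : ∀ i j, algebraMap R[X] K g * M' i j ∈ A) (i₀ : Fin m) (hMa : ∀ i, M i i₀ = a i) :
    Completable a := by
  have hinj : Function.Injective (algebraMap R[X] K) := FaithfulSMul.algebraMap_injective _ _
  let 𝔹 : Subring K := (algebraMap R[X] K).range
  have hj : ∀ y : R[X], algebraMap R[X] K y ∈ 𝔹 := fun y => ⟨y, rfl⟩
  let v : 𝔹 := ⟨algebraMap R[X] K X, X, rfl⟩
  let h : 𝔹 := ⟨algebraMap R[X] K g, g, rfl⟩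
  let vA : A := ⟨v, hBA v.2⟩
  let hA' : A := ⟨h, hBA h.2⟩
  have hv : (v : K) = algebraMap R[X] K X := rfl
  have hh : (h : K) = algebraMap R[X] K g := rfl
  have hvh : IsCoprime v h := hg.map (algebraMap R[X] K).rangeRestrict
  have hvhA : IsCoprime vA hA' := hvh.map (Subring.inclusion hBA)
  have hAv : ∀ x ∈ A, x ∈ awaySubring 𝔹 v := hA
  have hv0 : (v : K) ≠ 0 := by
    rw [hv, Ne, map_eq_zero_iff _ hinj]; exact X_ne_zero
  by_cases hg0 : (h : K) = 0
  · have hX : IsUnit (X : R[X]) := by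
      rw [hh, map_eq_zero_iff _ hinj] at hg0
      rw [hg0] at hg
      exact isCoprime_zero_right.1 hg
    exact absurd hX not_isUnit_X
  have hMM' : M' * M = 1 := mul_eq_one_comm.1 hMM
  obtain ⟨c₁, hc₁⟩ := exists_pow_mul_mem_of_finite (A := 𝔹) (v := v)
    (f := fun p : Fin m × Fin m => (h : K) * M p.1 p.2) fun p => hAv _ (hM p.1 p.2)
  obtain ⟨c₂, hc₂⟩ := exists_pow_mul_mem_of_finite (A := 𝔹) (v := v)
    (f := fun p : Fin m × Fin m => (h : K) * M' p.1 p.2) fun p => hAv _ (hM' p.1 p.2)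
  let c := c₁ + c₂
  have hc : ∀ i j, (v : K) ^ c * (h * M i j) ∈ 𝔹 := fun i j => by
    rw [pow_add, mul_right_comm, mul_comm]
    exact 𝔹.mul_mem (𝔹.pow_mem v.2 _) (hc₁ (i, j))
  have hc' : ∀ i j, (v : K) ^ c * (h * M' i j) ∈ 𝔹 := fun i j => by
    rw [pow_add, mul_assoc]
    exact 𝔹.mul_mem (𝔹.pow_mem v.2 _) (hc₂ (i, j))
  obtain ⟨f⟩ := exists_patchedLattice_equiv H hv hvh hMM hc hc'
  let N : Matrix (Fin m) (Fin m) K := Matrix.of fun i j => (f.symm (Pi.single j 1)).1 i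
  have hN : ∀ x : patchedLattice v h M', N *ᵥ (fun i => algebraMap R[X] K (f x i)) = x.1 := by
    intro x
    have e : x = ∑ j, f x j • f.symm (Pi.single j 1) := by
      conv_lhs => rw [← f.symm_apply_apply x, pi_eq_sum_univ' (f x), map_sum]
      refine Finset.sum_congr rfl fun j _ => ?_
      rw [← map_smul]
    conv_rhs => rw [e]
    ext i
    rw [Submodule.coe_sum, Finset.sum_apply, Matrix.mulVec, dotProduct]
    refine Finset.sum_congr rfl fun j _ => ?_
    rw [Submodule.coe_smul, Pi.smul_apply, Algebra.smul_def, mul_comm]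
    rfl
  have hNv : ∀ i j, N i j ∈ awaySubring 𝔹 v := fun i j => (f.symm (Pi.single j 1)).2.1 i
  have hNh : ∀ i j, (M' * N) i j ∈ awaySubring 𝔹 h := fun i j => (f.symm (Pi.single j 1)).2.2 i
  have hp : ∀ j : Fin m, (Pi.single j ((v : K) ^ c) : Fin m → K) ∈ patchedLattice v h M' := by
    intro j
    refine ⟨fun i => ?_, fun i => mem_awaySubring_of_mul_mem ?_⟩
    · rw [Pi.single_apply]
      split_ifs
      · exact le_awaySubring (𝔹.pow_mem v.2 c)
      · exact Subring.zero_mem _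
    · rw [Matrix.mulVec_single]
      have := hc' i j
      simpa [mul_comm, mul_left_comm, mul_assoc] using RingHom.mem_range.1 this
  have hq : ∀ j : Fin m, (fun i => (h : K) * M i j) ∈ patchedLattice v h M' := by
    intro j
    refine ⟨fun i => ⟨c, hc i j⟩, fun i => le_awaySubring ?_⟩
    have e : (fun i => (h : K) * M i j) = (h : K) • M *ᵥ Pi.single j 1 := by
      ext i; simp
    rw [e, Matrix.mulVec_smul, Matrix.mulVec_mulVec, hMM', Matrix.one_mulVec, Pi.smul_apply,
      Pi.single_apply]
    split_ifs
    · rw [smul_eq_mul, mul_one]; exact h.2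
    · rw [smul_zero]; exact 𝔹.zero_mem
  let N' : Matrix (Fin m) (Fin m) K :=
    Matrix.of fun i j => ((v : K) ^ c)⁻¹ * algebraMap R[X] K (f ⟨_, hp j⟩ i)
  let Y' : Matrix (Fin m) (Fin m) K :=
    Matrix.of fun i j => (h : K)⁻¹ * algebraMap R[X] K (f ⟨_, hq j⟩ i)
  have hNN' : N * N' = 1 := by
    ext i j
    have := congrFun (hN ⟨_, hp j⟩) i
    rw [Matrix.mul_apply, Matrix.one_apply]
    simp only [N', Matrix.of_apply, mul_left_comm _ ((v : K) ^ c)⁻¹]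
    rw [← Finset.mul_sum]
    refine (congrArg (fun z => ((v : K) ^ c)⁻¹ * z) this).trans ?_
    simp only [Pi.single_apply]
    split_ifs
    · exact inv_mul_cancel₀ (pow_ne_zero c hv0)
    · exact mul_zero _
  have hNY : N * Y' = M := by
    ext i j
    have := congrFun (hN ⟨_, hq j⟩) i
    rw [Matrix.mul_apply]
    simp only [Y', Matrix.of_apply, mul_left_comm _ (h : K)⁻¹]
    rw [← Finset.mul_sum]
    refine (congrArg (fun z => (h : K)⁻¹ * z) this).trans ?_
    exact inv_mul_cancel_left₀ hg0 _
  have hN'N : N' * N = 1 := mul_eq_one_comm.1 hNN'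
  have hYY' : (M' * N) * Y' = 1 := by rw [Matrix.mul_assoc, hNY, hMM']
  have hY' : Y' = N' * M := by rw [← hNY, ← Matrix.mul_assoc, hN'N, Matrix.one_mul]
  have hN'v : ∀ i j, N' i j ∈ awaySubring 𝔹 v := fun i j =>
    mem_awaySubring_of_pow_mul_mem c (by
      change (v : K) ^ c * (((v : K) ^ c)⁻¹ * _) ∈ 𝔹
      rw [mul_inv_cancel_left₀ (pow_ne_zero c hv0)]; exact hj _)
  have hY'h : ∀ i j, Y' i j ∈ awaySubring 𝔹 h := fun i j =>
    mem_awaySubring_of_mul_mem (by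
      change (h : K) * ((h : K)⁻¹ * _) ∈ 𝔹
      rw [mul_inv_cancel_left₀ hg0]; exact hj _)
  have hw : ∀ i, Y' i i₀ ∈ 𝔹 := by
    refine fun i => mem_of_mem_awaySubring hvh ?_ (hY'h i i₀)
    rw [hY', Matrix.mul_apply]
    refine Subring.sum_mem _ fun k _ => Subring.mul_mem _ (hN'v i k) ?_
    rw [hMa]
    exact hAv _ (a k).2
  choose w hw using hw
  have hwu : Unimodular w := by
    obtain ⟨b, hb⟩ := ha
    obtain ⟨c₃, hc₃⟩ := exists_pow_mem_span (w := w) hv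
      (t := (fun k => (b k : K)) ᵥ* N) (fun i => by
        rw [Matrix.vecMul, dotProduct]
        exact Subring.sum_mem _ fun k _ => Subring.mul_mem _ (hAv _ (b k).2) (hNv k i)) (by
        have e : (fun i => algebraMap R[X] K (w i)) = fun i => Y' i i₀ := funext hw
        have e' : N *ᵥ (fun i => Y' i i₀) = fun i => (a i : K) := by
          ext i
          rw [← hMa, ← hNY]; rfl
        rw [e, ← Matrix.dotProduct_mulVec, e']
        have := congrArg (Subring.subtype A) hb
        simpa [dotProduct] using this)
    obtain ⟨c₄, hc₄⟩ := exists_pow_mem_span (w := w) hh (t := (M' * N) i₀) (hNh i₀) (by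
        have e : (fun i => algebraMap R[X] K (w i)) = fun i => Y' i i₀ := funext hw
        rw [e]
        have := congrFun (congrFun hYY' i₀) i₀
        rwa [Matrix.mul_apply, Matrix.one_apply_eq] at this)
    rw [unimodular_iff, Ideal.eq_top_iff_one]
    obtain ⟨α, β, e⟩ := hg.pow (m := c₃) (n := c₄)
    rw [← e]
    exact Ideal.add_mem _ (Ideal.mul_mem_left _ _ hc₃) (Ideal.mul_mem_left _ _ hc₄)
  obtain ⟨_, ⟨u, rfl⟩, hu⟩ := (H m w hwu).rowEquiv i₀
  let j : R[X] →+* K := algebraMap R[X] K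
  let W : Matrix (Fin m) (Fin m) K := (u : Matrix (Fin m) (Fin m) R[X]).map j
  let W' : Matrix (Fin m) (Fin m) K := (↑u⁻¹ : Matrix (Fin m) (Fin m) R[X]).map j
  have hWW' : W * W' = 1 := by
    rw [← Matrix.map_mul, u.mul_inv, Matrix.map_one _ (map_zero j) (map_one j)]
  have hWm : ∀ {S : Subring K}, 𝔹 ≤ S → ∀ i k, W i k ∈ S := fun hS i k => hS (hj _)
  have hWm' : ∀ {S : Subring K}, 𝔹 ≤ S → ∀ i k, W' i k ∈ S := fun hS i k => hS (hj _)
  have hWw : ∀ i, W i i₀ = Y' i i₀ := by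
    intro i
    rw [← hw i, ← hu, Matrix.mulVec_single]
    simp [W, j]
  have hvA : awaySubring 𝔹 v ≤ awaySubring A vA := fun x ⟨n, hn⟩ => ⟨n, hBA hn⟩
  have hhA : awaySubring 𝔹 h ≤ awaySubring A hA' := fun x ⟨n, hn⟩ => ⟨n, hBA hn⟩
  have h1 : ∀ i k, (N * W) i k ∈ A := by
    refine fun i k => mem_of_mem_awaySubring hvhA
      (hvA (matrix_mul_mem hNv (hWm le_awaySubring) i k)) ?_
    have e : N * W = M * ((M' * N) * W) := by
      rw [← Matrix.mul_assoc, ← Matrix.mul_assoc, hMM, Matrix.one_mul]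
    rw [e]
    exact matrix_mul_mem (fun i k => mem_awaySubring_of_mul_mem (hM i k))
      (fun i k => hhA (matrix_mul_mem hNh (hWm le_awaySubring) i k)) i k
  have h2 : ∀ i k, (W' * N') i k ∈ A := by
    refine fun i k => mem_of_mem_awaySubring hvhA
      (hvA (matrix_mul_mem (hWm' le_awaySubring) hN'v i k)) ?_
    have e : W' * N' = (W' * Y') * M' := by
      rw [hY', Matrix.mul_assoc, Matrix.mul_assoc, hMM, Matrix.mul_one]
    rw [e]
    exact matrix_mul_mem (fun i k => hhA (matrix_mul_mem (hWm' le_awaySubring) hY'h i k))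
      (fun i k => mem_awaySubring_of_mul_mem (hM' i k)) i k
  let Z : Matrix (Fin m) (Fin m) A := Matrix.of fun i k => ⟨_, h1 i k⟩
  let Z' : Matrix (Fin m) (Fin m) A := Matrix.of fun i k => ⟨_, h2 i k⟩
  have hZ : Z * Z' = 1 := by
    have hinj' : Function.Injective fun Q : Matrix (Fin m) (Fin m) A => Q.map A.subtype :=
      Matrix.map_injective A.subtype_injective
    apply hinj'
    change (Z * Z').map A.subtype = (1 : Matrix (Fin m) (Fin m) A).map A.subtype
    rw [Matrix.map_mul, Matrix.map_one _ (map_zero _) (map_one _)]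
    change (N * W) * (W' * N') = 1
    rw [Matrix.mul_assoc, ← Matrix.mul_assoc W, hWW', Matrix.one_mul, hNN']
  refine ⟨i₀, Z, ⟨⟨Z, Z', hZ, mul_eq_one_comm.1 hZ⟩, rfl⟩, ?_⟩
  ext i
  rw [Matrix.mulVec_single]
  have : (N * W) i i₀ = a i := by
    rw [← hMa, ← hNY, Matrix.mul_apply, Matrix.mul_apply]
    exact Finset.sum_congr rfl fun k _ => by rw [hWw]
  simpa [Z] using this

end Patching

section Dimension

open Polynomial

variable {A : Type*} [CommRing A] {I I' J : Ideal A} {s s' : ℕ}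

/-- Every chain of primes containing `I` has fewer than `s` steps; that is, `dim A / I < s`. -/
def DimLT (I : Ideal A) (s : ℕ) : Prop :=
  ∀ p : LTSeries (PrimeSpectrum A), I ≤ p.head.asIdeal → p.length < s

theorem DimLT.of_forall_prime (h : DimLT I s)
    (hI : ∀ p : Ideal A, p.IsPrime → I' ≤ p → I ≤ p) : DimLT I' s :=
  fun p hp => h p (hI _ p.head.2 hp)

theorem DimLT.mono_left (h : DimLT I s) (hI : I ≤ I') : DimLT I' s :=
  fun p hp => h p (hI.trans hp)

theorem DimLT.mono_right (h : DimLT I s) (hs : s ≤ s') : DimLT I s' :=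
  fun p hp => (h p hp).trans_le hs

theorem dimLT_zero_iff : DimLT I 0 ↔ I = ⊤ := by
  constructor
  · intro h
    by_contra hI
    obtain ⟨M, hM, hIM⟩ := Ideal.exists_le_maximal I hI
    exact absurd (h (RelSeries.singleton _ ⟨M, hM.isPrime⟩) hIM) (Nat.not_lt_zero _)
  · rintro rfl p hp
    exact absurd (top_le_iff.1 hp) p.head.2.ne_top

theorem DimLT.isMaximal (h : DimLT I 1) {p : Ideal A} (hp : p.IsPrime) (hI : I ≤ p) :
    p.IsMaximal := by
  obtain ⟨M, hM, hpM⟩ := Ideal.exists_le_maximal p hp.ne_top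
  rcases hpM.eq_or_lt with rfl | hlt
  · exact hM
  · let q : LTSeries (PrimeSpectrum A) :=
      (RelSeries.singleton _ (⟨M, hM.isPrime⟩ : PrimeSpectrum A)).cons ⟨p, hp⟩
        (show (⟨p, hp⟩ : PrimeSpectrum A) < ⟨M, hM.isPrime⟩ from hlt)
    exact absurd (h q hI) (lt_irrefl 1)

theorem exists_dimLT_sup_span_eval {k : Type*} [Field k] [Infinite k] [Algebra k A]
    [IsNoetherianRing A] (P : A[X]) (h : DimLT I (s + 1))
    (h' : DimLT (I ⊔ Ideal.span (Set.range P.coeff)) s) :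
    ∃ c : k, DimLT (I ⊔ Ideal.span {P.eval (algebraMap k A c)}) s := by
  classical
  let bad : Ideal A → Set k := fun p =>
    {c | P.map (Ideal.Quotient.mk p) ≠ 0 ∧ P.eval (algebraMap k A c) ∈ p}
  have hbad : (⋃ p ∈ I.minimalPrimes, bad p).Finite := by
    refine Set.Finite.biUnion I.finite_minimalPrimes_of_isNoetherianRing fun p hp => ?_
    have : p.IsPrime := hp.1.1
    by_cases h0 : P.map (Ideal.Quotient.mk p) = 0
    · refine Set.Finite.subset Set.finite_empty fun c hc => hc.1 h0
    have hinj : Function.Injective (algebraMap k (A ⧸ p)) := FaithfulSMul.algebraMap_injective _ _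
    refine Set.Finite.subset (((P.map (Ideal.Quotient.mk p)).roots.toFinset.finite_toSet).preimage
      (f := algebraMap k (A ⧸ p)) hinj.injOn) fun c hc => ?_
    rw [Set.mem_preimage, Finset.mem_coe, Multiset.mem_toFinset, mem_roots h0, IsRoot.def]
    rw [show algebraMap k (A ⧸ p) c = Ideal.Quotient.mk p (algebraMap k A c) from rfl,
      eval_map, eval₂_at_apply]
    exact Ideal.Quotient.eq_zero_iff_mem.2 hc.2
  obtain ⟨c, hc⟩ := hbad.exists_notMem
  refine ⟨c, fun q hq => ?_⟩
  obtain ⟨p, hp, hpq⟩ := Ideal.exists_minimalPrimes_le (le_sup_left.trans hq)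
  have hpp : p.IsPrime := hp.1.1
  have hev : P.eval (algebraMap k A c) ∈ q.head.asIdeal :=
    hq (Ideal.mem_sup_right (Ideal.mem_span_singleton_self _))
  by_cases h0 : P.map (Ideal.Quotient.mk p) = 0
  · refine h' q (sup_le (le_sup_left.trans hq) (Ideal.span_le.2 ?_))
    rintro _ ⟨i, rfl⟩
    refine hpq (Ideal.Quotient.eq_zero_iff_mem.1 ?_)
    rw [← coeff_map, h0, coeff_zero]
  · have hlt : (⟨p, hpp⟩ : PrimeSpectrum A) < q.head := by
      refine lt_of_le_of_ne hpq fun e => hc ?_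
      rw [Set.mem_iUnion₂]
      exact ⟨p, hp, h0, by rw [← e] at hev; exact hev⟩
    have := h (q.cons ⟨p, hpp⟩ hlt) hp.1.2
    simpa using this

theorem exists_pow_eq_of_isUnit {k : Type*} [Field k] [IsAlgClosed k] [Algebra k A]
    [IsNoetherianRing A] (hmax : ∀ p : Ideal A, p.IsPrime → p.IsMaximal)
    (hres : ∀ p : Ideal A, p.IsMaximal → ∀ x, ∃ c : k, x - algebraMap k A c ∈ p)
    {e : ℕ} (he : (e : k) ≠ 0) {g : A} (hg : IsUnit g) : ∃ y, y ^ e = g := by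
  have he0 : e ≠ 0 := by rintro rfl; simp at he
  let ι := {p : Ideal A // p ∈ minimalPrimes A}
  have hfin : Finite ι := (minimalPrimes.finite_of_isNoetherianRing A)
  have hι : ∀ p : ι, p.1.IsMaximal := fun p => hmax _ p.2.1.1
  have hex : ∀ p : ι, ∃ d : k, algebraMap k A d ^ e - g ∈ p.1 := by
    intro p
    obtain ⟨c, hc⟩ := hres p.1 (hι p) g
    obtain ⟨d, hd⟩ := IsAlgClosed.exists_pow_nat_eq c (Nat.pos_of_ne_zero he0)
    refine ⟨d, ?_⟩
    rw [← map_pow, hd, ← neg_sub]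
    exact p.1.neg_mem hc
  choose d hd using hex
  have hcop : Pairwise (Function.onFun IsCoprime fun p : ι => p.1) := by
    intro p q hpq
    have := hι p
    have := hι q
    exact Ideal.isCoprime_of_isMaximal fun h => hpq (Subtype.ext h)
  obtain ⟨y, hy⟩ := Ideal.exists_forall_sub_mem_ideal hcop fun p => algebraMap k A (d p)
  have hyg : ∀ p : ι, y ^ e - g ∈ p.1 := by
    intro p
    have h1 : y ^ e - algebraMap k A (d p) ^ e ∈ p.1 :=
      Ideal.mem_of_dvd _ (sub_dvd_pow_sub_pow _ _ e) (hy p)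
    simpa using p.1.add_mem h1 (hd p)
  have hnil : IsNilpotent (y ^ e - g) := by
    rw [← mem_nilradical, nilradical_eq_sInf, Ideal.mem_sInf]
    intro p (hp : p.IsPrime)
    obtain ⟨q, hq, hqp⟩ := Ideal.exists_minimalPrimes_le (bot_le : (⊥ : Ideal A) ≤ p)
    exact hqp (hyg ⟨q, hq⟩)
  have hy : IsUnit y := by
    have : IsUnit (y ^ e) := by
      have := hnil.isUnit_add_left_of_commute hg (Commute.all _ _)
      simpa using this
    exact (isUnit_pow_iff he0).1 this
  obtain ⟨z, ⟨-, hz⟩, -⟩ := existsUnique_nilpotent_sub_and_aeval_eq_zero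
    (P := (X ^ e - C g : A[X])) (x := y) (by simpa using hnil) (by
      simp only [derivative_sub, derivative_X_pow, derivative_C, sub_zero, map_mul, map_natCast,
        map_pow, aeval_X]
      refine IsUnit.mul ?_ (hy.pow _)
      have := (IsUnit.mk0 _ he).map (algebraMap k A)
      simpa using this)
  exact ⟨z, by simpa [sub_eq_zero] using hz⟩

theorem exists_sub_mem_dimLT {k : Type*} [Field k] [Infinite k] [Algebra k A]
    [IsNoetherianRing A] {g : A} {b : ℕ → A} (h : DimLT J s) (l : ℕ)
    (hb : ∀ j ≤ l, DimLT (J ⊔ Ideal.span {g} ⊔ Ideal.span (b '' Set.Iio j)) (s - 1 - j)) :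
    ∃ w : ℕ → A, (∀ i, w i - b i ∈ Ideal.span {g}) ∧
      ∀ j ≤ l, DimLT (J ⊔ Ideal.span (w '' Set.Iio j)) (s - j) := by
  induction l with
  | zero =>
    refine ⟨b, fun i => by simp, fun j hj => ?_⟩
    obtain rfl := Nat.le_zero.1 hj
    exact h.mono_left le_sup_left
  | succ l ih =>
    obtain ⟨w, hw, H⟩ := ih fun j hj => hb j (hj.trans l.le_succ)
    obtain ⟨c, hc⟩ : ∃ c : k, DimLT (J ⊔ Ideal.span (w '' Set.Iio l) ⊔
        Ideal.span {w l + g * algebraMap k A c}) (s - (l + 1)) := by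
      rcases Nat.eq_zero_or_pos (s - l) with h0 | h0
      · refine ⟨0, ((H l le_rfl).mono_right (by lia)).mono_left le_sup_left⟩
      · have := exists_dimLT_sup_span_eval (k := k) (s := s - (l + 1)) (C (w l) + C g * X)
          ((H l le_rfl).mono_right (by lia)) (((hb (l + 1) le_rfl).mono_right (by lia)).mono_left ?_)
        · simpa using this
        have h0 : w l ∈ Ideal.span (Set.range (C (w l) + C g * X).coeff) :=
          Ideal.subset_span ⟨0, by simp⟩
        have h1 : g ∈ Ideal.span (Set.range (C (w l) + C g * X).coeff) :=
          Ideal.subset_span ⟨1, by simp [coeff_C]⟩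
        have hgle : Ideal.span {g} ≤ Ideal.span (Set.range (C (w l) + C g * X).coeff) :=
          (Ideal.span_singleton_le_iff_mem _).2 h1
        refine sup_le (sup_le (le_sup_left.trans le_sup_left) (hgle.trans le_sup_right)) ?_
        rw [Ideal.span_le]
        rintro _ ⟨i, hi, rfl⟩
        have hi' : b i = w i - (w i - b i) := by ring
        rw [hi']
        refine Ideal.sub_mem _ ?_ (Ideal.mem_sup_right (hgle (hw i)))
        rcases (Nat.lt_succ_iff_lt_or_eq.1 hi) with hi | rfl
        · exact Ideal.mem_sup_left (Ideal.mem_sup_right (Ideal.subset_span ⟨i, hi, rfl⟩))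
        · exact Ideal.mem_sup_right h0
    refine ⟨Function.update w l (w l + g * algebraMap k A c), fun i => ?_, fun j hj => ?_⟩
    · by_cases hi : i = l
      · subst hi
        rw [Function.update_self, add_sub_right_comm]
        exact Ideal.add_mem _ (hw i) (Ideal.mul_mem_right _ _ (Ideal.mem_span_singleton_self g))
      · rw [Function.update_of_ne hi]
        exact hw i
    · have himg : ∀ j ≤ l, Function.update w l (w l + g * algebraMap k A c) '' Set.Iio j =
          w '' Set.Iio j := fun j hj => Set.image_congr fun i (hi : i < j) =>
            Function.update_of_ne (by lia) _ _
      rcases Nat.le_succ_iff.1 hj with hj | rfl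
      · rw [himg j hj]
        exact H j hj
      · refine hc.mono_left ?_
        refine sup_le (sup_le le_sup_left ?_) ?_
        · rw [← himg l le_rfl]
          exact (Ideal.span_mono (Set.image_mono (Set.Iio_subset_Iio l.le_succ))).trans le_sup_right
        · rw [Ideal.span_singleton_le_iff_mem]
          exact Ideal.mem_sup_right (Ideal.subset_span ⟨l, Nat.lt_succ_self l, by simp⟩)

end Dimension

section PowerRows

open Polynomial

variable {A : Type*} [CommRing A]

theorem RowEquiv.snoc {r : ℕ} {a b : Fin r → A} (h : RowEquiv a b) (c : A) :
    RowEquiv (Fin.snoc a c : Fin (r + 1) → A) (Fin.snoc b c) := by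
  have key : ∀ a : Fin r → A, (Fin.snoc a c : Fin (r + 1) → A) =
      Sum.elim a (fun _ : Fin 1 => c) ∘ finSumFinEquiv.symm := by
    intro a
    funext i
    induction i using Fin.lastCases with
    | last => simp
    | cast i => simp
  rw [key a, key b]
  exact (h.sumElim _).reindex _

theorem RowEquiv.snoc_add_mem {r : ℕ} (a : Fin r → A) {c x : A}
    (hx : x ∈ Ideal.span (Set.range a)) :
    RowEquiv (Fin.snoc a c : Fin (r + 1) → A) (Fin.snoc a (c + x)) := by
  have := RowEquiv.add_mem (Fin.snoc a c : Fin (r + 1) → A) (Fin.last r) (x := x) (by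
    refine Ideal.span_mono ?_ hx
    rintro _ ⟨i, rfl⟩
    exact ⟨i.castSucc, i.castSucc_ne_last, by simp⟩)
  rwa [Fin.snoc_last, Fin.update_snoc_last] at this

theorem RowEquiv.snoc_sub_mul {r : ℕ} (a : Fin r → A) (g : A) (c : Fin r → A) :
    RowEquiv (Fin.snoc a g : Fin (r + 1) → A) (Fin.snoc (fun i => a i - c i * g) g) := by
  refine RowEquiv.of_sub_mem {Fin.last r} ?_ ?_
  · rintro _ rfl
    simp
  · intro i hi
    induction i using Fin.lastCases with
    | last => exact absurd rfl hi
    | cast i =>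
      simp only [Fin.snoc_castSucc, Set.image_singleton, Fin.snoc_last]
      rw [sub_sub_cancel_left, ← neg_mul]
      exact Ideal.mul_mem_left _ _ (Ideal.mem_span_singleton_self g)

theorem exists_rowEquiv_snoc_dimLT {k : Type*} [Field k] [Infinite k] [Algebra k A]
    [IsNoetherianRing A] {J : Ideal A} {r t : ℕ} (a : Fin (r + 1) → A)
    (ha : J ⊔ Ideal.span (Set.range a) = ⊤) (h : DimLT J (t + 1)) :
    ∃ g, RowEquiv a (Fin.snoc (fun i : Fin r => a i.castSucc) g) ∧ DimLT (J ⊔ Ideal.span {g}) t := by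
  let P : A[X] := ∑ i : Fin (r + 1), C (a i.rev) * X ^ (i : ℕ)
  obtain ⟨c, hc⟩ := exists_dimLT_sup_span_eval (k := k) P h (by
    refine DimLT.mono_left (I := ⊤) (dimLT_zero_iff.2 rfl |>.mono_right t.zero_le) ?_
    rw [← ha]
    refine sup_le_sup_left (Ideal.span_mono ?_) _
    rintro _ ⟨i, rfl⟩
    refine ⟨(i.rev : ℕ), ?_⟩
    simp only [P, finsetSum_coeff, coeff_C_mul_X_pow, Fin.val_inj]
    simp)
  refine ⟨_, ?_, hc⟩
  have hP : P.eval (algebraMap k A c) = a (Fin.last r) +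
      ∑ i : Fin r, a i.succ.rev * algebraMap k A c ^ ((i : ℕ) + 1) := by
    simp [P, eval_finsetSum, Fin.sum_univ_succ]
  rw [hP]
  refine (RowEquiv.of_eq ?_).trans (RowEquiv.snoc_add_mem _ (c := a (Fin.last r)) ?_)
  · funext i
    induction i using Fin.lastCases <;> simp
  · refine Ideal.sum_mem _ fun i _ => Ideal.mul_mem_right _ _ (Ideal.subset_span ⟨i.rev, ?_⟩)
    simp [Fin.rev_succ]

theorem exists_sub_pow_mem {k : Type*} [Field k] [IsAlgClosed k] [Algebra k A]
    [IsNoetherianRing A] {I : Ideal A} (h : DimLT I 1)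
    (hres : ∀ p : Ideal A, p.IsMaximal → I ≤ p → ∀ x, ∃ c : k, x - algebraMap k A c ∈ p)
    {e : ℕ} (he : (e : k) ≠ 0) {g : A} (hg : I ⊔ Ideal.span {g} = ⊤) :
    ∃ y, g - y ^ e ∈ I := by
  suffices H : ∃ y, y ^ e = Ideal.Quotient.mk I g by
    obtain ⟨y, hy⟩ := H
    obtain ⟨y, rfl⟩ := Ideal.Quotient.mk_surjective y
    refine ⟨y, ?_⟩
    rw [← Ideal.Quotient.eq_zero_iff_mem, map_sub, map_pow, hy, sub_self]
  refine exists_pow_eq_of_isUnit (k := k) ?_ ?_ he ?_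
  · intro p hp
    have h1 : I ≤ p.comap (Ideal.Quotient.mk I) := by
      intro x hx
      rw [Ideal.mem_comap, Ideal.Quotient.eq_zero_iff_mem.2 hx]
      exact p.zero_mem
    have hm : (p.comap (Ideal.Quotient.mk I)).IsMaximal := h.isMaximal inferInstance h1
    rw [← Ideal.map_comap_of_surjective _ Ideal.Quotient.mk_surjective p]
    refine (Ideal.map_eq_top_or_isMaximal_of_surjective _ Ideal.Quotient.mk_surjective hm).resolve_left ?_
    rw [Ideal.map_comap_of_surjective _ Ideal.Quotient.mk_surjective p]
    exact hp.ne_top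
  · intro p hp x
    obtain ⟨x, rfl⟩ := Ideal.Quotient.mk_surjective x
    have hm : (p.comap (Ideal.Quotient.mk I)).IsMaximal :=
      Ideal.comap_isMaximal_of_surjective _ Ideal.Quotient.mk_surjective
    have h1 : I ≤ p.comap (Ideal.Quotient.mk I) := by
      intro x hx
      rw [Ideal.mem_comap, Ideal.Quotient.eq_zero_iff_mem.2 hx]
      exact p.zero_mem
    obtain ⟨c, hc⟩ := hres _ hm h1 x
    exact ⟨c, by simpa using hc⟩
  · rw [Ideal.eq_top_iff_one, Submodule.mem_sup] at hg
    obtain ⟨i, hi, z, hz, hiz⟩ := hg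
    obtain ⟨w, rfl⟩ := Ideal.mem_span_singleton'.1 hz
    refine IsUnit.of_mul_eq_one (Ideal.Quotient.mk I w) ?_
    rw [← map_mul, ← map_one (Ideal.Quotient.mk I), ← hiz, map_add,
      Ideal.Quotient.eq_zero_iff_mem.2 hi, zero_add, mul_comm]

theorem exists_rowEquiv_pow {k : Type*} [Field k] [IsAlgClosed k] [Algebra k A]
    [IsNoetherianRing A] {J₀ : Ideal A}
    (hres : ∀ p : Ideal A, p.IsMaximal → J₀ ≤ p → ∀ x, ∃ c : k, x - algebraMap k A c ∈ p)
    {e : ℕ → ℕ} (he : ∀ i, e i ≠ 0) (r : ℕ) (J : Ideal A) (hJ : J₀ ≤ J) (s : ℕ) (hs : s ≤ r)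
    (a : Fin r → A) (ha : J ⊔ Ideal.span (Set.range a) = ⊤) (hd : DimLT J s)
    (hek : s = r → ∀ i < r, (e i : k) ≠ 0) :
    ∃ (a' : Fin r → A) (b : ℕ → A), RowEquiv a a' ∧ (∀ i : Fin r, a' i - b i ^ e i ∈ J) ∧
      ∀ j ≤ r, DimLT (J ⊔ Ideal.span (b '' Set.Iio j)) (s - j) := by
  induction r generalizing J s with
  | zero =>
    obtain rfl := Nat.le_zero.1 hs
    refine ⟨a, fun _ => 0, .refl _, fun i => i.elim0, fun j hj => ?_⟩
    exact (hd.mono_right (Nat.zero_le _)).mono_left le_sup_left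
  | succ r ih =>
    rcases s with _ | t
    · obtain rfl := dimLT_zero_iff.1 hd
      exact ⟨a, fun _ => 0, .refl _, fun i => Submodule.mem_top, fun j hj =>
        (hd.mono_right (Nat.zero_le _)).mono_left le_sup_left⟩
    have : Infinite k := IsAlgClosed.instInfinite
    obtain ⟨g, hag, hg⟩ := exists_rowEquiv_snoc_dimLT (k := k) a ha hd
    have hspan : ∀ (a' : Fin r → A) (g : A), Ideal.span (Set.range (Fin.snoc a' g : Fin (r + 1) → A)) =
        Ideal.span {g} ⊔ Ideal.span (Set.range a') := by
      intro a' g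
      rw [Fin.range_snoc, Set.insert_eq, Ideal.span_union]
    obtain ⟨a₁, b₁, h₁, hab₁, hd₁⟩ := ih (J ⊔ Ideal.span {g}) (hJ.trans le_sup_left) t (by lia)
      (fun i => a i.castSucc) (by rw [sup_assoc, ← hspan, ← hag.span_eq, ha]) hg
      (fun h i hi => hek (by lia) i (by lia))
    obtain ⟨b, hb, hdb⟩ := exists_sub_mem_dimLT (k := k) hd r hd₁
    have hab : ∀ i : Fin r, ∃ c, a₁ i - c * g - b i ^ e i ∈ J := by
      intro i
      have h2 : a₁ i - b i ^ e i ∈ J ⊔ Ideal.span {g} := by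
        have := Ideal.mem_of_dvd (Ideal.span {g}) (sub_dvd_pow_sub_pow _ _ (e i)) (hb i)
        have := Ideal.sub_mem _ (hab₁ i) (Ideal.mem_sup_right (S := J) this)
        convert this using 1
        ring
      obtain ⟨x, hx, y, hy, hxy⟩ := Submodule.mem_sup.1 h2
      obtain ⟨c, rfl⟩ := Ideal.mem_span_singleton'.1 hy
      refine ⟨c, ?_⟩
      convert hx using 1
      linear_combination -hxy
    choose c hc using hab
    set a₂ : Fin r → A := fun i => a₁ i - c i * g with ha₂
    have hR : RowEquiv a (Fin.snoc a₂ g) := hag.trans ((h₁.snoc g).trans (.snoc_sub_mul a₁ g c))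
    set I := J ⊔ Ideal.span (Set.range a₂) with hI
    have hIg : I ⊔ Ideal.span {g} = ⊤ := by
      rw [hI, sup_assoc, sup_comm (Ideal.span _), ← hspan, ← hR.span_eq, ha]
    have hdI : DimLT I (t + 1 - r) := by
      refine (hdb r le_rfl).of_forall_prime fun p hp hIp => ?_
      refine sup_le (le_sup_left.trans hIp) (Ideal.span_le.2 ?_)
      rintro _ ⟨i, hi, rfl⟩
      have h1 := hIp (Ideal.mem_sup_left (hc ⟨i, hi⟩))
      have h2 : a₂ ⟨i, hi⟩ ∈ p := hIp (Ideal.mem_sup_right (Ideal.subset_span ⟨_, rfl⟩))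
      have h3 := Ideal.sub_mem _ h2 h1
      exact hp.mem_of_pow_mem (e i) (by simpa [ha₂] using h3)
    obtain ⟨y, hy⟩ : ∃ y, g - y ^ e r ∈ I := by
      rcases Nat.lt_or_ge t r with h | h
      · obtain hI := dimLT_zero_iff.1 (hdI.mono_right (s' := 0) (by lia))
        exact ⟨1, hI ▸ Submodule.mem_top⟩
      · exact exists_sub_pow_mem (hdI.mono_right (by lia))
          (fun p hp hIp => hres p hp (hJ.trans (le_sup_left.trans hIp)))
          (hek (by lia) r r.lt_succ_self) hIg
    obtain ⟨x, hx, w, hw, hxw⟩ := Submodule.mem_sup.1 hy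
    have hR' : RowEquiv a (Fin.snoc a₂ (g + -w)) :=
      hR.trans (.snoc_add_mem a₂ (neg_mem hw))
    have hb' : ∀ j ≤ r, Function.update b r y '' Set.Iio j = b '' Set.Iio j := fun j hj =>
      Set.image_congr fun i (hi : i < j) => Function.update_of_ne (by lia) _ _
    have hmem : ∀ i : Fin (r + 1), (Fin.snoc a₂ (g + -w) : Fin (r + 1) → A) i -
        Function.update b r y i ^ e i ∈ J := by
      intro i
      induction i using Fin.lastCases with
      | last =>
        rw [Fin.snoc_last, Fin.val_last, Function.update_self]
        convert hx using 1
        linear_combination -hxw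
      | cast i =>
        rw [Fin.snoc_castSucc, Fin.val_castSucc, Function.update_of_ne i.2.ne]
        exact hc i
    refine ⟨_, Function.update b r y, hR', hmem, fun j hj => ?_⟩
    rcases Nat.le_succ_iff.1 hj with hj | rfl
    · rw [hb' j hj]
      exact hdb j hj
    · refine DimLT.of_forall_prime (I := ⊤) ((dimLT_zero_iff.2 rfl).mono_right (Nat.zero_le _))
        fun p hp hIp => ?_
      rw [← ha, hR'.span_eq]
      refine sup_le (le_sup_left.trans hIp) (Ideal.span_le.2 ?_)
      rintro _ ⟨i, rfl⟩
      have h1 := hIp (Ideal.mem_sup_left (hmem i))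
      have h2 : Function.update b r y i ∈ p :=
        hIp (Ideal.mem_sup_right (Ideal.subset_span ⟨i, i.2, rfl⟩))
      have h3 := Ideal.add_mem _ h1 (Ideal.pow_mem_of_mem _ h2 (e i) (Nat.pos_of_ne_zero (he i)))
      simpa using h3

end PowerRows

section RowReduction

variable {A : Type*} [CommRing A] {ι : Type*} [Fintype ι] [DecidableEq ι]

theorem mem_of_isMaximal_of_forall_exists {v z : A}
    (hv : ∀ x, ∃ y, y * (1 + v * x) - 1 ∈ Ideal.span {z}) {p : Ideal A} (hp : p.IsMaximal)
    (hz : z ∈ p) : v ∈ p := by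
  by_contra h
  obtain ⟨w, i, hi, hw⟩ := hp.exists_inv h
  obtain ⟨y, hy⟩ := hv (-w)
  have h1 := (Ideal.span_singleton_le_iff_mem p).2 hz hy
  refine hp.ne_top ((Ideal.eq_top_iff_one _).2 ?_)
  have h2 := Ideal.sub_mem _ (Ideal.mul_mem_left _ y hi) h1
  convert h2 using 1
  linear_combination (-y) * hw

theorem Unimodular.exists_rowEquiv_update {ρ : ι → A} (hρ : Unimodular ρ) {v β c : A} {z t p : ι}
    (hzt : z ≠ t) (hzp : z ≠ p) (htp : t ≠ p)
    (hv : ∀ x, ∃ y, y * (1 + v * x) - 1 ∈ Ideal.span {ρ z}) (hp : ρ p = β + v * c) :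
    ∃ y, RowEquiv ρ (Function.update (Function.update ρ t y) p β) := by
  set I := Ideal.span (ρ '' {j | j ≠ t ∧ j ≠ p}) with hI
  have hzI : ρ z ∈ I := Ideal.subset_span ⟨z, ⟨hzt, hzp⟩, rfl⟩
  have htop : Ideal.span {ρ t} ⊔ Ideal.span {β} ⊔ I = ⊤ := by
    by_contra h
    obtain ⟨M, hM, hle⟩ := Ideal.exists_le_maximal _ h
    have hvM := mem_of_isMaximal_of_forall_exists hv hM (hle (Ideal.mem_sup_right hzI))
    have htM : ρ t ∈ M :=
      hle (Ideal.mem_sup_left (Ideal.mem_sup_left (Ideal.mem_span_singleton_self _)))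
    have hβM : β ∈ M :=
      hle (Ideal.mem_sup_left (Ideal.mem_sup_right (Ideal.mem_span_singleton_self _)))
    refine hM.ne_top (top_le_iff.1 ?_)
    rw [← unimodular_iff.1 hρ, Ideal.span_le]
    rintro _ ⟨i, rfl⟩
    by_cases hit : i = t
    · exact hit ▸ htM
    by_cases hip : i = p
    · rw [hip, hp]
      exact M.add_mem hβM (M.mul_mem_right _ hvM)
    · exact hle (Ideal.mem_sup_right (Ideal.subset_span ⟨i, ⟨hit, hip⟩, rfl⟩))
  obtain ⟨w, hw, i, hi, h1⟩ := Submodule.mem_sup.1 ((Ideal.eq_top_iff_one _).1 htop)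
  obtain ⟨w₁, hw₁, w₂, hw₂, h2⟩ := Submodule.mem_sup.1 hw
  obtain ⟨p', rfl⟩ := Ideal.mem_span_singleton'.1 hw₁
  obtain ⟨q', rfl⟩ := Ideal.mem_span_singleton'.1 hw₂
  obtain ⟨σ, hσ⟩ := hv (c * q')
  obtain ⟨ζ, hζ⟩ := Ideal.mem_span_singleton'.1 hσ
  set τ := 1 + v * (c * q') with hτ
  refine ⟨(2 * τ - τ ^ 2 * σ) * ρ t + (τ * σ - 1) * (ρ p + -(v * c * p') * ρ t), ?_⟩
  refine (RowEquiv.add_mul ρ htp.symm (-(v * c * p'))).trans ?_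
  refine (RowEquiv.block _ htp (p := 2 * τ - τ ^ 2 * σ) (q := τ * σ - 1) (r := 1 - τ * σ) (s := σ)
    (by ring)).trans ?_
  rw [Function.update_self, Function.update_of_ne htp]
  set y := (2 * τ - τ ^ 2 * σ) * ρ t + (τ * σ - 1) * (ρ p + -(v * c * p') * ρ t) with hy
  set e := (1 - τ * σ) * ρ t + σ * (ρ p + -(v * c * p') * ρ t) with he
  rw [Function.update_comm htp.symm, Function.update_idem]
  have hβe : β - e ∈ I := by
    have : β - e = ζ * (ρ t - β) * ρ z - σ * v * c * i := by
      rw [he, hp, hτ]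
      rw [hτ] at hζ
      linear_combination (ρ t - β) * (-hζ) + (σ * v * c) * (h2 + h1)
    rw [this]
    exact I.sub_mem (I.mul_mem_left _ hzI) (I.mul_mem_left _ hi)
  have hmem : β - e ∈ Ideal.span
      (Function.update (Function.update ρ t y) p e '' {j | j ≠ p}) := by
    refine Ideal.span_mono ?_ hβe
    rintro _ ⟨j, ⟨hjt, hjp⟩, rfl⟩
    exact ⟨j, hjp, by rw [Function.update_of_ne hjp, Function.update_of_ne hjt]⟩
  have := RowEquiv.add_mem _ p hmem
  rwa [Function.update_self, Function.update_idem, add_sub_cancel] at this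

theorem Unimodular.exists_rowEquiv_forall_eq {ρ : ι → A} (hρ : Unimodular ρ) {v : A} {β c : ι → A}
    {z t : ι} (hzt : z ≠ t) (hv : ∀ x, ∃ y, y * (1 + v * x) - 1 ∈ Ideal.span {ρ z}) (S : Finset ι)
    (hz : z ∉ S) (ht : t ∉ S) (hS : ∀ i ∈ S, ρ i = β i + v * c i) :
    ∃ ρ', RowEquiv ρ ρ' ∧ (∀ i ∈ S, ρ' i = β i) ∧ ∀ i ∉ S, i ≠ t → ρ' i = ρ i := by
  induction S using Finset.induction_on with
  | empty => exact ⟨ρ, .refl ρ, by simp, fun _ _ _ => rfl⟩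
  | insert p S hp ih =>
    rw [Finset.mem_insert, not_or] at hz ht
    obtain ⟨ρ', h, hβ, h'⟩ := ih hz.2 ht.2 fun i hi => hS i (Finset.mem_insert_of_mem hi)
    obtain ⟨y, hy⟩ := (h.unimodular hρ).exists_rowEquiv_update (v := v) (β := β p) (c := c p)
      hzt hz.1 ht.1 (by rwa [h' z hz.2 hzt])
      (by rw [h' p hp (Ne.symm ht.1), hS p (Finset.mem_insert_self _ _)])
    refine ⟨_, h.trans hy, fun i hi => ?_, fun i hi hit => ?_⟩
    · by_cases hip : i = p
      · rw [hip, Function.update_self]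
      · have hiS := (Finset.mem_insert.1 hi).resolve_left hip
        have hit : i ≠ t := by rintro rfl; exact ht.2 hiS
        rw [Function.update_of_ne hip, Function.update_of_ne hit, hβ i hiS]
    · rw [Finset.mem_insert, not_or] at hi
      rw [Function.update_of_ne hi.1, Function.update_of_ne hit, h' i hi.2 hit]

theorem RowEquiv.cons {r : ℕ} {a b : Fin r → A} (c : A) (h : RowEquiv a b) :
    RowEquiv (Fin.cons c a : Fin (r + 1) → A) (Fin.cons c b) := by
  have key : ∀ a : Fin r → A, (Fin.cons c a : Fin (r + 1) → A) =
      (Fin.snoc a c : Fin (r + 1) → A) ∘ (finRotate (r + 1)).symm := by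
    intro a
    rw [Equiv.eq_comp_symm]
    funext i
    induction i using Fin.lastCases with
    | last => simp
    | cast i => simp [Fin.coeSucc_eq_succ]
  rw [key a, key b]
  exact (h.snoc c).reindex _

theorem completable_of_dimLT {k : Type*} [Field k] [IsAlgClosed k] [Algebra k A]
    [IsNoetherianRing A] {n r : ℕ} {ρ : Fin (r + 2) → A} (hρ : Unimodular ρ) {v : A}
    (hv : ∀ x, ∃ y, y * (1 + v * x) - 1 ∈ Ideal.span {ρ 0})
    (hd : DimLT (Ideal.span {ρ 0, v}) n)
    (hres : ∀ p : Ideal A, p.IsMaximal → Ideal.span {ρ 0, v} ≤ p →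
      ∀ x, ∃ c : k, x - algebraMap k A c ∈ p)
    (hn : n ≤ r + 1) (hk : n = r + 1 → ((r + 1).factorial : k) ≠ 0) : Completable ρ := by
  obtain ⟨a', b, hR, hab, -⟩ := exists_rowEquiv_pow hres (e := fun i => i + 1)
    (fun i => i.succ_ne_zero) (r + 1) _ le_rfl n hn (fun i => ρ i.succ) (by
      rw [← top_le_iff, ← unimodular_iff.1 hρ, Ideal.span_le]
      rintro _ ⟨i, rfl⟩
      induction i using Fin.cases with
      | zero => exact Ideal.mem_sup_left (Ideal.subset_span (by simp))
      | succ i => exact Ideal.mem_sup_right (Ideal.subset_span ⟨i, rfl⟩)) hd (by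
      intro h i hi h0
      refine hk h ?_
      obtain ⟨w, hw⟩ := Nat.dvd_factorial i.succ_pos (Nat.succ_le_of_lt hi)
      rw [hw, Nat.cast_mul, Nat.succ_eq_add_one, h0, zero_mul])
  have hex : ∀ i : Fin (r + 1), ∃ x c, a' i = b i ^ ((i : ℕ) + 1) + v * c + x * ρ 0 := by
    intro i
    obtain ⟨x, c, h⟩ := Ideal.mem_span_pair.1 (hab i)
    exact ⟨x, c, by linear_combination -h⟩
  choose x c hxc using hex
  have h1 : RowEquiv ρ (Fin.cons (ρ 0) fun i : Fin (r + 1) => b i ^ ((i : ℕ) + 1) + v * c i) := by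
    have h0 : ρ = Fin.cons (ρ 0) fun i : Fin (r + 1) => ρ i.succ := (Fin.cons_self_tail ρ).symm
    refine (RowEquiv.of_eq h0).trans ((hR.cons _).trans ?_)
    refine RowEquiv.of_sub_mem {0} ?_ ?_
    · rintro _ rfl
      simp
    · intro i hi
      induction i using Fin.cases with
      | zero => exact absurd rfl hi
      | succ i =>
        rw [Set.image_singleton, Fin.cons_succ, Fin.cons_succ, Fin.cons_zero, hxc i]
        exact Ideal.mem_span_singleton'.2 ⟨-x i, by ring⟩
  set ρ₁ : Fin (r + 2) → A :=
    Fin.cons (ρ 0) fun i : Fin (r + 1) => b i ^ ((i : ℕ) + 1) + v * c i with hρ₁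
  obtain ⟨ρ', h2, hβ, h'⟩ := (h1.unimodular hρ).exists_rowEquiv_forall_eq (v := v)
    (β := Fin.cons 0 fun i : Fin (r + 1) => b i ^ ((i : ℕ) + 1)) (c := Fin.cons 0 c)
    (z := 0) (t := 1) (by simp) (by simpa [hρ₁] using hv) {i | i ≠ 0 ∧ i ≠ 1} (by simp) (by simp) (by
      intro i hi
      rw [Finset.mem_filter_univ] at hi
      induction i using Fin.cases with
      | zero => exact absurd rfl hi.1
      | succ i => simp [hρ₁])
  refine (h1.trans h2).symm.completable ?_
  have hu : Unimodular ρ' := (h1.trans h2).unimodular hρ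
  let α : Fin (r + 2) → A := fun i => if (i : ℕ) ≤ 1 then ρ' i else b (i - 1)
  have hα : ρ' = fun i => α i ^ max 1 (i : ℕ) := by
    funext i
    by_cases hi : (i : ℕ) ≤ 1
    · simp [α, hi]
    · have hi' : i ≠ 0 ∧ i ≠ 1 := by
        constructor <;> rintro rfl <;> simp at hi
      rw [hβ i (Finset.mem_filter_univ _ |>.2 hi')]
      simp only [α, if_neg hi]
      induction i using Fin.cases with
      | zero => exact absurd rfl hi'.1
      | succ i => simp
  rw [hα]
  refine completable_factorial_powers (r + 1) α ?_
  rw [unimodular_iff, ← top_le_iff, ← unimodular_iff.1 hu, Ideal.span_le]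
  rintro _ ⟨i, rfl⟩
  rw [congrFun hα i]
  exact Ideal.pow_mem_of_mem (Ideal.span (Set.range α))
    (Ideal.subset_span (Set.mem_range_self i)) _ (by simp)

end RowReduction

section Suspension

open Polynomial

/-- `A` is the algebra `R[u, v] / (u v - f)`. -/
structure IsSuspension {R A : Type} [CommRing R] [CommRing A] [Algebra R A] (f : R) (u v : A) :
    Prop where
  mul_eq : u * v = algebraMap R A f
  exists_eq : ∀ x, ∃ p q : R[X], x = aeval v p + u * aeval u q
  exists_lift : ∀ {S : Type} [CommRing S] (φ : R →+* S) (u' v' : S), u' * v' = φ f →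
    ∃ ψ : A →+* S, ψ.comp (algebraMap R A) = φ ∧ ψ u = u' ∧ ψ v = v'

theorem exists_pow_mul_aeval_eq {R A : Type*} [CommRing R] [CommRing A] [Algebra R A] {f : R}
    {u v : A} (h : u * v = algebraMap R A f) (p : R[X]) :
    ∃ (m : ℕ) (q : R[X]), u ^ m * aeval v p = aeval u q := by
  induction p using Polynomial.induction_on' with
  | add p q hp hq =>
    obtain ⟨m, p', hp⟩ := hp
    obtain ⟨m', q', hq⟩ := hq
    refine ⟨m + m', X ^ m' * p' + X ^ m * q', ?_⟩
    simp only [map_add, map_mul, map_pow, aeval_X, ← hp, ← hq]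
    ring
  | monomial j c =>
    refine ⟨j, C (c * f ^ j), ?_⟩
    rw [aeval_monomial, aeval_C, map_mul, map_pow, ← h]
    ring

namespace IsSuspension

variable {R A : Type} [CommRing R] [CommRing A] [Algebra R A] {f : R} {u v : A}

theorem finiteType (h : IsSuspension f u v) : Algebra.FiniteType R A := by
  classical
  refine ⟨⟨{u, v}, ?_⟩⟩
  rw [eq_top_iff]
  intro x _
  obtain ⟨p, q, rfl⟩ := h.exists_eq x
  have hu : u ∈ Algebra.adjoin R (({u, v} : Finset A) : Set A) := Algebra.subset_adjoin (by simp)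
  have hv : v ∈ Algebra.adjoin R (({u, v} : Finset A) : Set A) := Algebra.subset_adjoin (by simp)
  have key : ∀ w ∈ Algebra.adjoin R (({u, v} : Finset A) : Set A), ∀ p : R[X],
      aeval w p ∈ Algebra.adjoin R (({u, v} : Finset A) : Set A) := fun w hw p =>
    Algebra.adjoin_le (Set.singleton_subset_iff.2 hw) (aeval_mem_adjoin_singleton R w)
  exact add_mem (key v hv p) (mul_mem hu (key u hu q))

theorem exists_pow_mul_eq_aeval (h : IsSuspension f u v) (x : A) :
    ∃ (m : ℕ) (q : R[X]), u ^ m * x = aeval u q := by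
  obtain ⟨p, q, rfl⟩ := h.exists_eq x
  obtain ⟨m, p', hp⟩ := exists_pow_mul_aeval_eq h.mul_eq p
  refine ⟨m, p' + X ^ (m + 1) * q, ?_⟩
  rw [mul_add, hp]
  simp only [map_add, map_mul, map_pow, aeval_X]
  ring

theorem exists_hom (h : IsSuspension f u v) {K : Type} [Field K] [Algebra R[X] K]
    [FaithfulSMul R[X] K] [Algebra R K] [IsScalarTower R R[X] K] [Nontrivial R] :
    ∃ π : A →+* K, π v = algebraMap R[X] K X ∧ (∀ p : R[X], π (aeval v p) = algebraMap R[X] K p) ∧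
      ∀ p : R[X], π (aeval u p) = aeval (π u) p := by
  have hX : algebraMap R[X] K X ≠ 0 := fun h0 => X_ne_zero
    (FaithfulSMul.algebraMap_injective R[X] K (h0.trans (map_zero _).symm))
  obtain ⟨π, hR, hu, hv⟩ := h.exists_lift (algebraMap R K)
    (algebraMap R K f / algebraMap R[X] K X) (algebraMap R[X] K X) (by field_simp)
  let π' : A →ₐ[R] K := { π with commutes' := fun r => RingHom.congr_fun hR r }
  have hπ : ∀ x, π x = π' x := fun _ => rfl
  refine ⟨π, hv, fun p => ?_, fun p => ?_⟩
  · rw [hπ, ← aeval_algHom_apply, ← hπ, hv, aeval_algebraMap_apply, aeval_X_left_apply]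
  · rw [hπ, ← aeval_algHom_apply, ← hπ]

theorem injective_hom [IsDomain R] (h : IsSuspension f u v) (hf : f ≠ 0) {K : Type} [Field K]
    [Algebra R[X] K] [FaithfulSMul R[X] K] [Algebra R K] [IsScalarTower R R[X] K] {π : A →+* K}
    (hv : π v = algebraMap R[X] K X) (hp : ∀ p : R[X], π (aeval v p) = algebraMap R[X] K p)
    (hq : ∀ p : R[X], π (aeval u p) = aeval (π u) p) : Function.Injective π := by
  rw [injective_iff_map_eq_zero]
  intro x hx
  obtain ⟨p, q, rfl⟩ := h.exists_eq x
  have huv : π u * algebraMap R[X] K X = algebraMap R[X] K (C f) := by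
    rw [← hv, ← map_mul, h.mul_eq, ← hp, aeval_C]
  set m := q.natDegree
  have hsum : algebraMap R[X] K (X ^ m) * aeval (π u) q =
      algebraMap R[X] K (∑ j ∈ Finset.range (m + 1), C (q.coeff j * f ^ j) * X ^ (m - j)) := by
    rw [aeval_eq_sum_range, Finset.mul_sum, map_sum]
    refine Finset.sum_congr rfl fun j hj => ?_
    have hj : j ≤ m := Nat.lt_succ_iff.1 (Finset.mem_range.1 hj)
    rw [Algebra.smul_def, IsScalarTower.algebraMap_apply R R[X] K, ← C_eq_algebraMap]
    rw [C_mul, C_pow]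
    simp only [map_mul, map_pow, ← huv]
    rw [← Nat.sub_add_cancel hj, pow_add, Nat.add_sub_cancel]
    ring
  have hzero : X ^ (m + 1) * p +
      C f * ∑ j ∈ Finset.range (m + 1), C (q.coeff j * f ^ j) * X ^ (m - j) = 0 := by
    refine FaithfulSMul.algebraMap_injective R[X] K ?_
    rw [map_zero, map_add, map_mul, map_mul, ← hsum, ← huv]
    rw [map_add, map_mul, hp, hq] at hx
    simp only [map_pow]
    linear_combination (algebraMap R[X] K X ^ (m + 1)) * hx
  have hq0 : q = 0 := by
    ext j
    rcases Nat.lt_or_ge m j with hj | hj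
    · exact coeff_eq_zero_of_natDegree_lt hj
    · have := congrArg (coeff · (m - j)) hzero
      simp only [coeff_add, coeff_zero, coeff_C_mul, finsetSum_coeff] at this
      rw [coeff_X_pow_mul', if_neg (by lia), zero_add, Finset.sum_eq_single j] at this
      · simpa [hf] using this
      · intro i hi hij
        rw [Finset.mem_range] at hi
        rw [coeff_X_pow, if_neg (by lia), mul_zero]
      · intro hj'
        exact absurd (Finset.mem_range.2 (by lia)) hj'
  have hp0 : p = 0 := by
    rw [hq0] at hzero
    simpa using hzero
  simp [hp0, hq0]

theorem isDomain [IsDomain R] (h : IsSuspension f u v) (hf : f ≠ 0) : IsDomain A := by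
  obtain ⟨π, hv, hp, hq⟩ := h.exists_hom (K := FractionRing R[X])
  exact (h.injective_hom hf hv hp hq).isDomain

theorem left_ne_zero [IsDomain R] (h : IsSuspension f u v) (hf : f ≠ 0) : u ≠ 0 := by
  rintro rfl
  obtain ⟨π, -, hp, -⟩ := h.exists_hom (K := FractionRing R[X])
  have h1 := h.mul_eq
  rw [zero_mul, ← aeval_C v] at h1
  have h2 := hp (C f)
  rw [← h1, map_zero] at h2
  exact hf (C_eq_zero.1 (FaithfulSMul.algebraMap_injective R[X] (FractionRing R[X])
    (h2.symm.trans (map_zero _).symm)))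

theorem exists_aeval_mem [IsDomain R] (h : IsSuspension f u v) (hf : f ≠ 0) {x : A} (hx : x ≠ 0) :
    ∃ p : R[X], p ≠ 0 ∧ aeval u p ∈ Ideal.span {x} := by
  have := h.isDomain hf
  obtain ⟨m, q, hq⟩ := h.exists_pow_mul_eq_aeval x
  refine ⟨q, ?_, hq ▸ Ideal.mul_mem_left _ _ (Ideal.mem_span_singleton_self x)⟩
  rintro rfl
  rw [map_zero, mul_eq_zero] at hq
  exact hq.elim (pow_ne_zero m (h.left_ne_zero hf)) hx

theorem exists_endomorphism (h : IsSuspension f u v) (Θ : R[X] →+* R[X]) (hX : Θ X = X)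
    (h0 : ∀ p, (Θ p).eval 0 = p.eval 0) :
    ∃ θ : A →+* A, θ u = u ∧ ∀ p, θ (aeval u p) = aeval u (Θ p) := by
  obtain ⟨w, hw⟩ : X ∣ Θ (C f) - C f := by
    rw [X_dvd_iff, coeff_zero_eq_eval_zero, eval_sub, h0, sub_self]
  obtain ⟨θ, hR, hu, -⟩ := h.exists_lift (((aeval u : R[X] →ₐ[R] A) : R[X] →+* A).comp (Θ.comp C)) u
    (v + aeval u w) (by
      have := congrArg (aeval u) hw
      simp only [map_sub, map_mul, aeval_X, aeval_C] at this
      simp only [RingHom.comp_apply, RingHom.coe_coe]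
      linear_combination h.mul_eq - this)
  refine ⟨θ, hu, fun p => ?_⟩
  have : θ.comp ((aeval u : R[X] →ₐ[R] A) : R[X] →+* A) =
      ((aeval u : R[X] →ₐ[R] A) : R[X] →+* A).comp Θ := by
    refine Polynomial.ringHom_ext (fun r => ?_) ?_
    · have := RingHom.congr_fun hR r
      simpa using this
    · simp [hu, hX]
  exact RingHom.congr_fun this p

theorem exists_leftInverse [IsDomain R] (h : IsSuspension f u v) (hf : f ≠ 0) (Θ : R[X] ≃+* R[X])
    (hX : Θ X = X) (h0 : ∀ p, (Θ p).eval 0 = p.eval 0) :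
    ∃ θ θ' : A →+* A, (∀ x, θ' (θ x) = x) ∧ ∀ p, θ (aeval u p) = aeval u (Θ p) := by
  obtain ⟨θ, hu, hθ⟩ := h.exists_endomorphism (Θ : R[X] →+* R[X]) hX h0
  obtain ⟨θ', hu', hθ'⟩ := h.exists_endomorphism (Θ.symm : R[X] →+* R[X])
    (by simpa using (Θ.symm_apply_eq.2 hX.symm))
    (fun p => by simpa using (h0 (Θ.symm p)).symm)
  have := h.isDomain hf
  refine ⟨θ, θ', fun x => ?_, hθ⟩
  obtain ⟨m, q, hq⟩ := h.exists_pow_mul_eq_aeval x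
  refine mul_left_cancel₀ (pow_ne_zero m (h.left_ne_zero hf)) ?_
  have := congrArg (fun x => θ' (θ x)) hq
  simp only [map_mul, map_pow, hu, hu', hθ, hθ'] at this
  rw [this, hq]
  simp

end IsSuspension

end Suspension

section Localization

open Polynomial

theorem isIntegral_aeval {R A S Q : Type*} [CommRing R] [CommRing A] [Algebra R A] [CommRing S]
    [CommRing Q] [Algebra S Q] (g : A →+* Q) {w : A} (hw : IsIntegral S (g w))
    (hC : ∀ r : R, IsIntegral S (g (algebraMap R A r))) (p : R[X]) :
    IsIntegral S (g (aeval w p)) := by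
  induction p using Polynomial.induction_on' with
  | add p q hp hq => simpa using hp.add hq
  | monomial j c => simpa [aeval_monomial] using (hC c).mul (hw.pow j)

/-- The multiplicative set of polynomials in `v` with constant term `1`. -/
def onePlus (R : Type*) {A : Type*} [CommRing R] [CommRing A] [Algebra R A] (v : A) :
    Submonoid A where
  carrier := {x | ∃ s : R[X], s.eval 0 = 1 ∧ aeval v s = x}
  one_mem' := ⟨1, by simp, by simp⟩
  mul_mem' := by
    rintro _ _ ⟨s, hs, rfl⟩ ⟨t, ht, rfl⟩
    exact ⟨s * t, by simp [hs, ht], by simp⟩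

namespace IsSuspension

variable {R A : Type} [CommRing R] [CommRing A] [Algebra R A] {f : R} {u v z : A}

theorem isIntegral_map (h : IsSuspension f u v) {S Q : Type*} [CommRing S] [CommRing Q]
    [Algebra S Q] (g : A →+* Q) (hu : IsIntegral S (g u)) (hv : IsIntegral S (g v))
    (hC : ∀ r : R, IsIntegral S (g (algebraMap R A r))) (x : A) : IsIntegral S (g x) := by
  obtain ⟨p, q, rfl⟩ := h.exists_eq x
  rw [map_add, map_mul]
  exact (isIntegral_aeval g hv hC p).add (hu.mul (isIntegral_aeval g hu hC q))

theorem exists_monic_aeval_mem (h : IsSuspension f u v) {P : R[X]} (hP : P.Monic)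
    (hz : aeval u P ∈ Ideal.span {z}) (x : A) :
    ∃ q : R[X][X], q.Monic ∧
      q.eval₂ ((aeval v : R[X] →ₐ[R] A) : R[X] →+* A) x ∈ Ideal.span {z} := by
  let g := Ideal.Quotient.mk (Ideal.span {z})
  let φ : R[X] →+* A ⧸ Ideal.span {z} := g.comp ((aeval v : R[X] →ₐ[R] A) : R[X] →+* A)
  let _ : Algebra R[X] (A ⧸ Ideal.span {z}) := φ.toAlgebra
  have hφ : ∀ p, φ p = g (aeval v p) := fun _ => rfl
  obtain ⟨q, hq, hx⟩ := h.isIntegral_map (S := R[X]) g ⟨P.map C, hP.map C, by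
      rw [eval₂_map, ← Ideal.Quotient.eq_zero_iff_mem.2 hz]
      change eval₂ (φ.comp C) (g u) P = g (aeval u P)
      rw [aeval_def, hom_eval₂]
      congr 1
      ext r
      simp [hφ]⟩ (by
      have : g v = algebraMap R[X] (A ⧸ Ideal.span {z}) X := by
        change _ = φ X
        rw [hφ, aeval_X]
      rw [this]
      exact isIntegral_algebraMap) (fun r => by
      have : g (algebraMap R A r) = algebraMap R[X] (A ⧸ Ideal.span {z}) (C r) := by
        change _ = φ (C r)
        rw [hφ, aeval_C]
      rw [this]
      exact isIntegral_algebraMap) x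
  refine ⟨q, hq, ?_⟩
  rw [← Ideal.Quotient.eq_zero_iff_mem, hom_eval₂]
  exact hx

theorem exists_monic_eval₂_mem (h : IsSuspension f u v) {P : R[X]} (hP : P.Monic)
    (hz : aeval u P ∈ Ideal.span {z}) (x : A) :
    ∃ q : R[X], q.Monic ∧ q.eval₂ (algebraMap R A) x ∈ Ideal.span {z, v} := by
  let g := Ideal.Quotient.mk (Ideal.span {z, v})
  have hle : Ideal.span {z} ≤ Ideal.span {z, v} := Ideal.span_mono (by simp)
  obtain ⟨q, hq, hx⟩ := h.isIntegral_map (S := R) g ⟨P, hP, by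
      have := Ideal.Quotient.eq_zero_iff_mem.2 (hle hz)
      rwa [aeval_def, hom_eval₂] at this⟩ (by
      have : g v = 0 := Ideal.Quotient.eq_zero_iff_mem.2 (Ideal.subset_span (by simp))
      rw [this]
      exact isIntegral_zero) (fun r => isIntegral_algebraMap (R := R) (x := r)) x
  refine ⟨q, hq, ?_⟩
  rw [← Ideal.Quotient.eq_zero_iff_mem, hom_eval₂]
  exact hx

variable {L : Type} [CommRing L] [Algebra A L] [IsLocalization (onePlus R v) L]

theorem exists_mul_sub_one_mem [Nontrivial R] (h : IsSuspension f u v) {P : R[X]} (hP : P.Monic)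
    (hz : aeval u P ∈ Ideal.span {z}) (x : L) :
    ∃ y, y * (1 + algebraMap A L v * x) - 1 ∈ Ideal.span {algebraMap A L z} := by
  obtain ⟨x, ⟨_, s, hs, rfl⟩, rfl⟩ := IsLocalization.exists_mk'_eq (onePlus R v) x
  obtain ⟨q, hq, hx⟩ := h.exists_monic_aeval_mem (v := v) hP hz x
  set φ : R[X] →+* A := ((aeval v : R[X] →ₐ[R] A) : R[X] →+* A) with hφ
  have hφX : φ X = v := aeval_X v
  -- the polynomial `q`, with roots scaled by `v`, evaluated at `v * x` and at `-s`
  have h1 : (q.scaleRoots X).eval₂ φ (v * x) ∈ Ideal.span {z} := by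
    rw [← hφX, scaleRoots_eval₂_mul]
    exact Ideal.mul_mem_left _ _ hx
  have h2 : (q.scaleRoots X).eval₂ φ (φ (-s)) = φ ((q.scaleRoots X).eval (-s)) := by
    rw [eval₂_at_apply]
  have h3 : ((q.scaleRoots X).eval (-s)).eval 0 = (-1) ^ q.natDegree := by
    have := eval₂_at_apply (p := q.scaleRoots X) (evalRingHom (0 : R)) (-s)
    rw [coe_evalRingHom] at this
    rw [← this, ← eval_map, map_scaleRoots _ _ _ (by simp [hq.leadingCoeff])]
    simp [hs, (hq.map _).leadingCoeff, hq.natDegree_map]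
  obtain ⟨t, ht⟩ := sub_dvd_eval_sub (v * x) (φ (-s)) ((q.scaleRoots X).map φ)
  rw [eval_map, eval_map, h2] at ht
  set w := (q.scaleRoots X).eval (-s)
  have hw : (-1) ^ q.natDegree * φ w ∈ onePlus R v :=
    ⟨(-1) ^ q.natDegree * w, by simp [h3, ← mul_pow], by simp [hφ]⟩
  obtain ⟨i, hi⟩ := (IsLocalization.map_units L ⟨_, hw⟩).exists_right_inv
  obtain ⟨c, hc⟩ := Ideal.mem_span_singleton'.1 h1
  have hmk := IsLocalization.mk'_spec L x (⟨_, s, hs, rfl⟩ : onePlus R v)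
  set ξ := IsLocalization.mk' L x (⟨_, s, hs, rfl⟩ : onePlus R v)
  refine ⟨-((-1) ^ q.natDegree * algebraMap A L t * algebraMap A L (φ s) * i),
    Ideal.mem_span_singleton'.2 ⟨-((-1) ^ q.natDegree * i * algebraMap A L c), ?_⟩⟩
  replace ht := congrArg (algebraMap A L) ht
  rw [← hc] at ht
  simp only [map_mul, map_add, map_sub, map_neg, map_pow, map_one, sub_neg_eq_add] at ht hi hmk ⊢
  change ξ * algebraMap A L (φ s) = _ at hmk
  linear_combination ((-1) ^ q.natDegree * i) * (-ht) - hi +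
    (-1) ^ q.natDegree * i * algebraMap A L t * algebraMap A L v * hmk

theorem comap_lt_comap [Nontrivial R] (h : IsSuspension f u v) {P : R[X]} (hP : P.Monic)
    (hz : aeval u P ∈ Ideal.span {z}) {p q : Ideal L} [p.IsPrime]
    (hp : Ideal.span {algebraMap A L z, algebraMap A L v} ≤ p) (hpq : p < q) :
    p.comap ((algebraMap A L).comp (algebraMap R A)) <
      q.comap ((algebraMap A L).comp (algebraMap R A)) := by
  obtain ⟨hle, x, hxq, hxp⟩ := SetLike.lt_iff_le_and_exists.1 hpq
  obtain ⟨x, s, rfl⟩ := IsLocalization.exists_mk'_eq (onePlus R v) x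
  have hxs := IsLocalization.mk'_spec L x s
  have hq : algebraMap A L x ∈ q := hxs ▸ q.mul_mem_right _ hxq
  have hp' : algebraMap A L x ∉ p := by
    rw [← hxs]
    intro hmem
    refine (Ideal.IsPrime.mem_or_mem inferInstance hmem).elim hxp fun hs => ?_
    exact Ideal.IsPrime.ne_top inferInstance
      (Ideal.eq_top_of_isUnit_mem p hs (IsLocalization.map_units L s))
  obtain ⟨Q, hQ, hx⟩ := h.exists_monic_eval₂_mem hP hz x
  refine Ideal.comap_lt_comap_of_root_mem_sdiff hle ⟨hq, hp'⟩ (p := Q) ?_ ?_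
  · have : Nontrivial (R ⧸ p.comap ((algebraMap A L).comp (algebraMap R A))) :=
      Ideal.Quotient.nontrivial_iff.2 (Ideal.IsPrime.ne_top inferInstance)
    exact (hQ.map _).ne_zero
  · rw [← hom_eval₂]
    refine hp ?_
    have := Ideal.mem_map_of_mem (algebraMap A L) hx
    rwa [Ideal.map_span, Set.image_pair] at this

theorem dimLT_localization [IsDomain R] (h : IsSuspension f u v) (hf : f ≠ 0) {n : ℕ}
    (hn : ringKrullDim R ≤ n) {P : R[X]} (hP : P.Monic) (hz : aeval u P ∈ Ideal.span {z}) :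
    DimLT (Ideal.span {algebraMap A L z, algebraMap A L v}) n := by
  intro p hp
  have hle : ∀ i, Ideal.span {algebraMap A L z, algebraMap A L v} ≤ (p i).asIdeal := fun i =>
    hp.trans (p.strictMono.monotone (Fin.zero_le i))
  let q : LTSeries (PrimeSpectrum R) :=
    { length := p.length
      toFun := fun i => (p i).comap ((algebraMap A L).comp (algebraMap R A))
      step := fun i => h.comap_lt_comap hP hz (hle _) (p.step i) }
  have hfq : f ∈ q.head.asIdeal := by
    change algebraMap A L (algebraMap R A f) ∈ p.head.asIdeal
    rw [← h.mul_eq, map_mul]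
    exact Ideal.mul_mem_left _ _ (hp (Ideal.subset_span (by simp)))
  have hlt : (⟨⊥, Ideal.isPrime_bot⟩ : PrimeSpectrum R) < q.head := by
    refine lt_of_le_of_ne bot_le fun e => hf ?_
    rw [← e] at hfq
    exact hfq
  have := (Order.LTSeries.length_le_krullDim (q.cons _ hlt)).trans hn
  rw [RelSeries.cons_length] at this
  exact_mod_cast this

theorem exists_sub_algebraMap_mem {k : Type} [Field k] [IsAlgClosed k] [Algebra k R]
    [Algebra k A] [IsScalarTower k R A] [Algebra k L] [IsScalarTower k A L]
    [Algebra.FiniteType k R] (h : IsSuspension f u v) {p : Ideal L} (hp : p.IsMaximal)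
    (hv : algebraMap A L v ∈ p) (x : L) : ∃ c : k, x - algebraMap k L c ∈ p := by
  have := h.finiteType
  have : Algebra.FiniteType k A := .trans ‹_› this
  have hsub : ∀ x : L, ∃ a : A, x - algebraMap A L a ∈ p := by
    intro x
    obtain ⟨a, ⟨_, s, hs, rfl⟩, rfl⟩ := IsLocalization.exists_mk'_eq (onePlus R v) x
    refine ⟨a, ?_⟩
    obtain ⟨t, ht⟩ : X ∣ s - 1 := by
      rw [X_dvd_iff, coeff_zero_eq_eval_zero, eval_sub, hs, eval_one, sub_self]
    have ht' : aeval v s = 1 + v * aeval v t := by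
      rw [sub_eq_iff_eq_add'.1 ht]
      simp
    have hmk := IsLocalization.mk'_spec L a (⟨_, s, hs, rfl⟩ : onePlus R v)
    set ξ := IsLocalization.mk' L a (⟨_, s, hs, rfl⟩ : onePlus R v)
    change ξ * algebraMap A L (aeval v s) = _ at hmk
    rw [← hmk, ht', map_add, map_mul, map_one]
    convert p.mul_mem_left (-(ξ * algebraMap A L (aeval v t))) hv using 1
    ring
  let _ := Ideal.Quotient.field p
  let φ : A →ₐ[k] L ⧸ p := (Ideal.Quotient.mkₐ k p).comp (IsScalarTower.toAlgHom k A L)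
  have hφ : Function.Surjective φ := by
    intro y
    obtain ⟨x, rfl⟩ := Ideal.Quotient.mk_surjective y
    obtain ⟨a, ha⟩ := hsub x
    exact ⟨a, (Ideal.Quotient.eq.2 ha).symm⟩
  have : Algebra.FiniteType k (L ⧸ p) := .of_surjective φ hφ
  have : Module.Finite k (L ⧸ p) := finite_of_finite_type_of_isJacobsonRing k (L ⧸ p)
  obtain ⟨c, hc⟩ := (IsAlgClosed.algebraMap_bijective_of_isIntegral (k := k)
    (K := L ⧸ p)).2 (Ideal.Quotient.mk p x)
  exact ⟨c, Ideal.Quotient.eq.1 hc.symm⟩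

theorem completable_localization {k : Type} [Field k] [IsAlgClosed k] [IsDomain R] [Algebra k R]
    [Algebra k A] [IsScalarTower k R A] [Algebra k L] [IsScalarTower k A L]
    [Algebra.FiniteType k R] (h : IsSuspension f u v) (hf : f ≠ 0) {n r : ℕ}
    (hdim : ringKrullDim R ≤ n) (hn : n ≤ r + 1) (hk : n = r + 1 → ((r + 1).factorial : k) ≠ 0)
    {a : Fin (r + 2) → A} (ha : Unimodular a) {P : R[X]} (hP : P.Monic)
    (hz : aeval u P ∈ Ideal.span {a 0}) : Completable (algebraMap A L ∘ a) := by
  have := h.finiteType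
  have : Algebra.FiniteType k A := .trans ‹_› this
  have := Algebra.FiniteType.isNoetherianRing k A
  have := IsLocalization.isNoetherianRing (onePlus R v) L inferInstance
  exact completable_of_dimLT (k := k) (ha.map (algebraMap A L)) (v := algebraMap A L v)
    (h.exists_mul_sub_one_mem hP hz) (h.dimLT_localization hf hdim hP hz)
    (fun p hp hle => h.exists_sub_algebraMap_mem hp (hle (Ideal.subset_span (by simp)))) hn hk

end IsSuspension

end Localization

section NonzeroCase

open Polynomial
open scoped Matrix

namespace IsSuspension

theorem completable_of_localization {R A : Type} [CommRing R] [CommRing A] [Algebra R A] {f : R}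
    {u v : A} [IsDomain R] (h : IsSuspension f u v) (hf : f ≠ 0)
    (H : ∀ r, ∀ a : Fin r → R[X], Unimodular a → Completable a) {L : Type} [CommRing L]
    [Algebra A L] [IsLocalization (onePlus R v) L] {m : ℕ} {a : Fin m → A} (ha : Unimodular a)
    (hL : Completable (algebraMap A L ∘ a)) : Completable a := by
  obtain ⟨π, hπv, hπp, hπu⟩ := h.exists_hom (K := FractionRing R[X])
  have hinj := h.injective_hom hf hπv hπp hπu
  have hunit : ∀ y : onePlus R v, IsUnit (π y) := by
    rintro ⟨_, s, hs, rfl⟩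
    rw [isUnit_iff_ne_zero, hπp, Ne, map_eq_zero_iff _ (FaithfulSMul.algebraMap_injective _ _)]
    rintro rfl
    simp at hs
  let ψ : L →+* FractionRing R[X] := IsLocalization.lift hunit
  have hψ : ∀ x, ψ (algebraMap A L x) = π x := IsLocalization.lift_eq hunit
  obtain ⟨i₀, -⟩ := id hL
  obtain ⟨M, hM, hMa⟩ := hL.rowEquiv i₀
  obtain ⟨M', hMM⟩ := hM.exists_right_inv
  obtain ⟨⟨_, g, hg0, rfl⟩, hb⟩ := IsLocalization.exist_integer_multiples_of_finite (onePlus R v)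
    (Sum.elim (fun p : Fin m × Fin m => M p.1 p.2) (fun p : Fin m × Fin m => M' p.1 p.2))
  have hg : IsCoprime X g := by
    obtain ⟨t, ht⟩ : X ∣ g - 1 := by
      rw [X_dvd_iff, coeff_zero_eq_eval_zero, eval_sub, hg0, eval_one, sub_self]
    exact ⟨-t, 1, by linear_combination ht⟩
  have hint : ∀ x : L, IsLocalization.IsInteger A (aeval v g • x) →
      algebraMap R[X] (FractionRing R[X]) g * ψ x ∈ π.range := by
    rintro x ⟨c, hc⟩
    refine ⟨c, ?_⟩
    rw [← hψ, hc, Algebra.smul_def, map_mul, hψ, hπp]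
  have hBA : (algebraMap R[X] (FractionRing R[X])).range ≤ π.range := by
    rintro _ ⟨p, rfl⟩
    exact ⟨aeval v p, hπp p⟩
  have hA : ∀ x ∈ π.range, ∃ c : ℕ, algebraMap R[X] (FractionRing R[X]) X ^ c * x ∈
      (algebraMap R[X] (FractionRing R[X])).range := by
    rintro _ ⟨x, rfl⟩
    obtain ⟨p, q, rfl⟩ := h.exists_eq x
    obtain ⟨c, q', hq⟩ := exists_pow_mul_aeval_eq ((mul_comm v u).trans h.mul_eq) (X * q)
    refine ⟨c, X ^ c * p + q', ?_⟩
    rw [← hπp, ← hπv, ← map_pow, ← map_mul, map_add, ← hq]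
    refine congrArg π ?_
    simp only [map_mul, map_pow, aeval_X]
    ring
  let e : A ≃+* π.range :=
    RingEquiv.ofBijective π.rangeRestrict
      ⟨fun x y hxy => hinj (congrArg Subtype.val hxy), π.rangeRestrict_surjective⟩
  have key : Completable ((e : A →+* π.range) ∘ a) := by
    refine completable_of_patching H π.range hBA hA g hg _ (ha.map (e : A →+* π.range))
      (M := M.map ψ) (M' := M'.map ψ) ?_ (fun i j => hint _ (hb (Sum.inl (i, j))))
      (fun i j => hint _ (hb (Sum.inr (i, j)))) i₀ fun i => ?_
    · rw [← Matrix.map_mul, hMM, Matrix.map_one _ (map_zero ψ) (map_one ψ)]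
    · have := congrFun hMa i
      rw [Matrix.mulVec_single_one] at this
      change ψ (M i i₀) = π (a i)
      rw [← hψ]
      exact congrArg ψ this
  convert key.map (e.symm : π.range →+* A) using 1
  ext i
  simp

/-- A ring automorphism making a given nonzero polynomial monic up to a unit. -/
theorem exists_ringEquiv_isUnit_leadingCoeff {k : Type} [Field k] {n : ℕ}
    (p : (MvPolynomial (Fin n) k)[X]) (hp : p ≠ 0) :
    ∃ Θ : (MvPolynomial (Fin n) k)[X] ≃+* (MvPolynomial (Fin n) k)[X], Θ X = X ∧
      (∀ q, (Θ q).eval 0 = q.eval 0) ∧ IsUnit (Θ p).leadingCoeff := by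
  let e := MvPolynomial.finSuccEquiv k n
  let N := nagataEquiv (e.symm p)
  have hN0 : N (MvPolynomial.X 0) = MvPolynomial.X 0 := by simp [N, nagataEquiv]
  have hN : ∀ i : Fin n, N (MvPolynomial.X i.succ) = MvPolynomial.X i.succ +
      MvPolynomial.X 0 ^ (2 + (e.symm p).totalDegree) ^ (i.succ : ℕ) := by
    intro i
    simp [N, nagataEquiv]
  refine ⟨((e.symm.trans N).trans e).toRingEquiv, ?_, fun q => ?_, ?_⟩
  · have : e.symm X = MvPolynomial.X 0 :=
      e.symm_apply_eq.2 (MvPolynomial.finSuccEquiv_X_zero).symm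
    change e (N (e.symm X)) = X
    rw [this, hN0]
    exact MvPolynomial.finSuccEquiv_X_zero
  · obtain ⟨q, rfl⟩ := e.surjective q
    change (e (N (e.symm (e q)))).eval 0 = (e q).eval 0
    rw [e.symm_apply_apply]
    let ε : (MvPolynomial (Fin n) k)[X] →ₐ[k] MvPolynomial (Fin n) k :=
      (aeval (0 : MvPolynomial (Fin n) k)).restrictScalars k
    have : (ε.comp (e.toAlgHom.comp N.toAlgHom)) = ε.comp e.toAlgHom := by
      refine MvPolynomial.algHom_ext fun i => ?_
      cases i using Fin.cases with
      | zero => simp [hN0]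
      | succ i => simp [hN, ε, e, MvPolynomial.finSuccEquiv_X_zero]
    simpa [ε, aeval_def] using DFunLike.congr_fun this q
  · have := isUnit_leadingCoeff_nagataEquiv (e.symm p) (by simpa using hp)
    simpa [N] using this

theorem _root_.completable_polynomial_mvPolynomial (n : ℕ) {k : Type} [Field k] (r : ℕ)
    (a : Fin r → (MvPolynomial (Fin n) k)[X]) (ha : Unimodular a) : Completable a := by
  let e := (MvPolynomial.finSuccEquiv k n).toRingEquiv
  convert (completable_mvPolynomial (n + 1) _ (ha.map e.symm.toRingHom)).map e.toRingHom
  ext1 i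
  simp

theorem completable {k : Type} [Field k] [IsAlgClosed k] {n : ℕ} {A : Type} [CommRing A]
    [Algebra (MvPolynomial (Fin n) k) A] {f : MvPolynomial (Fin n) k} {u v : A}
    (h : IsSuspension f u v) (hf : f ≠ 0) {r : ℕ} (hn : n ≤ r + 1)
    (hk : n = r + 1 → ((r + 1).factorial : k) ≠ 0) {a : Fin (r + 2) → A} (ha : Unimodular a) :
    Completable a := by
  let _ : Algebra k A := Algebra.compHom A (algebraMap k (MvPolynomial (Fin n) k))
  have : IsScalarTower k (MvPolynomial (Fin n) k) A := .of_algebraMap_eq fun _ => rfl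
  have := h.isDomain hf
  have hdim : ringKrullDim (MvPolynomial (Fin n) k) ≤ n := by
    rw [MvPolynomial.ringKrullDim_of_isNoetherianRing, ringKrullDim_eq_zero_of_field]
    simp
  obtain ⟨i, hi⟩ : ∃ i, a i ≠ 0 := by
    by_contra! h0
    obtain ⟨b, hb⟩ := ha
    simp [funext h0, dotProduct] at hb
  let σ := Equiv.swap 0 i
  suffices hσ : Completable (a ∘ σ) from
    (RowEquiv.perm σ a).symm.completable hσ
  have haσ := ha.reindex σ
  have h0 : (a ∘ σ) 0 ≠ 0 := by simpa [σ] using hi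
  generalize a ∘ σ = a at haσ h0
  obtain ⟨p, hp, hpa⟩ := h.exists_aeval_mem hf h0
  obtain ⟨Θ, hX, h0', hΘ⟩ := exists_ringEquiv_isUnit_leadingCoeff p hp
  obtain ⟨θ, θ', hθ, hθp⟩ := h.exists_leftInverse hf Θ hX h0'
  suffices hc : Completable (θ ∘ a) by
    convert hc.map θ'
    ext j
    exact (hθ _).symm
  obtain ⟨c, hc⟩ := hΘ.exists_left_inv
  have hmonic : (C c * Θ p).Monic := monic_C_mul_of_mul_leadingCoeff_eq_one hc
  refine h.completable_of_localization hf (completable_polynomial_mvPolynomial n)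
    (L := Localization (onePlus (MvPolynomial (Fin n) k) v)) (haσ.map θ) ?_
  refine h.completable_localization (k := k) hf hdim hn hk (haσ.map θ) hmonic ?_
  rw [map_mul, ← hθp]
  refine Ideal.mul_mem_left _ _ ?_
  have := Ideal.mem_map_of_mem θ hpa
  rwa [Ideal.map_span, Set.image_singleton] at this

end IsSuspension

end NonzeroCase

section ZeroCase

open Polynomial
open scoped Matrix

namespace IsSuspension

/-- A suspension of `0` is a fibre product of two polynomial rings. -/
theorem exists_algHom_of_zero {R A : Type} [CommRing R] [CommRing A] [Algebra R A] {u v : A}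
    (h : IsSuspension (0 : R) u v) :
    ∃ φ ψ : A →ₐ[R] R[X], (∀ x, (φ x).eval 0 = (ψ x).eval 0) ∧
      (∀ x y, φ x = φ y → ψ x = ψ y → x = y) ∧
      ∀ p q : R[X], p.eval 0 = q.eval 0 → ∃ x, φ x = p ∧ ψ x = q := by
  obtain ⟨φ, hφ, hφu, hφv⟩ := h.exists_lift (C : R →+* R[X]) 0 X (by simp)
  obtain ⟨ψ, hψ, hψu, hψv⟩ := h.exists_lift (C : R →+* R[X]) X 0 (by simp)
  let φ' : A →ₐ[R] R[X] := { φ with commutes' := fun r => RingHom.congr_fun hφ r }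
  let ψ' : A →ₐ[R] R[X] := { ψ with commutes' := fun r => RingHom.congr_fun hψ r }
  replace hφu : φ' u = 0 := hφu
  replace hφv : φ' v = X := hφv
  replace hψu : ψ' u = X := hψu
  replace hψv : ψ' v = 0 := hψv
  have h1 : ∀ p : R[X], φ' (aeval v p) = p := fun p => by
    rw [← aeval_algHom_apply, hφv, aeval_X_left_apply]
  have h2 : ∀ p : R[X], φ' (aeval u p) = C (p.eval 0) := fun p => by
    rw [← aeval_algHom_apply, hφu, ← coeff_zero_eq_eval_zero]
    exact eval₂_at_zero _
  have h3 : ∀ p : R[X], ψ' (aeval u p) = p := fun p => by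
    rw [← aeval_algHom_apply, hψu, aeval_X_left_apply]
  have h4 : ∀ p : R[X], ψ' (aeval v p) = C (p.eval 0) := fun p => by
    rw [← aeval_algHom_apply, hψv, ← coeff_zero_eq_eval_zero]
    exact eval₂_at_zero _
  refine ⟨φ', ψ', fun x => ?_, fun x y hφxy hψxy => ?_, fun p q hpq => ?_⟩
  · obtain ⟨p, q, rfl⟩ := h.exists_eq x
    simp [h1, h2, h3, h4, hφu, hψu]
  · have key : ∀ x, x = aeval v (φ' x) + aeval u (ψ' x) - algebraMap R A ((φ' x).eval 0) := by
      intro x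
      obtain ⟨p, q, rfl⟩ := h.exists_eq x
      simp only [map_add, map_mul, h1, h2, h3, h4, hφu, hψu, zero_mul, add_zero, aeval_X, aeval_C]
      ring
    rw [key x, key y, hφxy, hψxy]
  · refine ⟨aeval v p + aeval u q - algebraMap R A (p.eval 0), ?_, ?_⟩
    · rw [map_sub, map_add, h1, h2, AlgHom.commutes, hpq]
      exact add_sub_cancel_right _ _
    · rw [map_sub, map_add, h3, h4, AlgHom.commutes]
      exact add_sub_cancel_left _ _

theorem completable_of_zero {R A : Type} [CommRing R] [CommRing A] [Algebra R A] {u v : A}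
    (h : IsSuspension (0 : R) u v)
    (H : ∀ r, ∀ a : Fin r → R[X], Unimodular a → Completable a) {m : ℕ} {a : Fin m → A}
    (ha : Unimodular a) : Completable a := by
  obtain ⟨φ, ψ, h0, hinj, hglue⟩ := h.exists_algHom_of_zero
  have hunit : ∀ x, IsUnit (φ x) → IsUnit (ψ x) → IsUnit x := by
    intro x hx hx'
    obtain ⟨p, hp⟩ := hx.exists_left_inv
    obtain ⟨q, hq⟩ := hx'.exists_left_inv
    have e1 := congrArg (eval 0) hp
    have e2 := congrArg (eval 0) hq
    rw [eval_mul, eval_one] at e1 e2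
    rw [← h0] at e2
    obtain ⟨y, hy, hy'⟩ := hglue p q (by
      linear_combination eval 0 q * e1 - eval 0 p * e2)
    refine IsUnit.of_mul_eq_one_right y (hinj _ _ ?_ ?_)
    · rw [map_mul, hy, hp, map_one]
    · rw [map_mul, hy', hq, map_one]
  have hφa := H m _ (ha.map (φ : A →+* R[X]))
  obtain ⟨i, -⟩ := id hφa
  obtain ⟨M, hM, hMa⟩ := hφa.rowEquiv i
  obtain ⟨N, hN, hNa⟩ := (H m _ (ha.map (ψ : A →+* R[X]))).rowEquiv i
  rw [Matrix.mulVec_single_one] at hMa hNa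
  let ε : R[X] →+* R := evalRingHom 0
  obtain ⟨N', hN'⟩ := (hN.map ε.mapMatrix).exists_left_inv
  let W : Matrix (Fin m) (Fin m) R := N' * ε.mapMatrix M
  have hW : IsUnit W := (IsUnit.of_mul_eq_one _ hN').mul (hM.map ε.mapMatrix)
  have hWi : W *ᵥ Pi.single i 1 = Pi.single i 1 := by
    have e : ε.mapMatrix M *ᵥ Pi.single i 1 = ε.mapMatrix N *ᵥ Pi.single i 1 := by
      ext j
      rw [Matrix.mulVec_single_one, Matrix.mulVec_single_one]
      have e1 : M j i = φ (a j) := congrFun hMa j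
      have e2 : N j i = ψ (a j) := congrFun hNa j
      change (M j i).eval 0 = (N j i).eval 0
      rw [e1, e2, h0]
    rw [← Matrix.mulVec_mulVec, e, Matrix.mulVec_mulVec, hN', Matrix.one_mulVec]
  have hNW : ε.mapMatrix (N * (C : R →+* R[X]).mapMatrix W) = ε.mapMatrix M := by
    have e : ε.mapMatrix ((C : R →+* R[X]).mapMatrix W) = W := by
      ext j l
      simp [ε]
    rw [map_mul, e, ← Matrix.mul_assoc, mul_eq_one_comm.1 hN', Matrix.one_mul]
  have hNWi : ∀ j, (N * (C : R →+* R[X]).mapMatrix W) j i = ψ (a j) := by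
    intro j
    have e : (C : R →+* R[X]).mapMatrix W *ᵥ Pi.single i 1 = Pi.single i 1 := by
      ext1 l
      have := congrFun hWi l
      rw [Matrix.mulVec_single_one] at this ⊢
      change C (W l i) = _
      rw [show W l i = _ from this]
      simp [Pi.single_apply, apply_ite C]
    have e2 := congrArg (fun x => (N *ᵥ x) j) e
    simp only [Matrix.mulVec_mulVec] at e2
    rw [Matrix.mulVec_single_one, Matrix.mulVec_single_one] at e2
    exact e2.trans (congrFun hNa j)
  have hex : ∀ j l, ∃ x, φ x = M j l ∧ ψ x = (N * (C : R →+* R[X]).mapMatrix W) j l :=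
    fun j l => hglue _ _ (congrFun (congrFun hNW.symm j) l)
  choose G hG hG' using hex
  refine ⟨i, Matrix.of G, ?_, ?_⟩
  · rw [Matrix.isUnit_iff_isUnit_det]
    refine hunit _ ?_ ?_
    · have : φ (Matrix.of G).det = M.det := by
        rw [AlgHom.map_det]
        congr 1
        ext1 j l
        exact hG j l
      rw [this]
      exact (Matrix.isUnit_iff_isUnit_det _).1 hM
    · have : ψ (Matrix.of G).det = (N * (C : R →+* R[X]).mapMatrix W).det := by
        rw [AlgHom.map_det]
        congr 1
        ext1 j l
        exact hG' j l
      rw [this]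
      exact (Matrix.isUnit_iff_isUnit_det _).1 (hN.mul (hW.map (C : R →+* R[X]).mapMatrix))
  · rw [Matrix.mulVec_single_one]
    ext j
    refine hinj _ _ ((hG j i).trans (congrFun hMa j)) ((hG' j i).trans (hNWi j))

end IsSuspension

end ZeroCase

section RankOne

open scoped Matrix

/-- A surjective `m × (m + 1)` matrix can be completed to a square matrix of determinant `1`. -/
theorem exists_det_fromRows_eq_one {R κ : Type*} [CommRing R] [Fintype κ] [DecidableEq κ]
    (α : Matrix κ (Unit ⊕ κ) R) (β : Matrix (Unit ⊕ κ) κ R) (h : α * β = 1) :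
    ∃ ρ : Matrix Unit (Unit ⊕ κ) R, (Matrix.fromRows ρ α).det = 1 := by
  let δ : (Unit ⊕ κ → R) →ₗ[R] R := (Matrix.detRowAlternating (R := R)
    (n := Unit ⊕ κ)).toMultilinearMap.toLinearMap (Matrix.fromRows 0 α) (Sum.inl ())
  have hδ : ∀ x, δ x = (Matrix.fromRows (Matrix.replicateRow Unit x) α).det := by
    intro x
    change Matrix.det (Function.update _ _ _) = _
    congr 1
    ext i j
    rcases i with i | i
    · change _ = x j
      exact congrFun (Function.update_self (Sum.inl ()) x (Matrix.fromRows 0 α)) j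
    · change _ = α i j
      exact congrFun
        (Function.update_of_ne (Sum.inr_ne_inl (b := i) (a := ())) x (Matrix.fromRows 0 α)) j
  let γ : Unit ⊕ κ → R := fun j =>
    (Matrix.fromCols (Matrix.replicateCol Unit (Pi.single j 1)) β).det
  have hγ : ∀ j, δ (Pi.single j 1) * γ j = 1 - (β * α) j j := by
    intro j
    rw [hδ, ← Matrix.det_mul, Matrix.fromRows_mul_fromCols, h, Matrix.det_fromBlocks_one₂₂,
      Matrix.det_unique, Matrix.sub_apply, ← Matrix.mul_assoc, Matrix.mul_assoc _ β α]
    simp [Matrix.mul_apply, Pi.single_apply]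
  refine ⟨Matrix.replicateRow Unit (∑ j, γ j • Pi.single j 1), ?_⟩
  rw [← hδ, map_sum]
  have htr : ∑ j, (β * α) j j = Fintype.card κ := by
    change (β * α).trace = _
    rw [Matrix.trace_mul_comm, h, Matrix.trace_one]
  calc ∑ j, δ (γ j • Pi.single j 1) = ∑ j, (1 - (β * α) j j) :=
        Finset.sum_congr rfl fun j _ => by rw [map_smul, smul_eq_mul, mul_comm, hγ]
    _ = 1 := by
        rw [Finset.sum_sub_distrib, htr]
        simp

/-- A stably free module of rank `1` is free. -/
theorem nonempty_linearEquiv_of_prod_of_rank_one {R P κ : Type*} [CommRing R] [AddCommGroup P]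
    [Module R P] [Fintype κ] [DecidableEq κ]
    (e : (P × (κ → R)) ≃ₗ[R] (Unit ⊕ κ → R)) : Nonempty (P ≃ₗ[R] R) := by
  let φ : (Unit ⊕ κ → R) →ₗ[R] (κ → R) := LinearMap.snd R P _ ∘ₗ e.symm.toLinearMap
  let ψ : (κ → R) →ₗ[R] (Unit ⊕ κ → R) := e.toLinearMap ∘ₗ LinearMap.inr R P _
  obtain ⟨ρ, hρ⟩ := exists_det_fromRows_eq_one φ.toMatrix' ψ.toMatrix' (by
    rw [← LinearMap.toMatrix'_comp, ← LinearMap.toMatrix'_id]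
    congr 1
    ext
    simp [φ, ψ])
  have hφ : ∀ x, φ.toMatrix' *ᵥ x = φ x := fun x => by
    rw [← Matrix.toLin'_apply, Matrix.toLin'_toMatrix']
  have hunit : IsUnit (Matrix.fromRows ρ φ.toMatrix') :=
    (Matrix.isUnit_iff_isUnit_det _).2 (hρ ▸ isUnit_one)
  obtain ⟨N, hN⟩ := hunit.exists_left_inv
  have hN' := mul_eq_one_comm.1 hN
  let θ : P →ₗ[R] R := LinearMap.proj () ∘ₗ Matrix.toLin' ρ ∘ₗ e.toLinearMap ∘ₗ
    LinearMap.inl R P _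
  have hθ : ∀ p, θ p = (ρ *ᵥ e (p, 0)) () := fun p => rfl
  refine ⟨LinearEquiv.ofBijective θ ⟨?_, fun t => ?_⟩⟩
  · rw [← LinearMap.ker_eq_bot, LinearMap.ker_eq_bot']
    intro p hp
    have h0 : Matrix.fromRows ρ φ.toMatrix' *ᵥ e (p, 0) = 0 := by
      rw [Matrix.fromRows_mulVec, hφ]
      ext i
      rcases i with i | i
      · exact hp
      · simp [φ]
    have h1 := congrArg (N *ᵥ ·) h0
    simp only [Matrix.mulVec_mulVec, hN, Matrix.one_mulVec, Matrix.mulVec_zero] at h1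
    exact congrArg Prod.fst (e.map_eq_zero_iff.1 h1)
  · obtain ⟨x, hx⟩ : ∃ x, Matrix.fromRows ρ φ.toMatrix' *ᵥ x = Sum.elim (fun _ => t) 0 :=
      ⟨N *ᵥ Sum.elim (fun _ => t) 0, by rw [Matrix.mulVec_mulVec, hN', Matrix.one_mulVec]⟩
    rw [Matrix.fromRows_mulVec, hφ] at hx
    refine ⟨(e.symm x).1, ?_⟩
    have h2 : (e.symm x).2 = 0 := by
      ext i
      exact congrFun hx (Sum.inr i)
    have h3 : e ((e.symm x).1, 0) = x := by
      rw [← h2]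
      exact e.apply_symm_apply x
    rw [hθ, h3]
    exact congrFun hx (Sum.inl ())

theorem subsingleton_of_prod_linearEquiv {R P M : Type*} [CommRing R] [AddCommGroup P]
    [Module R P] [AddCommGroup M] [Module R M] [Module.Finite R M] (e : (P × M) ≃ₗ[R] M) :
    Subsingleton P := by
  have hs : Function.Surjective (LinearMap.snd R P M ∘ₗ e.symm.toLinearMap) :=
    (LinearMap.snd_surjective (R := R) (M := P) (M₂ := M)).comp e.symm.surjective
  have hi := OrzechProperty.injective_of_surjective_endomorphism _ hs
  refine ⟨fun p q => ?_⟩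
  have := hi (a₁ := e (p, 0)) (a₂ := e (q, 0)) (by simp)
  simpa using this

end RankOne

section Cancellative

theorem isCancellative_of_completable {A : Type} [CommRing A] {n : ℕ}
    (H : 2 ≤ n → ∀ r, n ≤ r → ∀ a : Fin (r + 1) → A, Unimodular a → Completable a) :
    IsCancellative A (Fin n → A) := by
  rintro Q _ _ - - m ⟨e⟩
  have c : ((Fin n → A) × (Fin m → A)) ≃ₗ[A] (Fin n ⊕ Fin m → A) :=
    (LinearEquiv.sumArrowLequivProdArrow (Fin n) (Fin m) A A).symm
  rcases n with _ | _ | n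
  · have := subsingleton_of_prod_linearEquiv (e.symm.trans LinearEquiv.uniqueProd)
    exact ⟨LinearEquiv.ofSubsingleton _ _⟩
  · have e1 : (Fin 1 ⊕ Fin m → A) ≃ₗ[A] (Unit ⊕ Fin m → A) :=
      LinearEquiv.funCongrLeft A A (Equiv.sumCongr (Equiv.equivPUnit _).symm (Equiv.refl _))
    obtain ⟨e2⟩ := nonempty_linearEquiv_of_prod_of_rank_one (e.symm.trans (c.trans e1))
    exact ⟨(LinearEquiv.funUnique (Fin 1) A A).trans e2.symm⟩
  · have e1 : (Fin (n + 2) ⊕ Fin m → A) ≃ₗ[A] (Fin (n + 2 + m) → A) :=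
      LinearEquiv.funCongrLeft A A finSumFinEquiv.symm
    obtain ⟨e2⟩ := nonempty_linearEquiv_of_prod_fin (H (by lia)) m (e.symm.trans (c.trans e1))
    exact ⟨e2.symm⟩

end Cancellative

section Quadric

open Polynomial

/-- The coordinate ring of `x₀² + x₁² + f = 0` is a suspension of `f`. -/
theorem isSuspension_of_ker_eq {k B : Type} [Field k] [CommRing B] {n : ℕ}
    (h2 : (2 : k) ≠ 0) {i : k} (hi : i * i = -1) (f : MvPolynomial (Fin n) k)
    (π : MvPolynomial (Fin (n + 2)) k →+* B) (hπ : Function.Surjective π)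
    (hker : RingHom.ker π = Ideal.span {MvPolynomial.X 0 ^ 2 + MvPolynomial.X 1 ^ 2 +
      MvPolynomial.rename (fun j : Fin n => j.succ.succ) f})
    [Algebra (MvPolynomial (Fin n) k) B]
    (halg : ∀ p : MvPolynomial (Fin n) k, algebraMap (MvPolynomial (Fin n) k) B p =
      π (MvPolynomial.rename (fun j : Fin n => j.succ.succ) p)) :
    IsSuspension f (π (MvPolynomial.X 0 + MvPolynomial.C i * MvPolynomial.X 1))
      (π (MvPolynomial.C i * MvPolynomial.X 1 - MvPolynomial.X 0)) := by
  set u := π (MvPolynomial.X 0 + MvPolynomial.C i * MvPolynomial.X 1) with hu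
  set v := π (MvPolynomial.C i * MvPolynomial.X 1 - MvPolynomial.X 0) with hv
  have hC : ∀ c : k, π (MvPolynomial.C c) =
      algebraMap (MvPolynomial (Fin n) k) B (MvPolynomial.C c) := fun c => by
    rw [halg, MvPolynomial.rename_C]
  have hi' : (MvPolynomial.C i * MvPolynomial.C i : MvPolynomial (Fin (n + 2)) k) = -1 := by
    rw [← map_mul, hi, map_neg, map_one]
  have huv : u * v = algebraMap (MvPolynomial (Fin n) k) B f := by
    have h0 : π (MvPolynomial.X 0 ^ 2 + MvPolynomial.X 1 ^ 2 +
        MvPolynomial.rename (fun j : Fin n => j.succ.succ) f) = 0 := by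
      rw [← RingHom.mem_ker, hker]
      exact Ideal.mem_span_singleton_self _
    rw [halg, ← sub_eq_zero, ← neg_eq_zero, hu, hv, ← map_mul, ← map_sub, ← map_neg, ← h0]
    refine congrArg π ?_
    linear_combination (-MvPolynomial.X 1 ^ 2) * hi'
  have hmulu : ∀ x : B, (∃ p q : (MvPolynomial (Fin n) k)[X], x = aeval v p + u * aeval u q) →
      ∃ p q : (MvPolynomial (Fin n) k)[X], u * x = aeval v p + u * aeval u q := by
    rintro _ ⟨p, q, rfl⟩
    refine ⟨C f * p.divX, C (p.coeff 0) + X * q, ?_⟩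
    conv_lhs => rw [← divX_mul_X_add p]
    simp only [map_add, map_mul, aeval_C, aeval_X, ← huv]
    ring
  have hmulv : ∀ x : B, (∃ p q : (MvPolynomial (Fin n) k)[X], x = aeval v p + u * aeval u q) →
      ∃ p q : (MvPolynomial (Fin n) k)[X], v * x = aeval v p + u * aeval u q := by
    rintro _ ⟨p, q, rfl⟩
    refine ⟨X * p + C f * C (q.coeff 0), C f * q.divX, ?_⟩
    conv_lhs => rw [← divX_mul_X_add q]
    simp only [map_add, map_mul, aeval_C, aeval_X, ← huv]
    ring
  have hmulC : ∀ (r : MvPolynomial (Fin n) k) (x : B),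
      (∃ p q : (MvPolynomial (Fin n) k)[X], x = aeval v p + u * aeval u q) →
      ∃ p q : (MvPolynomial (Fin n) k)[X],
        algebraMap (MvPolynomial (Fin n) k) B r * x = aeval v p + u * aeval u q := by
    rintro r _ ⟨p, q, rfl⟩
    refine ⟨C r * p, C r * q, ?_⟩
    simp only [map_mul, aeval_C]
    ring
  have hadd : ∀ x y : B, (∃ p q : (MvPolynomial (Fin n) k)[X], x = aeval v p + u * aeval u q) →
      (∃ p q : (MvPolynomial (Fin n) k)[X], y = aeval v p + u * aeval u q) →
      ∃ p q : (MvPolynomial (Fin n) k)[X], x + y = aeval v p + u * aeval u q := by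
    rintro _ _ ⟨p, q, rfl⟩ ⟨p', q', rfl⟩
    refine ⟨p + p', q + q', ?_⟩
    simp only [map_add]
    ring
  have hhalf : (MvPolynomial.C (2⁻¹ : k) * 2 : MvPolynomial (Fin (n + 2)) k) = 1 := by
    rw [show (2 : MvPolynomial (Fin (n + 2)) k) = MvPolynomial.C 2 from (map_ofNat _ 2).symm,
      ← map_mul, inv_mul_cancel₀ h2, map_one]
  have hX0 : π (MvPolynomial.X 0) = algebraMap (MvPolynomial (Fin n) k) B (MvPolynomial.C 2⁻¹) * u
      + algebraMap (MvPolynomial (Fin n) k) B (MvPolynomial.C (-2⁻¹)) * v := by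
    rw [← hC, ← hC, hu, hv, ← map_mul, ← map_mul, ← map_add, map_neg]
    refine congrArg π ?_
    linear_combination (-MvPolynomial.X 0) * hhalf
  have hX1 : π (MvPolynomial.X 1) =
      algebraMap (MvPolynomial (Fin n) k) B (MvPolynomial.C (-2⁻¹ * i)) * u
      + algebraMap (MvPolynomial (Fin n) k) B (MvPolynomial.C (-2⁻¹ * i)) * v := by
    rw [← hC, hu, hv, ← map_mul, ← map_mul, ← map_add, map_mul, map_neg]
    refine congrArg π ?_
    linear_combination (-MvPolynomial.X 1) * hhalf +
      2 * MvPolynomial.C 2⁻¹ * MvPolynomial.X 1 * hi'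
  refine ⟨huv, fun x => ?_, fun {S} _ φ u' v' huv' => ?_⟩
  · obtain ⟨x, rfl⟩ := hπ x
    induction x using MvPolynomial.induction_on with
    | C c => exact ⟨C (MvPolynomial.C c), 0, by rw [hC]; simp⟩
    | add x y hx hy => rw [map_add]; exact hadd _ _ hx hy
    | mul_X x j hx =>
      rw [map_mul, mul_comm]
      cases j using Fin.cases with
      | zero =>
        rw [hX0, add_mul, mul_assoc, mul_assoc]
        exact hadd _ _ (hmulC _ _ (hmulu _ hx)) (hmulC _ _ (hmulv _ hx))
      | succ j =>
        cases j using Fin.cases with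
        | zero =>
          rw [Fin.succ_zero_eq_one, hX1, add_mul, mul_assoc, mul_assoc]
          exact hadd _ _ (hmulC _ _ (hmulu _ hx)) (hmulC _ _ (hmulv _ hx))
        | succ j =>
          have : π (MvPolynomial.X j.succ.succ) =
              algebraMap (MvPolynomial (Fin n) k) B (MvPolynomial.X j) := by
            rw [halg, MvPolynomial.rename_X]
          rw [this]
          exact hmulC _ _ hx
  · let g : Fin (n + 2) → S := Fin.cons (φ (MvPolynomial.C 2⁻¹) * (u' - v'))
      (Fin.cons (φ (MvPolynomial.C (-2⁻¹ * i)) * (u' + v')) fun j => φ (MvPolynomial.X j))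
    let ψ := MvPolynomial.eval₂Hom (φ.comp MvPolynomial.C) g
    have hψ0 : ψ (MvPolynomial.X 0) = φ (MvPolynomial.C 2⁻¹) * (u' - v') :=
      MvPolynomial.eval₂Hom_X' _ _ _
    have hψ1 : ψ (MvPolynomial.X 1) = φ (MvPolynomial.C (-2⁻¹ * i)) * (u' + v') :=
      MvPolynomial.eval₂Hom_X' _ _ _
    have hψC : ∀ c, ψ (MvPolynomial.C c) = φ (MvPolynomial.C c) :=
      MvPolynomial.eval₂Hom_C _ _
    have hψR : ∀ p, ψ (MvPolynomial.rename (fun j : Fin n => j.succ.succ) p) = φ p := by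
      intro p
      have : (ψ.comp (MvPolynomial.rename (R := k) (fun j : Fin n => j.succ.succ) :
          MvPolynomial (Fin n) k →+* MvPolynomial (Fin (n + 2)) k)) = φ := by
        refine MvPolynomial.ringHom_ext (fun c => ?_) fun j => ?_
        · rw [RingHom.comp_apply, RingHom.coe_coe, MvPolynomial.rename_C, hψC]
        · rw [RingHom.comp_apply, RingHom.coe_coe, MvPolynomial.rename_X]
          exact MvPolynomial.eval₂Hom_X' _ _ _
      exact RingHom.congr_fun this p
    have hhalf' : φ (MvPolynomial.C 2⁻¹) * 2 = 1 := by
      rw [← map_ofNat (φ.comp MvPolynomial.C) 2, RingHom.comp_apply, ← map_mul, ← map_mul,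
        inv_mul_cancel₀ h2, map_one, map_one]
    have hi'' : φ (MvPolynomial.C i) * φ (MvPolynomial.C i) = -1 := by
      rw [← map_mul, ← map_mul, hi, map_neg, map_neg, map_one, map_one]
    have hle : RingHom.ker π ≤ RingHom.ker ψ := by
      rw [hker, Ideal.span_singleton_le_iff_mem, RingHom.mem_ker, map_add, map_add, map_pow,
        map_pow, hψ0, hψ1, hψR, ← huv']
      simp only [map_mul, map_neg]
      linear_combination (φ (MvPolynomial.C 2⁻¹) ^ 2 * (u' + v') ^ 2) * hi'' -
        (φ (MvPolynomial.C 2⁻¹) * 2 + 1) * u' * v' * hhalf'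
    have hlift : ∀ x, π.liftOfSurjective hπ ⟨ψ, hle⟩ (π x) = ψ x := fun x =>
      RingHom.liftOfRightInverse_comp_apply π _ (Function.rightInverse_surjInv hπ) ⟨ψ, hle⟩ x
    refine ⟨π.liftOfSurjective hπ ⟨ψ, hle⟩, ?_, ?_, ?_⟩
    · refine RingHom.ext fun p => ?_
      rw [RingHom.comp_apply, halg, hlift, hψR]
    · rw [hu, hlift, map_add, map_mul, hψ0, hψ1, hψC]
      simp only [map_mul, map_neg]
      linear_combination u' * hhalf' - φ (MvPolynomial.C 2⁻¹) * (u' + v') * hi''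
    · rw [hv, hlift, map_sub, map_mul, hψ0, hψ1, hψC]
      simp only [map_mul, map_neg]
      linear_combination v' * hhalf' - φ (MvPolynomial.C 2⁻¹) * (u' + v') * hi''

theorem completable_quadric {k B : Type} [Field k] [IsAlgClosed k] [CommRing B] {n : ℕ}
    (h2 : 2 ≤ n) (hfac : (n.factorial : k) ≠ 0) (f : MvPolynomial (Fin n) k)
    (π : MvPolynomial (Fin (n + 2)) k →+* B) (hπ : Function.Surjective π)
    (hker : RingHom.ker π = Ideal.span {MvPolynomial.X 0 ^ 2 + MvPolynomial.X 1 ^ 2 +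
      MvPolynomial.rename (fun j : Fin n => j.succ.succ) f}) {r : ℕ} (hr : n ≤ r)
    {a : Fin (r + 1) → B} (ha : Unimodular a) : Completable a := by
  have h20 : (2 : k) ≠ 0 := by
    intro h0
    refine hfac ?_
    obtain ⟨c, hc⟩ := Nat.dvd_factorial two_pos h2
    rw [hc, Nat.cast_mul, Nat.cast_two, h0, zero_mul]
  obtain ⟨i, hi⟩ := IsAlgClosed.exists_pow_nat_eq (-1 : k) two_pos
  let _ : Algebra (MvPolynomial (Fin n) k) B := (π.comp
    (MvPolynomial.rename (R := k) (fun j : Fin n => j.succ.succ) :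
      MvPolynomial (Fin n) k →+* MvPolynomial (Fin (n + 2)) k)).toAlgebra
  have h := isSuspension_of_ker_eq h20 ((pow_two i).symm.trans hi) f π hπ hker fun _ => rfl
  obtain ⟨r, rfl⟩ : ∃ r', r = r' + 1 := ⟨r - 1, by lia⟩
  by_cases hf : f = 0
  · subst hf
    exact h.completable_of_zero (completable_polynomial_mvPolynomial n) ha
  · exact h.completable hf hr (fun hn => hn ▸ hfac) ha

end Quadric

set_option synthInstance.maxHeartbeats 1000000 in
set_option maxHeartbeats 2000000 in
theorem statement13
    (k : Type) [Field k] [IsAlgClosed k]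
    (d : ℕ) (hd : 1 ≤ d) (hfac : IsUnit ((d - 1).factorial : k))
    -- `f ∈ k[x₂, …, x_d]`
    (f : MvPolynomial (Fin (d + 1)) k)
    (hf : f ∈ MvPolynomial.supported k {i : Fin (d + 1) | 2 ≤ (i : ℕ)}) :
    -- `A = k[x₀, x₁, …, x_d] / (x₀² + x₁² + f(x₂, …, x_d))`, and `A^{d-1}` is cancellative
    IsCancellative
      (MvPolynomial (Fin (d + 1)) k ⧸
        Ideal.span {MvPolynomial.X 0 ^ 2 + MvPolynomial.X 1 ^ 2 + f})
      (Fin (d - 1) →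
        MvPolynomial (Fin (d + 1)) k ⧸
          Ideal.span {MvPolynomial.X 0 ^ 2 + MvPolynomial.X 1 ^ 2 + f}) := by
  refine isCancellative_of_completable fun h2 r hr a ha => ?_
  obtain ⟨n, rfl⟩ : ∃ n, d = n + 1 := ⟨d - 1, by lia⟩
  rw [Nat.add_sub_cancel] at h2 hr hfac
  obtain ⟨f, rfl⟩ := MvPolynomial.exists_rename_eq_of_vars_subset_range f
    (fun j : Fin n => j.succ.succ) ((Fin.succ_injective _).comp (Fin.succ_injective _)) (by
      refine (MvPolynomial.mem_supported.1 hf).trans fun i hi => ?_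
      have hi : 2 ≤ (i : ℕ) := hi
      exact ⟨⟨i - 2, by lia⟩, Fin.ext (by simp; lia)⟩)
  exact completable_quadric h2 hfac.ne_zero f (Ideal.Quotient.mk _) Ideal.Quotient.mk_surjective
    Ideal.mk_ker hr ha
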